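/- arXiv:2105.11930 — 2 statements merged into one kernel-verified Lean document; each statement's English description precedes it below -/
import Mathlib

section
/- Let X₀ be a smooth, embedded, closed plane curve, star-shaped and centrosymmetric with respect to the origin O, and suppose Gage's area-preserving flow with initial curve X₀ has a smooth solution X(·,t) on [0,ω). If for some t ∈ [0,ω) the evolving curve X(·,t) is star-shaped with respect to some point of the plane, then O itself is one of its star centers, i.e., X(·,t) is star-shaped with respect to O. -/
open Real Set MeasureTheory Filter

noncomputable section

/-- Euclidean norm of a plane vector. -/
def vnorm (v : ℝ × ℝ) : ℝ := Real.sqrt (v.1 ^ 2 + v.2 ^ 2)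

/-- Determinant of the 2×2 matrix whose rows are the plane vectors `a`, `b`. -/
def vdet (a b : ℝ × ℝ) : ℝ := a.1 * b.2 - a.2 * b.1

/-- Unit tangent vector of a plane curve. -/
def unitTangent (X : ℝ → ℝ × ℝ) (φ : ℝ) : ℝ × ℝ :=
  (vnorm (deriv X φ))⁻¹ • deriv X φ

/-- Inward unit normal: the rotation of the unit tangent by +π/2. -/
def innerNormal (X : ℝ → ℝ × ℝ) (φ : ℝ) : ℝ × ℝ :=
  (-(unitTangent X φ).2, (unitTangent X φ).1)

/-- Curvature of a plane curve. -/
def curv (X : ℝ → ℝ × ℝ) (φ : ℝ) : ℝ :=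
  vdet (deriv X φ) (deriv (deriv X) φ) / vnorm (deriv X φ) ^ 3

/-- Length of a closed plane curve parametrized on `[0, 2π]`. -/
def clen (X : ℝ → ℝ × ℝ) : ℝ := ∫ φ in (0:ℝ)..(2 * π), vnorm (deriv X φ)

/-- Enclosed area of a closed plane curve. -/
def carea (X : ℝ → ℝ × ℝ) : ℝ :=
  (1 / 2) * ∫ φ in (0:ℝ)..(2 * π), vdet (X φ) (deriv X φ)

/-- A smooth closed plane curve: a smooth `2π`-periodic map `ℝ → ℝ²` with
nonvanishing derivative. -/
structure IsSmoothClosedCurve (X : ℝ → ℝ × ℝ) : Prop where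
  smooth : ContDiff ℝ (⊤ : ℕ∞) X
  periodic : Function.Periodic X (2 * π)
  regular : ∀ φ, deriv X φ ≠ 0

/-- An embedded closed curve: injective over one period. -/
def IsEmbeddedCurve (X : ℝ → ℝ × ℝ) : Prop := Set.InjOn X (Set.Ico 0 (2 * π))

/-- Star-shapedness with respect to a point `O`: `det(X − O, T) > 0` everywhere. -/
def StarShapedWrt (X : ℝ → ℝ × ℝ) (O : ℝ × ℝ) : Prop :=
  ∀ φ, 0 < vdet (X φ - O) (unitTangent X φ)

/-- Centrosymmetry with respect to a point `O`: the image of the curve is invariant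
under the point reflection `Z ↦ 2O − Z`. -/
def CentroSymmetricWrt (X : ℝ → ℝ × ℝ) (O : ℝ × ℝ) : Prop :=
  (fun Z => (2 : ℝ) • O - Z) '' Set.range X = Set.range X

/-- `X` is a smooth solution of Gage's area-preserving flow on the time set `I`
with initial curve `X₀`: `∂X/∂t = α T + (κ − 2π/L) N`. -/
structure IsGAPFSolutionOn (X : ℝ → ℝ → ℝ × ℝ) (X₀ : ℝ → ℝ × ℝ) (I : Set ℝ) : Prop where
  init : ∀ φ, X 0 φ = X₀ φ
  curve : ∀ t ∈ I, IsSmoothClosedCurve (X t)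
  smooth : ContDiffOn ℝ (⊤ : ℕ∞) (fun p : ℝ × ℝ => X p.1 p.2) (I ×ˢ Set.univ)
  flow : ∃ α : ℝ → ℝ → ℝ,
    ∀ t ∈ I, ∀ φ,
      HasDerivWithinAt (fun τ => X τ φ)
        (α t φ • unitTangent (X t) φ +
          (curv (X t) φ - 2 * π / clen (X t)) • innerNormal (X t) φ) I t



theorem crv_lip {X X1 : ℝ → ℂ} {M : ℝ} (h1 : ∀ φ, HasDerivAt X (X1 φ) φ)
    (hM : ∀ φ, ‖X1 φ‖ ≤ M) (a b : ℝ) : ‖X b - X a‖ ≤ M * |b - a| := by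
  have := Convex.norm_image_sub_le_of_norm_hasDerivWithin_le (f := X) (f' := X1) (s := univ)
    (x := a) (y := b) (C := M)
    (fun x _ => (h1 x).hasDerivWithinAt) (fun x _ => hM x) convex_univ (mem_univ _) (mem_univ _)
  simpa using this

theorem crv_taylor1 {X X1 X2 : ℝ → ℂ} {M : ℝ} (h1 : ∀ φ, HasDerivAt X (X1 φ) φ)
    (h2 : ∀ φ, HasDerivAt X1 (X2 φ) φ) (hM : ∀ φ, ‖X2 φ‖ ≤ M) (a b : ℝ) :
    ‖X b - X a - (b - a) • X1 a‖ ≤ M * (b - a) ^ 2 := by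
  have hM0 : 0 ≤ M := (norm_nonneg _).trans (hM 0)
  have := Convex.norm_image_sub_le_of_norm_hasDerivWithin_le
    (f := fun x => X x - (x - a) • X1 a) (f' := fun x => X1 x - X1 a) (s := uIcc a b)
    (x := a) (y := b) (C := M * |b - a|)
    (fun x _ => by
      have h := ((h1 x).sub (((hasDerivAt_id x).sub_const a).smul_const (X1 a)))
      refine (h.congr_deriv ?_).hasDerivWithinAt
      simp)
    (fun x hx => by
      refine (crv_lip h2 hM a x).trans ?_
      gcongr M * ?_
      exact abs_sub_left_of_mem_uIcc hx)
    (convex_uIcc a b) left_mem_uIcc right_mem_uIcc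
  rw [Real.norm_eq_abs] at this
  calc _ = ‖X b - (b - a) • X1 a - (X a - (a - a) • X1 a)‖ := by congr 1; simp; ring
    _ ≤ _ := this
    _ = _ := by rw [mul_assoc, ← sq, sq_abs]

theorem crv_taylor2 {X X1 X2 : ℝ → ℂ} (h1 : ∀ φ, HasDerivAt X (X1 φ) φ)
    (h2 : ∀ φ, HasDerivAt X1 (X2 φ) φ) (a : ℝ) {ε : ℝ} (hε : 0 < ε) :
    ∃ ρ > 0, ∀ x, |x| < ρ →
      ‖X (a + x) - X a - x • X1 a - (x ^ 2 / 2) • X2 a‖ ≤ ε * x ^ 2 := by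
  have h := (h2 a).isLittleO.def hε
  rw [Metric.eventually_nhds_iff] at h
  obtain ⟨ρ, hρ, h⟩ := h
  refine ⟨ρ, hρ, fun x hx => ?_⟩
  have := Convex.norm_image_sub_le_of_norm_hasDerivWithin_le
    (f := fun z => X z - (z - a) • X1 a - ((z - a) ^ 2 / 2) • X2 a)
    (f' := fun z => X1 z - X1 a - (z - a) • X2 a) (s := uIcc a (a + x))
    (x := a) (y := a + x) (C := ε * |x|)
    (fun z _ => by
      have e := (((hasDerivAt_id z).sub_const a).pow 2).div_const 2
      have h := ((h1 z).sub (((hasDerivAt_id z).sub_const a).smul_const (X1 a))).sub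
        (e.smul_const (X2 a))
      refine (h.congr_deriv ?_).hasDerivWithinAt
      simp)
    (fun z hz => by
      have hz' : |z - a| ≤ |x| := by simpa using abs_sub_left_of_mem_uIcc hz
      refine (h (y := z) (by rw [Real.dist_eq]; linarith)).trans ?_
      rw [Real.norm_eq_abs]
      gcongr)
    (convex_uIcc _ _) left_mem_uIcc right_mem_uIcc
  rw [Real.norm_eq_abs] at this
  simp only [add_sub_cancel_left] at this
  calc _ = ‖X (a + x) - x • X1 a - (x ^ 2 / 2) • X2 a -
        (X a - (a - a) • X1 a - ((a - a) ^ 2 / 2) • X2 a)‖ := by congr 1; simp; ring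
    _ ≤ _ := this
    _ = _ := by rw [mul_assoc, ← sq, sq_abs]

theorem crv_inj {X X1 X2 : ℝ → ℂ} {M c : ℝ} (h1 : ∀ φ, HasDerivAt X (X1 φ) φ)
    (h2 : ∀ φ, HasDerivAt X1 (X2 φ) φ) (hM : ∀ φ, ‖X2 φ‖ ≤ M) (hc : ∀ φ, c ≤ ‖X1 φ‖)
    (a b : ℝ) (hab : M * |b - a| ≤ c / 2) : c / 2 * |b - a| ≤ ‖X b - X a‖ := by
  have h := crv_taylor1 h1 h2 hM a b
  have h3 : ‖(b - a) • X1 a‖ ≤ ‖X b - X a‖ + ‖X b - X a - (b - a) • X1 a‖ := by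
    have := norm_sub_le (X b - X a) (X b - X a - (b - a) • X1 a)
    simpa using this
  rw [norm_smul, Real.norm_eq_abs] at h3
  rw [← sq_abs] at h
  nlinarith [hc a, abs_nonneg (b - a)]

theorem quad_lemma {a A B C : ℝ} (hC : 0 < C)
    (h : ∀ ε > 0, ∃ ρ > 0, ∀ x, |x| < ρ → ∃ y,
      a * x + A * x ^ 2 + 2 * B * x * y + C * y ^ 2 - ε * (x ^ 2 + y ^ 2) ≤ 0) :
    a = 0 ∧ A * C ≤ B ^ 2 := by
  have key : ∀ ε > 0, ε < C → ∃ ρ > 0, ∀ x, |x| < ρ →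
      (C - ε) * a * x + ((A - ε) * (C - ε) - B ^ 2) * x ^ 2 ≤ 0 := by
    intro ε hε hεC
    obtain ⟨ρ, hρ, hh⟩ := h ε hε
    refine ⟨ρ, hρ, fun x hx => ?_⟩
    obtain ⟨y, hy⟩ := hh x hx
    have h1 : 0 < C - ε := by linarith
    have h2 := mul_le_mul_of_nonneg_left hy h1.le
    nlinarith [sq_nonneg ((C - ε) * y + B * x)]
  have ha : a = 0 := by
    obtain ⟨ρ, hρ, hh⟩ := key (C / 2) (by linarith) (by linarith)
    have : ∀ x, |x| < ρ → (C - C/2) * a * x ≤ -((A - C/2) * (C - C/2) - B ^ 2) * x ^ 2 :=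
      fun x hx => by linarith [hh x hx]
    by_contra hne
    set Q := -((A - C/2) * (C - C/2) - B ^ 2)
    set p := (C - C/2) * a with hp
    have hp0 : p ≠ 0 := mul_ne_zero (by linarith) hne
    have hp' : 0 < |p| := abs_pos.2 hp0
    have hs : ∀ s, 0 < s → s < ρ → |p| ≤ |Q| * s := by
      intro s hs hsρ
      rcases lt_or_gt_of_ne hp0 with h0 | h0
      · have := this (-s) (by rw [abs_neg, abs_of_pos hs]; exact hsρ)
        rw [abs_of_neg h0]
        have h3 : s * (-p) ≤ s * (|Q| * s) := by nlinarith [le_abs_self Q, sq_nonneg s]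
        exact le_of_mul_le_mul_left h3 hs
      · have := this s (by rw [abs_of_pos hs]; exact hsρ)
        rw [abs_of_pos h0]
        have h3 : s * p ≤ s * (|Q| * s) := by nlinarith [le_abs_self Q, sq_nonneg s]
        exact le_of_mul_le_mul_left h3 hs
    have hq : 0 < |Q| + 1 := by positivity
    have h5 := hs (min (ρ/2) (|p| / (2 * (|Q| + 1)))) (by positivity)
      (lt_of_le_of_lt (min_le_left _ _) (by linarith))
    have h6 : |Q| * min (ρ/2) (|p| / (2 * (|Q| + 1))) ≤ (|Q| + 1) * (|p| / (2 * (|Q| + 1))) := by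
      gcongr
      · linarith
      · exact min_le_right _ _
    have h7 : (|Q| + 1) * (|p| / (2 * (|Q| + 1))) = |p| / 2 := by field_simp
    linarith
  refine ⟨ha, ?_⟩
  subst ha
  have key2 : ∀ ε > 0, ε < C → (A - ε) * (C - ε) ≤ B ^ 2 := by
    intro ε hε hεC
    obtain ⟨ρ, hρ, hh⟩ := key ε hε hεC
    have := hh (ρ / 2) (by rw [abs_of_pos (by linarith)]; linarith)
    have h3 : 0 < (ρ / 2) ^ 2 := by positivity
    by_contra hcon
    push Not at hcon
    nlinarith [mul_pos (sub_pos.2 hcon) h3]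
  have ht : Tendsto (fun ε : ℝ => (A - ε) * (C - ε)) (nhdsWithin 0 (Ioi 0)) (nhds (A * C)) := by
    have : Continuous (fun ε : ℝ => (A - ε) * (C - ε)) := by fun_prop
    have := this.tendsto 0
    simp only [sub_zero] at this
    exact this.mono_left nhdsWithin_le_nhds
  refine le_of_tendsto ht ?_
  filter_upwards [Ioo_mem_nhdsGT hC] with ε hε
  exact key2 ε hε.1 hε.2

theorem norm_sq_expand (W v u R : ℂ) : ‖W + (v + (u + R))‖ ^ 2 = ‖W‖ ^ 2 + 2 * inner ℝ W v + 2 * inner ℝ W u +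
      2 * inner ℝ W R + ‖v‖ ^ 2 + 2 * inner ℝ v (u + R) + ‖u + R‖ ^ 2 := by
  rw [norm_add_sq_real W, norm_add_sq_real v, inner_add_right W, inner_add_right W]; ring

set_option maxHeartbeats 1000000 in
/-- lower quadratic expansion of the squared norm -/
theorem quad_expand {X X1 X2 : ℝ → ℂ} (h1 : ∀ φ, HasDerivAt X (X1 φ) φ)
    (h2 : ∀ φ, HasDerivAt X1 (X2 φ) φ) (a b : ℝ) {ε : ℝ} (hε : 0 < ε) :
    ∃ ρ > 0, ∀ x y, |x| < ρ → |y| < ρ →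
      ‖X a + X b‖ ^ 2 + 2 * inner ℝ (X a + X b) (X1 a) * x + 2 * inner ℝ (X a + X b) (X1 b) * y
      + (‖X1 a‖ ^ 2 + inner ℝ (X a + X b) (X2 a)) * x ^ 2 + 2 * inner ℝ (X1 a) (X1 b) * x * y
      + (‖X1 b‖ ^ 2 + inner ℝ (X a + X b) (X2 b)) * y ^ 2 - ε * (x ^ 2 + y ^ 2)
      ≤ ‖X (a + x) + X (b + y)‖ ^ 2 := by
  set W := X a + X b with hW
  set C := ‖W‖ + ‖X1 a‖ + ‖X1 b‖ + ‖X2 a‖ + ‖X2 b‖ + 1 with hC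
  have hC1 : 1 ≤ C := by rw [hC]; linarith [norm_nonneg W, norm_nonneg (X1 a), norm_nonneg (X1 b), norm_nonneg (X2 a), norm_nonneg (X2 b)]
  set e := min 1 (ε / (4 * C)) with he
  have hC0 : 0 < C := by linarith
  have he0 : 0 < e := by positivity
  obtain ⟨ρ1, hρ1, H1⟩ := crv_taylor2 h1 h2 a he0
  obtain ⟨ρ2, hρ2, H2⟩ := crv_taylor2 h1 h2 b he0
  refine ⟨min (min ρ1 ρ2) (ε / (16 * C ^ 2)), by positivity, fun x y hx hy => ?_⟩
  simp only [lt_min_iff] at hx hy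
  set R := (X (a + x) - X a - x • X1 a - (x ^ 2 / 2) • X2 a) +
    (X (b + y) - X b - y • X1 b - (y ^ 2 / 2) • X2 b) with hR
  have hRn : ‖R‖ ≤ e * (x ^ 2 + y ^ 2) := by
    refine (norm_add_le _ _).trans ?_
    linarith [H1 x hx.1.1, H2 y hy.1.2]
  set v := x • X1 a + y • X1 b with hv
  set u := (x ^ 2 / 2) • X2 a + (y ^ 2 / 2) • X2 b with hu
  have hsum : X (a + x) + X (b + y) = W + (v + (u + R)) := by
    rw [hR, hv, hu, hW]; abel
  have hun : ‖u + R‖ ≤ 2 * C * (x ^ 2 + y ^ 2) := by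
    have h3 : ‖u‖ ≤ (x ^ 2 / 2) * ‖X2 a‖ + (y ^ 2 / 2) * ‖X2 b‖ := by
      refine (norm_add_le _ _).trans ?_
      rw [norm_smul, norm_smul, Real.norm_of_nonneg (by positivity), Real.norm_of_nonneg (by positivity)]
    have h4 : ‖X2 a‖ ≤ C := by rw [hC]; linarith [norm_nonneg W, norm_nonneg (X1 a), norm_nonneg (X1 b), norm_nonneg (X2 a), norm_nonneg (X2 b)]
    have h5 : ‖X2 b‖ ≤ C := by rw [hC]; linarith [norm_nonneg W, norm_nonneg (X1 a), norm_nonneg (X1 b), norm_nonneg (X2 a), norm_nonneg (X2 b)]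
    have h6 : e ≤ C := (min_le_left _ _).trans hC1
    have := norm_add_le u R
    nlinarith [sq_nonneg x, sq_nonneg y]
  have hvn : ‖v‖ ≤ ε / (8 * C) := by
    have h3 : ‖v‖ ≤ |x| * ‖X1 a‖ + |y| * ‖X1 b‖ := by
      refine (norm_add_le _ _).trans ?_
      rw [norm_smul, norm_smul, Real.norm_eq_abs, Real.norm_eq_abs]
    have h4 : ‖X1 a‖ + ‖X1 b‖ ≤ C := by rw [hC]; linarith [norm_nonneg W, norm_nonneg (X1 a), norm_nonneg (X1 b), norm_nonneg (X2 a), norm_nonneg (X2 b)]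
    have h5 : |x| * ‖X1 a‖ + |y| * ‖X1 b‖ ≤ (ε / (16 * C ^ 2)) * C := by
      nlinarith [norm_nonneg (X1 a), norm_nonneg (X1 b), hx.2, hy.2, abs_nonneg x, abs_nonneg y,
        mul_le_mul_of_nonneg_right hx.2.le (norm_nonneg (X1 a)),
        mul_le_mul_of_nonneg_right hy.2.le (norm_nonneg (X1 b)),
        mul_le_mul_of_nonneg_left h4 (by positivity : 0 ≤ ε / (16 * C ^ 2))]
    have h6 : (ε / (16 * C ^ 2)) * C = ε / (8 * C) / 2 := by field_simp; ring
    have : 0 < ε / (8 * C) := by positivity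
    linarith
  have hip : -(‖v‖ * ‖u + R‖) ≤ inner ℝ v (u + R) := by
    have := abs_real_inner_le_norm v (u + R)
    linarith [neg_abs_le (inner ℝ v (u + R))]
  have hprod : ‖v‖ * ‖u + R‖ ≤ ε / 4 * (x ^ 2 + y ^ 2) := by
    calc _ ≤ ε / (8 * C) * (2 * C * (x ^ 2 + y ^ 2)) := by gcongr
      _ = _ := by field_simp; ring
  have hWR : -(ε / 4 * (x ^ 2 + y ^ 2)) ≤ inner ℝ W R := by
    have := abs_real_inner_le_norm W R
    have h3 : ‖W‖ * ‖R‖ ≤ ε / 4 * (x ^ 2 + y ^ 2) := by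
      have hWC : ‖W‖ ≤ C := by rw [hC]; linarith [norm_nonneg W, norm_nonneg (X1 a), norm_nonneg (X1 b), norm_nonneg (X2 a), norm_nonneg (X2 b)]
      calc _ ≤ C * (ε / (4 * C) * (x ^ 2 + y ^ 2)) := by
            gcongr
            refine hRn.trans ?_
            gcongr
            exact min_le_right _ _
        _ = _ := by field_simp
    linarith [neg_abs_le (inner ℝ W R)]
  have hexp := norm_sq_expand W v u R
  have hWv : inner ℝ W v = x * inner ℝ W (X1 a) + y * inner ℝ W (X1 b) := by
    rw [hv, inner_add_right, inner_smul_right, inner_smul_right]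
  have hWu : inner ℝ W u = x ^ 2 / 2 * inner ℝ W (X2 a) + y ^ 2 / 2 * inner ℝ W (X2 b) := by
    rw [hu, inner_add_right, inner_smul_right, inner_smul_right]
  have hvv : ‖v‖ ^ 2 = x ^ 2 * ‖X1 a‖ ^ 2 + 2 * x * y * inner ℝ (X1 a) (X1 b) + y ^ 2 * ‖X1 b‖ ^ 2 := by
    rw [hv, norm_add_sq_real, norm_smul, norm_smul, mul_pow, mul_pow, Real.norm_eq_abs, Real.norm_eq_abs, sq_abs, sq_abs,
      inner_smul_left, inner_smul_right]
    simp; ring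
  rw [hsum, hexp, hWv, hWu, hvv]
  linarith [sq_nonneg ‖u + R‖]

def cdet (z w : ℂ) : ℝ := z.re * w.im - z.im * w.re

theorem cinner (z w : ℂ) : inner ℝ z w = z.re * w.re + z.im * w.im := by
  rw [Complex.inner]; simp; ring

theorem cnormsq (z : ℂ) : ‖z‖ ^ 2 = z.re ^ 2 + z.im ^ 2 := by
  rw [Complex.sq_norm, Complex.normSq_apply]; ring

theorem cdet_abs_le (z w : ℂ) : |cdet z w| ≤ ‖z‖ * ‖w‖ := by
  apply abs_le_of_sq_le_sq _ (by positivity)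
  rw [mul_pow, cnormsq, cnormsq, cdet]
  nlinarith [sq_nonneg (z.re * w.re + z.im * w.im)]

theorem cdet_zero_of_perp {W p q : ℂ} (hW : W ≠ 0) (hp : inner ℝ W p = 0) (hq : inner ℝ W q = 0) :
    cdet p q = 0 := by
  rw [cinner] at hp hq
  have h1 : W.re * cdet p q = 0 := by unfold cdet; linear_combination q.im * hp - p.im * hq
  have h2 : W.im * cdet p q = 0 := by unfold cdet; linear_combination p.re * hq - q.re * hp
  by_contra h
  exact hW (Complex.ext (by simpa [h] using h1) (by simpa [h] using h2))

theorem par_of_cdet {p q : ℂ} (hp : p ≠ 0) (h : cdet p q = 0) :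
    q = ((inner ℝ p q) / ‖p‖ ^ 2 : ℝ) • p := by
  have hp' : ‖p‖ ^ 2 ≠ 0 := by positivity
  have h2 : ‖p‖ ^ 2 • q = (inner ℝ p q) • p := by
    rw [cnormsq, cinner]
    unfold cdet at h
    apply Complex.ext
    · simp [-Complex.ofReal_add, -Complex.ofReal_mul, -Complex.ofReal_pow]; linear_combination (-p.im) * h
    · simp [-Complex.ofReal_add, -Complex.ofReal_mul, -Complex.ofReal_pow]; linear_combination p.re * h
  rw [div_eq_inv_mul, mul_smul, ← h2, smul_smul, inv_mul_cancel₀ hp', one_smul]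

theorem kappa_bound {p P : ℂ} {c M : ℝ} (hc : 0 < c) (hp : c ≤ ‖p‖) (hP : ‖P‖ ≤ M) :
    |cdet p P / ‖p‖ ^ 3| ≤ M / c ^ 2 := by
  have hp0 : 0 < ‖p‖ := by linarith
  have hM : 0 ≤ M := (norm_nonneg _).trans hP
  rw [abs_div, abs_of_pos (by positivity : 0 < ‖p‖ ^ 3)]
  calc _ ≤ ‖p‖ * M / ‖p‖ ^ 3 := by
        gcongr; exact (cdet_abs_le p P).trans (by gcongr)
    _ = M / ‖p‖ ^ 2 := by field_simp
    _ ≤ _ := by gcongr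

theorem speed_bound {p P q Q W Va Vb : ℂ} {h c M : ℝ} (hc : 0 < c) (hp : c ≤ ‖p‖) (hq : c ≤ ‖q‖)
    (hP : ‖P‖ ≤ M) (hQ : ‖Q‖ ≤ M) (hW : W ≠ 0) (hWp : inner ℝ W p = 0) (hWq : inner ℝ W q = 0)
    (hpq : inner ℝ p q < 0)
    (hdisc : (‖p‖ ^ 2 + inner ℝ W P) * (‖q‖ ^ 2 + inner ℝ W Q) ≤ (inner ℝ p q) ^ 2)
    (hVa : cdet p Va = cdet p P / ‖p‖ ^ 2 - h * ‖p‖)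
    (hVb : cdet q Vb = cdet q Q / ‖q‖ ^ 2 - h * ‖q‖) :
    2 * inner ℝ W (Va + Vb) ≤ 2 * (M / c ^ 2) ^ 2 * ‖W‖ ^ 2 := by
  have hn : 0 < ‖p‖ := by linarith
  have hp0 : p ≠ 0 := norm_pos_iff.1 hn
  have hka := kappa_bound hc hp hP
  have hkb := kappa_bound hc hq hQ
  set ka := cdet p P / ‖p‖ ^ 3 with hkadef
  set kb := cdet q Q / ‖q‖ ^ 3 with hkbdef
  have hqp := par_of_cdet hp0 (cdet_zero_of_perp hW hWp hWq)
  obtain ⟨l, hl⟩ : ∃ l, l = -(inner ℝ p q / ‖p‖ ^ 2) := ⟨_, rfl⟩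
  have hl0 : 0 < l := by rw [hl]; have := div_neg_of_neg_of_pos hpq (by positivity : 0 < ‖p‖ ^ 2); linarith
  have hqp' : q = (-l) • p := by rw [hqp, hl]; simp
  have hqn : ‖q‖ = l * ‖p‖ := by rw [hqp', norm_smul]; simp [abs_of_pos hl0]
  have hin : inner ℝ p q = -l * ‖p‖ ^ 2 := by rw [hl]; field_simp
  have hdq : ∀ z, cdet q z = -l * cdet p z := by intro z; rw [hqp']; simp [cdet]; ring
  -- W = μ J p
  obtain ⟨μ, hμ⟩ : ∃ μ, μ = cdet p W / ‖p‖ ^ 2 := ⟨_, rfl⟩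
  have hWz : ∀ z, inner ℝ W z = μ * cdet p z := by
    intro z
    rw [hμ, div_mul_eq_mul_div, eq_div_iff (by positivity), cnormsq, cinner]
    rw [cinner] at hWp
    unfold cdet
    linear_combination (z.re * p.re + z.im * p.im) * hWp
  have hWn : ‖W‖ ^ 2 = μ ^ 2 * ‖p‖ ^ 2 := by
    have : cdet p W = μ * ‖p‖ ^ 2 := by rw [hμ]; field_simp
    rw [← real_inner_self_eq_norm_sq, hWz, this]; ring
  have e1 : cdet p P = ka * ‖p‖ ^ 3 := by rw [hkadef]; field_simp
  have e2 : cdet p Q = -kb * l ^ 2 * ‖p‖ ^ 3 := by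
    rw [hkbdef, hqn, hdq]; field_simp
  have e3 : cdet p Va = (ka - h) * ‖p‖ := by rw [hVa, e1]; field_simp
  have e4 : cdet p Vb = -(kb - h) * ‖p‖ := by
    rw [hdq, hdq, e2, hqn] at hVb
    have : l * cdet p Vb = l * (-(kb - h) * ‖p‖) := by
      have : -l * (-kb * l ^ 2 * ‖p‖ ^ 3) / (l * ‖p‖) ^ 2 = l * kb * ‖p‖ := by field_simp
      rw [this] at hVb; linarith
    exact mul_left_cancel₀ hl0.ne' this
  rw [hWz, hWz, e1, e2, hqn, hin] at hdisc
  set n := ‖p‖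
  have hd2 : (1 + μ * n * ka) * (1 - μ * n * kb) ≤ 1 := by
    have h3 : (l ^ 2 * n ^ 4) * ((1 + μ * n * ka) * (1 - μ * n * kb)) ≤ (l ^ 2 * n ^ 4) * 1 := by
      linarith
    exact le_of_mul_le_mul_left h3 (by positivity)
  rw [inner_add_right, hWz, hWz, e3, e4, hWn]
  have h5 : ka * kb ≤ (M / c ^ 2) ^ 2 := by
    calc ka * kb ≤ |ka| * |kb| := by rw [← abs_mul]; exact le_abs_self _
      _ ≤ _ := by rw [sq]; exact mul_le_mul hka hkb (abs_nonneg _) ((abs_nonneg _).trans hka)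
  have h6 := mul_le_mul_of_nonneg_left h5 (by positivity : 0 ≤ μ ^ 2 * n ^ 2)
  nlinarith

structure FD (X X1 X2 Xt : ℝ → ℝ → ℂ) (h : ℝ → ℝ) (τ c M : ℝ) : Prop where
  c0 : 0 < c
  c1 : c ≤ 1
  M1 : 1 ≤ M
  d1 : ∀ t ∈ Icc 0 τ, ∀ φ, HasDerivAt (X t) (X1 t φ) φ
  d2 : ∀ t ∈ Icc 0 τ, ∀ φ, HasDerivAt (X1 t) (X2 t φ) φ
  dt : ∀ t ∈ Icc 0 τ, ∀ φ, HasDerivWithinAt (fun s => X s φ) (Xt t φ) (Icc 0 τ) t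
  b0 : ∀ t ∈ Icc 0 τ, ∀ φ, c ≤ ‖X1 t φ‖
  b1 : ∀ t ∈ Icc 0 τ, ∀ φ, ‖X1 t φ‖ ≤ M
  b2 : ∀ t ∈ Icc 0 τ, ∀ φ, ‖X2 t φ‖ ≤ M
  bt : ∀ t ∈ Icc 0 τ, ∀ φ, ‖Xt t φ‖ ≤ M
  lip : ∀ t ∈ Icc 0 τ, ∀ t' ∈ Icc 0 τ, ∀ φ, ‖X t φ - X t' φ‖ ≤ M * |t - t'|
  lip1 : ∀ t ∈ Icc 0 τ, ∀ t' ∈ Icc 0 τ, ∀ φ, ‖X1 t φ - X1 t' φ‖ ≤ M * |t - t'|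
  per : ∀ t ∈ Icc 0 τ, Function.Periodic (X t) (2 * π)
  cX : ContinuousOn (fun p : ℝ × ℝ => X p.1 p.2) (Icc 0 τ ×ˢ univ)
  cXt : ContinuousOn (fun p : ℝ × ℝ => Xt p.1 p.2) (Icc 0 τ ×ˢ univ)
  flow : ∀ t ∈ Icc 0 τ, ∀ φ, cdet (X1 t φ) (Xt t φ) =
    cdet (X1 t φ) (X2 t φ) / ‖X1 t φ‖ ^ 2 - h t * ‖X1 t φ‖

/-- strong minimality -/
theorem strong_min {X X1 X2 : ℝ → ℂ} {M c : ℝ} (hc : 0 < c) (h1 : ∀ φ, HasDerivAt X (X1 φ) φ)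
    (h2 : ∀ φ, HasDerivAt X1 (X2 φ) φ) (hM : ∀ φ, ‖X2 φ‖ ≤ M) (hcX : ∀ φ, c ≤ ‖X1 φ‖)
    (a b : ℝ) (hab : M * |b - a| ≤ c / 2) (z : ℂ) (hz : inner ℝ (z + X a) (X1 a) = 0)
    (hzn : ‖z + X a‖ * M ≤ c ^ 2 / 16) :
    ‖z + X a‖ ^ 2 + c ^ 2 / 8 * (b - a) ^ 2 ≤ ‖z + X b‖ ^ 2 := by
  have hi := crv_inj h1 h2 hM hcX a b hab
  have ht := crv_taylor1 h1 h2 hM a b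
  have e : z + X b = (z + X a) + (X b - X a) := by ring
  rw [e, norm_add_sq_real (z + X a) (X b - X a)]
  have e2 : inner ℝ (z + X a) (X b - X a) = inner ℝ (z + X a) (X b - X a - (b - a) • X1 a) := by
    rw [inner_sub_right _ _ ((b - a) • X1 a), inner_smul_right, hz]; ring
  have e3 := abs_real_inner_le_norm (z + X a) (X b - X a - (b - a) • X1 a)
  rw [← e2] at e3
  have e4 : ‖z + X a‖ * ‖X b - X a - (b - a) • X1 a‖ ≤ c ^ 2 / 16 * (b - a) ^ 2 := by
    calc _ ≤ ‖z + X a‖ * (M * (b - a) ^ 2) := by gcongr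
      _ = ‖z + X a‖ * M * (b - a) ^ 2 := by ring
      _ ≤ _ := by gcongr
  have e5 : c ^ 2 / 4 * (b - a) ^ 2 ≤ ‖X b - X a‖ ^ 2 := by
    have := pow_le_pow_left₀ (by positivity) hi 2
    rw [mul_pow, sq_abs] at this
    linarith
  linarith [neg_abs_le (inner ℝ (z + X a) (X b - X a))]


theorem core_time {X X1 X2 Xt : ℝ → ℝ → ℂ} {h : ℝ → ℝ} {τ c M : ℝ}
    (F : FD X X1 X2 Xt h τ c M) {t0 t1 a b L η K : ℝ} (ht0 : t0 ∈ Icc 0 τ) (ht1 : t1 ∈ Icc 0 τ)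
    (h01 : t0 < t1)
    (hlt : 2 * inner ℝ (X t1 a + X t1 b) (Xt t1 a + Xt t1 b) < K * η)
    (hL : 0 ≤ L)
    (hd : ∀ t ∈ Ico t0 t1, ∃ y, (y - b) ^ 2 ≤ L * (t1 - t) ∧
      ‖X t a + X t y‖ ^ 2 ≤ η * (1 + K * (t - t0)) ∧
      η * (1 + K * (t1 - t0)) ≤ ‖X t1 a + X t1 y‖ ^ 2) : False := by
  set G : ℝ × ℝ → ℝ := fun p =>
    2 * inner ℝ (X p.1 a + X p.1 p.2) (Xt p.1 a + Xt p.1 p.2) with hG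
  have hGc : ContinuousOn G (Icc 0 τ ×ˢ univ) := by
    have e1 : ContinuousOn (fun p : ℝ × ℝ => X p.1 a) (Icc 0 τ ×ˢ univ) :=
      F.cX.comp (f := fun p : ℝ × ℝ => (p.1, a)) (by fun_prop) (fun p hp => ⟨hp.1, mem_univ _⟩)
    have e2 : ContinuousOn (fun p : ℝ × ℝ => Xt p.1 a) (Icc 0 τ ×ˢ univ) :=
      F.cXt.comp (f := fun p : ℝ × ℝ => (p.1, a)) (by fun_prop) (fun p hp => ⟨hp.1, mem_univ _⟩)
    exact continuousOn_const.mul (ContinuousOn.inner (𝕜 := ℝ) (e1.add F.cX) (e2.add F.cXt))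
  have hev := (hGc (t1, b) ⟨ht1, mem_univ _⟩).eventually (Iio_mem_nhds hlt)
  rw [eventually_nhdsWithin_iff, Metric.eventually_nhds_iff] at hev
  obtain ⟨ρ, hρ, hev⟩ := hev
  obtain ⟨t, ht, htρ, htL⟩ : ∃ t ∈ Ico t0 t1, t1 - t < ρ ∧ L * (t1 - t) < ρ ^ 2 := by
    refine ⟨t1 - min (t1 - t0) (min (ρ / 2) (ρ ^ 2 / (2 * (L + 1)))), ⟨?_, ?_⟩, ?_, ?_⟩
    · linarith [min_le_left (t1 - t0) (min (ρ / 2) (ρ ^ 2 / (2 * (L + 1))))]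
    · have : 0 < min (t1 - t0) (min (ρ / 2) (ρ ^ 2 / (2 * (L + 1)))) := by
        refine lt_min (by linarith) (by positivity)
      linarith
    · rw [sub_sub_cancel]
      refine lt_of_le_of_lt ((min_le_right _ _).trans (min_le_left _ _)) (by linarith)
    · rw [sub_sub_cancel]
      calc _ ≤ (L + 1) * (ρ ^ 2 / (2 * (L + 1))) := by
            refine mul_le_mul (by linarith) ((min_le_right _ _).trans (min_le_right _ _)) ?_ (by linarith)
            exact le_min (by linarith) (by positivity)
        _ = ρ ^ 2 / 2 := by field_simp
        _ < _ := by have : 0 < ρ ^ 2 := by positivity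
                    linarith
  obtain ⟨y, hy, hyt, hy1⟩ := hd t ht
  have hyρ : |y - b| < ρ := by
    apply abs_lt_of_sq_lt_sq (by linarith) hρ.le
  have hmem : ∀ s ∈ Icc t t1, s ∈ Icc 0 τ := fun s hs => ⟨ht0.1.trans (ht.1.trans hs.1), hs.2.trans ht1.2⟩
  have hder : ∀ s ∈ Icc t t1, HasDerivWithinAt (fun s => ‖X s a + X s y‖ ^ 2) (G (s, y)) (Icc 0 τ) s := by
    intro s hs
    have := ((F.dt s (hmem s hs) a).add (F.dt s (hmem s hs) y)).norm_sq
    exact this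
  obtain ⟨s, hs, hslope⟩ := exists_hasDerivAt_eq_slope (fun s => ‖X s a + X s y‖ ^ 2)
    (fun s => G (s, y)) ht.2
    (fun s hs => ((hder s hs).continuousWithinAt).mono (fun r hr => hmem r hr))
    (fun s hs => (hder s ⟨hs.1.le, hs.2.le⟩).hasDerivAt
      (Icc_mem_nhds (lt_of_le_of_lt (hmem t ⟨le_rfl, ht.2.le⟩).1 hs.1) (lt_of_lt_of_le hs.2 ht1.2)))
  have hGs : G (s, y) < K * η := by
    refine hev (y := (s, y)) ?_ ⟨hmem s ⟨hs.1.le, hs.2.le⟩, mem_univ _⟩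
    rw [Prod.dist_eq, Real.dist_eq, Real.dist_eq]
    refine max_lt ?_ hyρ
    rw [abs_sub_comm, abs_of_pos (by linarith [hs.2])]
    linarith [hs.1]
  rw [hslope, div_lt_iff₀ (by linarith [ht.2])] at hGs
  nlinarith

set_option maxHeartbeats 2000000 in
theorem core {X X1 X2 Xt : ℝ → ℝ → ℂ} {h : ℝ → ℝ} {τ c M : ℝ}
    (F : FD X X1 X2 Xt h τ c M) {σ : ℝ → ℝ} (hσ : Continuous σ) {t0 t1 φ1 δ ε η K : ℝ}
    (ht0 : t0 ∈ Icc 0 τ) (ht1 : t1 ∈ Icc 0 τ)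
    (hσX : ∀ φ, X t0 (σ φ) = -X t0 φ)
    (hσ1 : ∀ φ, inner ℝ (X1 t0 φ) (X1 t0 (σ φ)) ≤ -c ^ 2)
    (hδ0 : 0 < δ) (A1 : M * (4 * δ) ≤ c / 2) (A2 : 4 * M * ε < c / 2 * δ)
    (A3 : 2 * M * ε * M ≤ c ^ 2 / 16) (A4 : M * (M * ε + M * δ) + M * (M * ε) < c ^ 2)
    (A5 : K * ε ≤ 1) (A6 : 2 * (M / c ^ 2) ^ 2 * 2 < K)
    (h01 : t0 < t1) (h01' : t1 ≤ t0 + ε) (hη : 0 < η)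
    (ha : ∀ u ∈ Icc (-δ) δ, η * (1 + K * (t1 - t0)) ≤ ‖X t1 φ1 + X t1 (σ φ1 + u)‖ ^ 2)
    (hb : ∃ u ∈ Icc (-δ) δ, ‖X t1 φ1 + X t1 (σ φ1 + u)‖ ^ 2 = η * (1 + K * (t1 - t0)))
    (hcc : ∀ φ, ∃ u ∈ Icc (-δ) δ, ‖X t1 φ + X t1 (σ φ + u)‖ ^ 2 ≤ η * (1 + K * (t1 - t0)))
    (hd : ∀ t ∈ Ico t0 t1, ∃ u ∈ Icc (-δ) δ,
      ‖X t φ1 + X t (σ φ1 + u)‖ ^ 2 ≤ η * (1 + K * (t - t0))) : False := by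
  have hc := F.c0
  have hM0 : 0 < M := by linarith [F.M1]
  have hK0 : 0 < K := lt_of_le_of_lt (by positivity) A6
  obtain ⟨u1, hu1, hu1e⟩ := hb
  obtain ⟨ψ1, hψ1⟩ : ∃ ψ1, ψ1 = σ φ1 + u1 := ⟨_, rfl⟩
  rw [← hψ1] at hu1e
  obtain ⟨W, hW⟩ : ∃ W, W = X t1 φ1 + X t1 ψ1 := ⟨_, rfl⟩
  rw [← hW] at hu1e
  set D := η * (1 + K * (t1 - t0)) with hD
  have hD0 : 0 < D := by have : 0 < K * (t1 - t0) := mul_pos hK0 (by linarith)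
                         positivity
  have hD2 : D ≤ 2 * η := by
    have : K * (t1 - t0) ≤ 1 := le_trans (by gcongr; linarith) A5
    rw [hD]; nlinarith
  have sqle : ∀ {a b : ℝ}, 0 ≤ b → a ^ 2 ≤ b ^ 2 → a ≤ b := fun hb h => le_of_sq_le_sq h hb
  have hW0n : ‖X t1 φ1 + X t1 (σ φ1)‖ ≤ 2 * M * ε := by
    have e : X t1 φ1 + X t1 (σ φ1) = (X t1 φ1 - X t0 φ1) + (X t1 (σ φ1) - X t0 (σ φ1)) := by
      rw [hσX]; ring
    rw [e]
    refine (norm_add_le _ _).trans ?_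
    have l1 := F.lip t1 ht1 t0 ht0 φ1
    have l2 := F.lip t1 ht1 t0 ht0 (σ φ1)
    rw [abs_of_pos (by linarith)] at l1 l2
    nlinarith
  have hWn : ‖W‖ ≤ 2 * M * ε := by
    refine le_trans (sqle (norm_nonneg _) ?_) hW0n
    have := ha 0 ⟨by linarith, hδ0.le⟩
    rw [add_zero] at this
    rw [hu1e]; exact this
  have d1 := F.d1 t1 ht1
  have d2 := F.d2 t1 ht1
  have b0 := F.b0 t1 ht1
  have b1 := F.b1 t1 ht1
  have b2 := F.b2 t1 ht1
  have hu1' : |u1| ≤ δ := abs_le.2 hu1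
  have hu1s : |u1| < δ := by
    have h1 := crv_inj d1 d2 b2 b0 (σ φ1) ψ1 (by
      rw [hψ1, add_sub_cancel_left]; nlinarith)
    have h2 : ‖X t1 ψ1 - X t1 (σ φ1)‖ ≤ ‖W‖ + ‖X t1 φ1 + X t1 (σ φ1)‖ := by
      have e : X t1 ψ1 - X t1 (σ φ1) = W - (X t1 φ1 + X t1 (σ φ1)) := by rw [hW]; ring
      rw [e]; exact norm_sub_le _ _
    rw [hψ1, add_sub_cancel_left, ← hψ1] at h1
    have : c / 2 * |u1| < c / 2 * δ := by linarith
    exact lt_of_mul_lt_mul_left this (by positivity)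
  -- first order in ψ
  have hWq : inner ℝ W (X1 t1 ψ1) = 0 := by
    have hmin : IsLocalMin (fun ψ => ‖X t1 φ1 + X t1 ψ‖ ^ 2) ψ1 := by
      have : ∀ᶠ ψ in nhds ψ1, |ψ - σ φ1| < δ := by
        have hc' : Continuous fun ψ => |ψ - σ φ1| := by fun_prop
        exact (hc'.tendsto ψ1).eventually (Iio_mem_nhds (by rw [hψ1, add_sub_cancel_left]; exact hu1s))
      filter_upwards [this] with ψ hψ
      have := ha (ψ - σ φ1) (abs_le.1 hψ.le)
      rw [add_sub_cancel] at this
      rw [← hW, hu1e]; exact this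
    have hder := (((d1 ψ1).const_add (X t1 φ1)).norm_sq)
    have := hmin.hasDerivAt_eq_zero hder
    rw [← hW] at this
    linarith
  have hWM : ‖W‖ * M ≤ c ^ 2 / 16 := le_trans (by gcongr) A3
  have smin : ∀ y, |y| ≤ 3 * δ → ‖W‖ ^ 2 + c ^ 2 / 8 * y ^ 2 ≤ ‖X t1 φ1 + X t1 (ψ1 + y)‖ ^ 2 := by
    intro y hy
    have := strong_min hc d1 d2 b2 b0 ψ1 (ψ1 + y) (by rw [add_sub_cancel_left]; nlinarith)
      (X t1 φ1) (by rw [← hW]; exact hWq) (by rw [← hW]; exact hWM)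
    rwa [← hW, add_sub_cancel_left] at this
  -- second order conditions
  have hCpos : 0 < ‖X1 t1 ψ1‖ ^ 2 + inner ℝ W (X2 t1 ψ1) := by
    have h1 := abs_real_inner_le_norm W (X2 t1 ψ1)
    have h2 : ‖W‖ * ‖X2 t1 ψ1‖ ≤ c ^ 2 / 16 := le_trans (by gcongr; exact b2 ψ1) hWM
    have h3 : c ^ 2 ≤ ‖X1 t1 ψ1‖ ^ 2 := by gcongr; exact b0 ψ1
    have : 0 < c ^ 2 := by positivity
    linarith [neg_abs_le (inner ℝ W (X2 t1 ψ1))]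
  have hsec := quad_lemma (a := 2 * inner ℝ W (X1 t1 φ1))
    (A := ‖X1 t1 φ1‖ ^ 2 + inner ℝ W (X2 t1 φ1)) (B := inner ℝ (X1 t1 φ1) (X1 t1 ψ1))
    (C := ‖X1 t1 ψ1‖ ^ 2 + inner ℝ W (X2 t1 ψ1)) hCpos (by
      intro e he
      obtain ⟨ρ, hρ, hq⟩ := quad_expand d1 d2 φ1 ψ1 he
      rw [← hW] at hq
      have hev : ∀ᶠ x in nhds (0:ℝ), |x| < ρ ∧ |σ (φ1 + x) - σ φ1| < δ ∧
          2 * ‖W‖ * (M * |x|) + (M * |x|) ^ 2 < c ^ 2 / 8 * ρ ^ 2 := by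
        refine Filter.Eventually.and ?_ (Filter.Eventually.and ?_ ?_)
        · have hc' : Continuous fun x : ℝ => |x| := by fun_prop
          exact (hc'.tendsto 0).eventually (Iio_mem_nhds (by simpa using hρ))
        · have hc' : Continuous fun x : ℝ => |σ (φ1 + x) - σ φ1| := by fun_prop
          exact (hc'.tendsto 0).eventually (Iio_mem_nhds (by simpa using hδ0))
        · have hc' : Continuous fun x : ℝ => 2 * ‖W‖ * (M * |x|) + (M * |x|) ^ 2 := by fun_prop
          exact (hc'.tendsto 0).eventually (Iio_mem_nhds (by simp; positivity))
      rw [Metric.eventually_nhds_iff] at hev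
      obtain ⟨ρ', hρ', hev⟩ := hev
      refine ⟨ρ', hρ', fun x hx => ?_⟩
      obtain ⟨hx1, hx2, hx3⟩ := hev (y := x) (by simpa [Real.dist_eq] using hx)
      obtain ⟨u, hu, hle⟩ := hcc (φ1 + x)
      refine ⟨σ (φ1 + x) + u - ψ1, ?_⟩
      obtain ⟨y, hy⟩ : ∃ y, y = σ (φ1 + x) + u - ψ1 := ⟨_, rfl⟩
      rw [← hy]
      have hyy : σ (φ1 + x) + u = ψ1 + y := by rw [hy]; ring
      rw [hyy] at hle
      have hy3 : |y| ≤ 3 * δ := by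
        have e : y = (σ (φ1 + x) - σ φ1) + u - u1 := by rw [hy, hψ1]; ring
        have hu' : |u| ≤ δ := abs_le.2 hu
        rw [e, abs_le]
        constructor <;> linarith [(abs_le.1 hu').1, (abs_le.1 hu').2, (abs_le.1 hu1').1, (abs_le.1 hu1').2, (abs_lt.1 hx2).1, (abs_lt.1 hx2).2]
      have hs := smin y hy3
      have hle' : ‖X t1 (φ1 + x) + X t1 (ψ1 + y)‖ ≤ ‖W‖ :=
        sqle (norm_nonneg _) (by rw [hu1e]; exact hle)
      have htri : ‖X t1 φ1 + X t1 (ψ1 + y)‖ ≤ ‖W‖ + M * |x| := by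
        have e : X t1 φ1 + X t1 (ψ1 + y) = (X t1 (φ1 + x) + X t1 (ψ1 + y)) -
          (X t1 (φ1 + x) - X t1 φ1) := by ring
        have l := crv_lip d1 b1 φ1 (φ1 + x)
        rw [add_sub_cancel_left] at l
        rw [e]
        refine (norm_sub_le _ _).trans (by linarith)
      have hsq := pow_le_pow_left₀ (norm_nonneg _) htri 2
      have hyρ : |y| < ρ := by
        apply abs_lt_of_sq_lt_sq _ hρ.le
        have : c ^ 2 / 8 * y ^ 2 < c ^ 2 / 8 * ρ ^ 2 := by nlinarith
        exact lt_of_mul_lt_mul_left this (by positivity)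
      have := hq x y hx1 hyρ
      rw [hWq] at this
      have h9 : ‖X t1 (φ1 + x) + X t1 (ψ1 + y)‖ ^ 2 ≤ ‖W‖ ^ 2 := by gcongr
      linarith)
  obtain ⟨hWp, hdisc⟩ := hsec
  have hWp' : inner ℝ W (X1 t1 φ1) = 0 := by linarith
  have hWne : W ≠ 0 := by
    intro h0
    rw [h0] at hu1e
    simp at hu1e
    linarith
  have hpq : inner ℝ (X1 t1 φ1) (X1 t1 ψ1) < 0 := by
    have e : inner ℝ (X1 t1 φ1) (X1 t1 ψ1) = inner ℝ (X1 t0 φ1) (X1 t0 (σ φ1)) +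
        inner ℝ (X1 t1 φ1) (X1 t1 ψ1 - X1 t0 (σ φ1)) +
        inner ℝ (X1 t1 φ1 - X1 t0 φ1) (X1 t0 (σ φ1)) := by
      rw [inner_sub_right, inner_sub_left]; ring
    have l1 := F.lip1 t1 ht1 t0 ht0 φ1
    have l2 := F.lip1 t1 ht1 t0 ht0 (σ φ1)
    rw [abs_of_pos (by linarith)] at l1 l2
    have l3 := crv_lip d2 b2 (σ φ1) ψ1
    have e3 : ψ1 - σ φ1 = u1 := by rw [hψ1]; ring
    rw [e3] at l3
    have l4 : ‖X1 t1 ψ1 - X1 t0 (σ φ1)‖ ≤ M * ε + M * δ := by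
      have : X1 t1 ψ1 - X1 t0 (σ φ1) = (X1 t1 ψ1 - X1 t1 (σ φ1)) + (X1 t1 (σ φ1) - X1 t0 (σ φ1)) := by ring
      rw [this]
      refine (norm_add_le _ _).trans ?_
      nlinarith
    have l5 : ‖X1 t1 φ1 - X1 t0 φ1‖ ≤ M * ε := l1.trans (by gcongr; linarith)
    have i1 := (le_abs_self _).trans (abs_real_inner_le_norm (X1 t1 φ1) (X1 t1 ψ1 - X1 t0 (σ φ1)))
    have i2 := (le_abs_self _).trans (abs_real_inner_le_norm (X1 t1 φ1 - X1 t0 φ1) (X1 t0 (σ φ1)))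
    have i3 : ‖X1 t1 φ1‖ * ‖X1 t1 ψ1 - X1 t0 (σ φ1)‖ ≤ M * (M * ε + M * δ) := by
      gcongr; exact b1 φ1
    have i4 : ‖X1 t1 φ1 - X1 t0 φ1‖ * ‖X1 t0 (σ φ1)‖ ≤ (M * ε) * M := by
      refine mul_le_mul l5 (F.b1 t0 ht0 _) (norm_nonneg _) ((norm_nonneg _).trans l5)
    linarith [hσ1 φ1]
  have hsp := speed_bound hc (b0 φ1) (b0 ψ1) (b2 φ1) (b2 ψ1) hWne hWp' hWq hpq hdisc
    (F.flow t1 ht1 φ1) (F.flow t1 ht1 ψ1)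
  have hlt : 2 * inner ℝ W (Xt t1 φ1 + Xt t1 ψ1) < K * η := by
    refine lt_of_le_of_lt hsp ?_
    rw [hu1e]
    calc _ ≤ 2 * (M / c ^ 2) ^ 2 * (2 * η) := by gcongr
      _ = 2 * (M / c ^ 2) ^ 2 * 2 * η := by ring
      _ < _ := by gcongr
  rw [hW] at hlt
  -- time derivative
  refine core_time F ht0 ht1 h01 hlt
    (L := (8 / c ^ 2) * (4 * M * ‖W‖ + 4 * M ^ 2 * (t1 - t0))) ?_ ?_
  · have : 0 < t1 - t0 := by linarith
    positivity
  · intro t ht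
    obtain ⟨u, hu, hle⟩ := hd t ht
    have htm : t ∈ Icc 0 τ := ⟨ht0.1.trans ht.1, ht.2.le.trans ht1.2⟩
    refine ⟨σ φ1 + u, ?_, hle, ha u hu⟩
    have hy3 : |σ φ1 + u - ψ1| ≤ 3 * δ := by
      have hu' : |u| ≤ δ := abs_le.2 hu
      rw [hψ1, abs_le]
      constructor <;> linarith [(abs_le.1 hu').1, (abs_le.1 hu').2, (abs_le.1 hu1').1, (abs_le.1 hu1').2]
    have hs := smin _ hy3
    rw [add_sub_cancel] at hs
    have hle' : ‖X t φ1 + X t (σ φ1 + u)‖ ≤ ‖W‖ := by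
      refine sqle (norm_nonneg _) (hle.trans ?_)
      rw [hu1e, hD]
      have : K * (t - t0) ≤ K * (t1 - t0) := by gcongr; exact ht.2.le
      gcongr
    have htri : ‖X t1 φ1 + X t1 (σ φ1 + u)‖ ≤ ‖W‖ + 2 * M * (t1 - t) := by
      have e : X t1 φ1 + X t1 (σ φ1 + u) = (X t φ1 + X t (σ φ1 + u)) +
        ((X t1 φ1 - X t φ1) + (X t1 (σ φ1 + u) - X t (σ φ1 + u))) := by ring
      have l1 := F.lip t1 ht1 t htm φ1
      have l2 := F.lip t1 ht1 t htm (σ φ1 + u)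
      rw [abs_of_pos (by linarith [ht.2])] at l1 l2
      rw [e]
      have n1 := norm_add_le (X t φ1 + X t (σ φ1 + u)) ((X t1 φ1 - X t φ1) + (X t1 (σ φ1 + u) - X t (σ φ1 + u)))
      have n2 := norm_add_le (X t1 φ1 - X t φ1) (X t1 (σ φ1 + u) - X t (σ φ1 + u))
      linarith
    have hsq := pow_le_pow_left₀ (norm_nonneg _) htri 2
    have hfin : c ^ 2 / 8 * (σ φ1 + u - ψ1) ^ 2 ≤ (4 * M * ‖W‖ + 4 * M ^ 2 * (t1 - t0)) * (t1 - t) := by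
      have h4 : (t1 - t) * (t1 - t) ≤ (t1 - t0) * (t1 - t) := by
        refine mul_le_mul_of_nonneg_right (by linarith [ht.1]) (by linarith [ht.2])
      have h5 : 4 * M ^ 2 * ((t1 - t) * (t1 - t)) ≤ 4 * M ^ 2 * ((t1 - t0) * (t1 - t)) := by gcongr
      linarith
    calc (σ φ1 + u - ψ1) ^ 2 = 8 / c ^ 2 * (c ^ 2 / 8 * (σ φ1 + u - ψ1) ^ 2) := by field_simp
      _ ≤ 8 / c ^ 2 * ((4 * M * ‖W‖ + 4 * M ^ 2 * (t1 - t0)) * (t1 - t)) := by gcongr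
      _ = _ := by ring


def CSym (X X1 : ℝ → ℝ → ℂ) (t : ℝ) : Prop :=
  ∃ σ : ℝ → ℝ, Continuous σ ∧ (∀ φ, ∃ k : ℤ, σ (φ + 2 * π) = σ φ + k * (2 * π)) ∧
    (∀ φ, X t (σ φ) = -X t φ) ∧ ∀ φ, inner ℝ (X1 t φ) (X1 t (σ φ)) < 0

theorem cdet_sub (q a b : ℂ) : cdet q (a - b) = cdet q a - cdet q b := by simp [cdet]; ring

theorem par_lemma {X X1 X2 : ℝ → ℂ} {M c : ℝ} (hc : 0 < c) (hM0 : 0 < M)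
    (h1 : ∀ φ, HasDerivAt X (X1 φ) φ)
    (h2 : ∀ φ, HasDerivAt X1 (X2 φ) φ) (hM1 : ∀ φ, ‖X1 φ‖ ≤ M) (hM : ∀ φ, ‖X2 φ‖ ≤ M)
    (hcX : ∀ φ, c ≤ ‖X1 φ‖) {σ : ℝ → ℝ} (hσ : Continuous σ) (hs : ∀ φ, X (σ φ) = -X φ) (φ : ℝ) :
    cdet (X1 (σ φ)) (X1 φ) = 0 := by
  set q := X1 (σ φ) with hq
  have hder : HasDerivAt (fun x => cdet q (X x)) (cdet q (X1 φ)) φ := by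
    have hr : HasDerivAt (fun x => (X x).re) (X1 φ).re φ :=
      (Complex.reCLM.hasFDerivAt.comp_hasDerivAt φ (h1 φ))
    have hi : HasDerivAt (fun x => (X x).im) (X1 φ).im φ :=
      (Complex.imCLM.hasFDerivAt.comp_hasDerivAt φ (h1 φ))
    exact (hi.const_mul q.re).sub (hr.const_mul q.im)
  have hz : HasDerivAt (fun x => cdet q (X x)) 0 φ := by
    rw [hasDerivAt_iff_isLittleO]
    have hO : (fun x => cdet q (X x) - cdet q (X φ) - (x - φ) • (0:ℝ)) =O[nhds φ]
        (fun x => (x - φ) ^ 2) := by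
      refine Asymptotics.IsBigO.of_bound (M * (M * (2 * M / c) ^ 2)) ?_
      have : ∀ᶠ x in nhds φ, M * |σ x - σ φ| < c / 2 := by
        have hc' : Continuous fun x => M * |σ x - σ φ| := by fun_prop
        exact (hc'.tendsto φ).eventually (Iio_mem_nhds (by simpa using hc))
      filter_upwards [this] with x hx
      have i1 := crv_inj h1 h2 hM hcX (σ φ) (σ x) hx.le
      have i2 := crv_lip h1 hM1 φ x
      have i3 := crv_taylor1 h1 h2 hM (σ φ) (σ x)
      have e1 : ‖X (σ x) - X (σ φ)‖ = ‖X x - X φ‖ := by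
        rw [hs, hs, ← norm_neg]; congr 1; ring
      rw [e1] at i1
      have i4 : |σ x - σ φ| ≤ 2 * M / c * |x - φ| := by
        have : |σ x - σ φ| ≤ 2 / c * (M * |x - φ|) := by
          calc |σ x - σ φ| = 2 / c * (c / 2 * |σ x - σ φ|) := by field_simp
            _ ≤ _ := mul_le_mul_of_nonneg_left (i1.trans i2) (by positivity)
        calc _ ≤ _ := this
          _ = _ := by ring
      have e2 : cdet q (X x) - cdet q (X φ) = -cdet q (X (σ x) - X (σ φ) - (σ x - σ φ) • q) := by
        rw [hs, hs]; simp [cdet]; ring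
      rw [smul_zero, sub_zero, e2, Real.norm_eq_abs, abs_neg, Real.norm_eq_abs, abs_of_nonneg (sq_nonneg (x - φ))]
      calc _ ≤ ‖q‖ * ‖X (σ x) - X (σ φ) - (σ x - σ φ) • q‖ := cdet_abs_le _ _
        _ ≤ M * (M * (σ x - σ φ) ^ 2) := by gcongr; exact hM1 _
        _ ≤ M * (M * (2 * M / c * |x - φ|) ^ 2) := by
            rw [← sq_abs (σ x - σ φ)]; gcongr
        _ = _ := by rw [mul_pow, sq_abs]; ring
    refine hO.trans_isLittleO ?_
    have h3 : (fun x : ℝ => (x - φ) ^ 2) = fun x => (x - φ) * (x - φ) := by ext; ring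
    rw [h3]
    have h4 : (fun x : ℝ => x - φ) =o[nhds φ] (fun _ => (1:ℝ)) := by
      rw [Asymptotics.isLittleO_one_iff]
      have : Continuous fun x : ℝ => x - φ := by fun_prop
      simpa using this.tendsto φ
    simpa using h4.mul_isBigO (Asymptotics.isBigO_refl (fun x : ℝ => x - φ) (nhds φ))
  exact hder.unique hz

theorem inner_upgrade {p q : ℂ} {c : ℝ} (hc : 0 < c) (hp : c ≤ ‖p‖) (hq : c ≤ ‖q‖)
    (h : inner ℝ p q < 0) (hd : cdet q p = 0) : inner ℝ p q ≤ -c ^ 2 := by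
  have h1 : (inner ℝ p q) ^ 2 + (cdet q p) ^ 2 = ‖p‖ ^ 2 * ‖q‖ ^ 2 := by
    rw [cnormsq, cnormsq, cinner, cdet]; ring
  rw [hd] at h1
  have h2 : c ^ 2 * c ^ 2 ≤ ‖p‖ ^ 2 * ‖q‖ ^ 2 := by gcongr
  by_contra hcon
  push Not at hcon
  nlinarith

theorem align {X X1 X2 Xt : ℝ → ℝ → ℂ} {h : ℝ → ℝ} {τ c M : ℝ}
    (F : FD X X1 X2 Xt h τ c M) {s t0 t1 φ1 δ ε ψ1 : ℝ}
    (ht0 : t0 ∈ Icc 0 τ) (ht1 : t1 ∈ Icc 0 τ)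
    (hσ1 : inner ℝ (X1 t0 φ1) (X1 t0 s) ≤ -c ^ 2)
    (A4 : M * (M * ε + M * δ) + M * (M * ε) < c ^ 2)
    (h01 : t0 ≤ t1) (h01' : t1 ≤ t0 + ε) (hu : |ψ1 - s| ≤ δ) :
    inner ℝ (X1 t1 φ1) (X1 t1 ψ1) < 0 := by
  have hM0 : 0 < M := by linarith [F.M1]
  have e : inner ℝ (X1 t1 φ1) (X1 t1 ψ1) = inner ℝ (X1 t0 φ1) (X1 t0 s) +
      inner ℝ (X1 t1 φ1) (X1 t1 ψ1 - X1 t0 s) +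
      inner ℝ (X1 t1 φ1 - X1 t0 φ1) (X1 t0 s) := by
    rw [inner_sub_right, inner_sub_left]; ring
  have l1 := F.lip1 t1 ht1 t0 ht0 φ1
  have l2 := F.lip1 t1 ht1 t0 ht0 s
  rw [abs_of_nonneg (by linarith)] at l1 l2
  have l3 := crv_lip (F.d2 t1 ht1) (F.b2 t1 ht1) s ψ1
  have l4 : ‖X1 t1 ψ1 - X1 t0 s‖ ≤ M * ε + M * δ := by
    have : X1 t1 ψ1 - X1 t0 s = (X1 t1 ψ1 - X1 t1 s) + (X1 t1 s - X1 t0 s) := by ring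
    rw [this]
    refine (norm_add_le _ _).trans ?_
    nlinarith
  have l5 : ‖X1 t1 φ1 - X1 t0 φ1‖ ≤ M * ε := l1.trans (by gcongr; linarith)
  have i1 := (le_abs_self _).trans (abs_real_inner_le_norm (X1 t1 φ1) (X1 t1 ψ1 - X1 t0 s))
  have i2 := (le_abs_self _).trans (abs_real_inner_le_norm (X1 t1 φ1 - X1 t0 φ1) (X1 t0 s))
  have i3 : ‖X1 t1 φ1‖ * ‖X1 t1 ψ1 - X1 t0 s‖ ≤ M * (M * ε + M * δ) := by
    gcongr; exact F.b1 t1 ht1 φ1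
  have i4 : ‖X1 t1 φ1 - X1 t0 φ1‖ * ‖X1 t0 s‖ ≤ (M * ε) * M := by
    refine mul_le_mul l5 (F.b1 t0 ht0 _) (norm_nonneg _) ((norm_nonneg _).trans l5)
  linarith

theorem step_exists {X X1 X2 Xt : ℝ → ℝ → ℂ} {h : ℝ → ℝ} {τ c M : ℝ}
    (F : FD X X1 X2 Xt h τ c M) {σ : ℝ → ℝ} (hσ : Continuous σ) {t0 t2 δ ε K : ℝ}
    (hper : ∀ φ, ∃ k : ℤ, σ (φ + 2 * π) = σ φ + k * (2 * π))
    (ht0 : t0 ∈ Icc 0 τ) (ht2 : t2 ∈ Icc 0 τ)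
    (hσX : ∀ φ, X t0 (σ φ) = -X t0 φ)
    (hσ1 : ∀ φ, inner ℝ (X1 t0 φ) (X1 t0 (σ φ)) ≤ -c ^ 2)
    (hδ0 : 0 < δ) (A1 : M * (4 * δ) ≤ c / 2) (A2 : 4 * M * ε < c / 2 * δ)
    (A3 : 2 * M * ε * M ≤ c ^ 2 / 16) (A4 : M * (M * ε + M * δ) + M * (M * ε) < c ^ 2)
    (A5 : K * ε ≤ 1) (A6 : 2 * (M / c ^ 2) ^ 2 * 2 < K)
    (h02 : t0 ≤ t2) (h02' : t2 ≤ t0 + ε) (φ : ℝ) :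
    ∃ u ∈ Icc (-δ) δ, X t2 (σ φ + u) = -X t2 φ := by
  have hτ : 0 ≤ τ := ht0.1.trans ht0.2
  set Xc : ℝ → ℝ → ℂ := fun t φ => X (projIcc 0 τ hτ t) φ with hXc
  have hXcc : Continuous (fun p : ℝ × ℝ => Xc p.1 p.2) := by
    have : ContinuousOn (fun p : ℝ × ℝ => Xc p.1 p.2) univ := by
      refine F.cX.comp (f := fun p : ℝ × ℝ => ((projIcc 0 τ hτ p.1 : ℝ), p.2)) ?_ ?_
      · have : Continuous (fun p : ℝ × ℝ => ((projIcc 0 τ hτ p.1 : ℝ), p.2)) := by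
          have := continuous_projIcc (h := hτ)
          fun_prop
        exact this.continuousOn
      · intro p _
        exact ⟨(projIcc 0 τ hτ p.1).2, mem_univ _⟩
    exact continuousOn_univ.1 this
  have hXcX : ∀ t ∈ Icc 0 τ, ∀ φ, Xc t φ = X t φ := by
    intro t ht φ
    simp only [hXc]
    rw [projIcc_of_mem hτ ht]
  set f : ℝ × ℝ → ℝ → ℝ := fun p u => ‖Xc p.1 p.2 + Xc p.1 (σ p.2 + u)‖ ^ 2 with hf
  have hfc : Continuous ↿f := by
    have e1 : Continuous (fun r : (ℝ × ℝ) × ℝ => Xc r.1.1 r.1.2) :=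
      hXcc.comp (f := fun r : (ℝ × ℝ) × ℝ => r.1) (by fun_prop)
    have e2 : Continuous (fun r : (ℝ × ℝ) × ℝ => Xc r.1.1 (σ r.1.2 + r.2)) :=
      hXcc.comp (f := fun r : (ℝ × ℝ) × ℝ => (r.1.1, σ r.1.2 + r.2)) (by fun_prop)
    exact (e1.add e2).norm.pow 2
  have hIc : IsCompact (Icc (-δ) δ) := isCompact_Icc
  have hIn : (Icc (-δ) δ).Nonempty := ⟨0, by linarith, hδ0.le⟩
  set D : ℝ × ℝ → ℝ := fun p => sInf (f p '' Icc (-δ) δ) with hD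
  have hDc : Continuous D := hIc.continuous_sInf hfc
  have hDle : ∀ p, ∀ u ∈ Icc (-δ) δ, D p ≤ f p u := by
    intro p u hu
    refine csInf_le ⟨0, ?_⟩ (mem_image_of_mem _ hu)
    rintro _ ⟨v, _, rfl⟩
    positivity
  have hDatt : ∀ p, ∃ u ∈ Icc (-δ) δ, D p = f p u := by
    intro p
    have : ContinuousOn (f p) (Icc (-δ) δ) := by
      have : Continuous (f p) := hfc.comp (f := fun u => (p, u)) (by fun_prop)
      exact this.continuousOn
    exact hIc.exists_sInf_image_eq hIn this
  have hDper : ∀ t ∈ Icc 0 τ, Function.Periodic (fun φ => D (t, φ)) (2 * π) := by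
    intro t ht φ
    have : f (t, φ + 2 * π) = f (t, φ) := by
      ext u
      obtain ⟨k, hk⟩ := hper φ
      simp only [hf, hXcX t ht]
      rw [hk, F.per t ht φ]
      have := (F.per t ht).int_mul k (σ φ + u)
      rw [← this]
      congr 4
      ring
    simp only [hD, this]
  have hK0 : 0 < K := lt_of_le_of_lt (by positivity) A6
  have claim : ∀ η > 0, ∀ t ∈ Icc t0 t2, ∀ φ, D (t, φ) < η * (1 + K * (t - t0)) := by
    intro η hη
    by_contra hcon
    push Not at hcon
    obtain ⟨tb, htb, φb, hb⟩ := hcon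
    set S : Set (ℝ × ℝ) := (Icc t0 t2 ×ˢ Icc 0 (2 * π)) ∩ {p | η * (1 + K * (p.1 - t0)) ≤ D p}
      with hS
    have hSc : IsCompact S := by
      refine (isCompact_Icc.prod isCompact_Icc).inter_right ?_
      exact isClosed_le (by fun_prop) hDc
    have hmem : ∀ t ∈ Icc t0 t2, t ∈ Icc 0 τ := fun t ht => ⟨ht0.1.trans ht.1, ht.2.trans ht2.2⟩
    have hred : ∀ t ∈ Icc t0 t2, ∀ φ, η * (1 + K * (t - t0)) ≤ D (t, φ) → ∃ φ', (t, φ') ∈ S := by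
      intro t ht φ hle
      obtain ⟨y, hy, hye⟩ := (hDper t (hmem t ht)).exists_mem_Ico₀ (by positivity) φ
      refine ⟨y, ⟨ht, hy.1, hy.2.le⟩, ?_⟩
      simp only [mem_ofPred_eq]
      rw [← hye]; exact hle
    have hSn : S.Nonempty := by
      obtain ⟨y, hy⟩ := hred tb htb φb hb
      exact ⟨_, hy⟩
    obtain ⟨⟨t1, φ1⟩, hp, hmin⟩ := hSc.exists_isMinOn hSn continuous_fst.continuousOn
    have ht1 : t1 ∈ Icc t0 t2 := hp.1.1
    have hp2 : η * (1 + K * (t1 - t0)) ≤ D (t1, φ1) := hp.2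
    have hearly : ∀ t ∈ Ico t0 t1, ∀ φ, D (t, φ) < η * (1 + K * (t - t0)) := by
      intro t ht φ
      by_contra hc
      push Not at hc
      obtain ⟨y, hy⟩ := hred t ⟨ht.1, ht.2.le.trans ht1.2⟩ φ hc
      have := hmin hy
      simp only [mem_ofPred_eq] at this
      linarith [ht.2]
    have h01 : t0 < t1 := by
      rcases lt_or_eq_of_le ht1.1 with h | h
      · exact h
      · exfalso
        rw [← h] at hp2
        have := hDle (t0, φ1) 0 ⟨by linarith, hδ0.le⟩
        simp only [hf, hXcX t0 ht0, add_zero, hσX] at this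
        simp at this
        simp at hp2
        linarith
    have hlim : ∀ φ, D (t1, φ) ≤ η * (1 + K * (t1 - t0)) := by
      intro φ
      have l1 : Tendsto (fun t => D (t, φ)) (nhdsWithin t1 (Iio t1)) (nhds (D (t1, φ))) := by
        have : Continuous fun t => D (t, φ) := by fun_prop
        exact (this.tendsto t1).mono_left nhdsWithin_le_nhds
      have l2 : Tendsto (fun t => η * (1 + K * (t - t0))) (nhdsWithin t1 (Iio t1))
          (nhds (η * (1 + K * (t1 - t0)))) := by
        have : Continuous fun t => η * (1 + K * (t - t0)) := by fun_prop
        exact (this.tendsto t1).mono_left nhdsWithin_le_nhds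
      refine le_of_tendsto_of_tendsto l1 l2 ?_
      filter_upwards [Ioo_mem_nhdsLT h01] with t ht
      exact (hearly t ⟨ht.1.le, ht.2⟩ φ).le
    have ht1m := hmem t1 ht1
    have hfX : ∀ t ∈ Icc 0 τ, ∀ φ u, f (t, φ) u = ‖X t φ + X t (σ φ + u)‖ ^ 2 := by
      intro t ht φ u
      simp only [hf, hXcX t ht]
    refine core F hσ ht0 ht1m hσX hσ1 hδ0 A1 A2 A3 A4 A5 A6 h01 (ht1.2.trans h02') hη
      (φ1 := φ1) ?_ ?_ ?_ ?_
    · intro u hu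
      rw [← hfX t1 ht1m]
      exact hp2.trans (hDle _ u hu)
    · obtain ⟨u, hu, hue⟩ := hDatt (t1, φ1)
      refine ⟨u, hu, ?_⟩
      rw [← hfX t1 ht1m, ← hue]
      exact le_antisymm (hlim φ1) hp2
    · intro φ
      obtain ⟨u, hu, hue⟩ := hDatt (t1, φ)
      refine ⟨u, hu, ?_⟩
      rw [← hfX t1 ht1m, ← hue]
      exact hlim φ
    · intro t ht
      obtain ⟨u, hu, hue⟩ := hDatt (t, φ1)
      refine ⟨u, hu, ?_⟩
      rw [← hfX t (hmem t ⟨ht.1, ht.2.le.trans ht1.2⟩), ← hue]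
      exact (hearly t ht φ1).le
  obtain ⟨u, hu, hue⟩ := hDatt (t2, φ)
  refine ⟨u, hu, ?_⟩
  have h0 : D (t2, φ) ≤ 0 := by
    have hq : 0 < 1 + K * (t2 - t0) := by
      have : 0 ≤ K * (t2 - t0) := mul_nonneg hK0.le (by linarith)
      linarith
    by_contra hcon
    push Not at hcon
    have := claim (D (t2, φ) / (1 + K * (t2 - t0))) (by positivity) t2 ⟨h02, le_rfl⟩ φ
    rw [div_mul_cancel₀ _ hq.ne'] at this
    exact lt_irrefl _ this
  rw [hue] at h0
  simp only [hf, hXcX t2 ht2] at h0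
  have h1 : ‖X t2 φ + X t2 (σ φ + u)‖ = 0 := by
    have := norm_nonneg (X t2 φ + X t2 (σ φ + u))
    nlinarith
  rw [norm_eq_zero] at h1
  exact (neg_eq_of_add_eq_zero_right h1).symm

theorem sym_step {X X1 X2 Xt : ℝ → ℝ → ℂ} {h : ℝ → ℝ} {τ c M : ℝ}
    (F : FD X X1 X2 Xt h τ c M) : ∃ ε > 0, ∀ t0 ∈ Icc 0 τ, ∀ t2 ∈ Icc 0 τ, t0 ≤ t2 → t2 ≤ t0 + ε →
      CSym X X1 t0 → CSym X X1 t2 := by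
  have hc := F.c0
  have hc1 := F.c1
  have hM1 := F.M1
  have hM0 : 0 < M := by linarith
  obtain ⟨δ, ε, K, hδ0, hε0, A1, A2, A3, A4, A5, A6⟩ : ∃ δ ε K : ℝ, 0 < δ ∧ 0 < ε ∧
      M * (4 * δ) ≤ c / 2 ∧ 4 * M * ε < c / 2 * δ ∧ 2 * M * ε * M ≤ c ^ 2 / 16 ∧
      M * (M * ε + M * δ) + M * (M * ε) < c ^ 2 ∧ K * ε ≤ 1 ∧ 2 * (M / c ^ 2) ^ 2 * 2 < K := by
    have hr : c / M ≤ 1 := by rw [div_le_one hM0]; linarith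
    have hM' : 1 / M ≤ 1 := by rw [div_le_one hM0]; linarith
    have hc2 : c ^ 2 ≤ 1 := pow_le_one₀ hc.le hc1
    refine ⟨c ^ 2 / (8 * M ^ 2), c ^ 4 / (128 * M ^ 3), 5 * M ^ 2 / c ^ 4, by positivity,
      by positivity, ?_, ?_, ?_, ?_, ?_, ?_⟩
    · have : M * (4 * (c ^ 2 / (8 * M ^ 2))) = c / 2 * (c / M) := by field_simp; norm_num
      rw [this]
      exact mul_le_of_le_one_right (by positivity) hr
    · have e1 : 4 * M * (c ^ 4 / (128 * M ^ 3)) = (c ^ 3 / M ^ 2) * (c / 32) := by field_simp; norm_num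
      have e2 : c / 2 * (c ^ 2 / (8 * M ^ 2)) = (c ^ 3 / M ^ 2) * (1 / 16) := by field_simp; norm_num
      rw [e1, e2]
      exact mul_lt_mul_of_pos_left (by linarith) (by positivity)
    · have : 2 * M * (c ^ 4 / (128 * M ^ 3)) * M = c ^ 2 / 64 * (c ^ 2 * (1 / M)) := by field_simp; norm_num
      rw [this]
      have h3 : c ^ 2 * (1 / M) ≤ 1 := mul_le_one₀ hc2 (by positivity) hM'
      have : 0 < c ^ 2 := by positivity
      nlinarith
    · have : M * (M * (c ^ 4 / (128 * M ^ 3)) + M * (c ^ 2 / (8 * M ^ 2))) +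
        M * (M * (c ^ 4 / (128 * M ^ 3))) = c ^ 2 / 64 * (c ^ 2 * (1 / M)) + c ^ 2 / 8 := by
          field_simp; ring
      rw [this]
      have h3 : c ^ 2 * (1 / M) ≤ 1 := mul_le_one₀ hc2 (by positivity) hM'
      have : 0 < c ^ 2 := by positivity
      nlinarith
    · have : 5 * M ^ 2 / c ^ 4 * (c ^ 4 / (128 * M ^ 3)) = 5 / 128 * (1 / M) := by field_simp
      rw [this]; linarith
    · have : 2 * (M / c ^ 2) ^ 2 * 2 = 4 * M ^ 2 / c ^ 4 := by field_simp; norm_num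
      rw [this]
      gcongr
      norm_num
  refine ⟨ε, hε0, fun t0 ht0 t2 ht2 h02 h02' hsym => ?_⟩
  obtain ⟨σ, hσ, hper, hσX, hσ1⟩ := hsym
  have hσ1' : ∀ φ, inner ℝ (X1 t0 φ) (X1 t0 (σ φ)) ≤ -c ^ 2 := fun φ =>
    inner_upgrade hc (F.b0 t0 ht0 _) (F.b0 t0 ht0 _) (hσ1 φ)
      (par_lemma hc hM0 (F.d1 t0 ht0) (F.d2 t0 ht0) (F.b1 t0 ht0) (F.b2 t0 ht0) (F.b0 t0 ht0) hσ hσX φ)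
  have hex := step_exists F hσ hper ht0 ht2 hσX hσ1' hδ0 A1 A2 A3 A4 A5 A6 h02 h02'
  choose u hu huX using hex
  have hu' : ∀ φ, |u φ| ≤ δ := fun φ => abs_le.2 (hu φ)
  have inj := crv_inj (F.d1 t2 ht2) (F.d2 t2 ht2) (F.b2 t2 ht2) (F.b0 t2 ht2)
  refine ⟨fun φ => σ φ + u φ, ?_, ?_, huX, ?_⟩
  · rw [continuous_iff_continuousAt]
    intro φ
    rw [ContinuousAt, tendsto_iff_norm_sub_tendsto_zero]
    have hXc : Continuous (X t2) := continuous_iff_continuousAt.2 fun x => (F.d1 t2 ht2 x).continuousAt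
    have hlim : Tendsto (fun x => 2 / c * ‖X t2 x - X t2 φ‖) (nhds φ) (nhds 0) := by
      have : Continuous (fun x => 2 / c * ‖X t2 x - X t2 φ‖) := by fun_prop
      simpa using this.tendsto φ
    refine squeeze_zero' (Eventually.of_forall fun x => norm_nonneg _) ?_ hlim
    have : ∀ᶠ x in nhds φ, |σ x - σ φ| < δ := by
      have hc' : Continuous fun x => |σ x - σ φ| := by fun_prop
      exact (hc'.tendsto φ).eventually (Iio_mem_nhds (by simpa using hδ0))
    filter_upwards [this] with x hx
    have hab : |σ x + u x - (σ φ + u φ)| ≤ 4 * δ := by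
      rw [abs_le]
      constructor <;> linarith [(hu x).1, (hu x).2, (hu φ).1, (hu φ).2, (abs_lt.1 hx).1, (abs_lt.1 hx).2]
    have := inj (σ φ + u φ) (σ x + u x) (le_trans (by gcongr) A1)
    rw [huX, huX] at this
    have e1 : ‖-X t2 x - -X t2 φ‖ = ‖X t2 x - X t2 φ‖ := by rw [← norm_neg]; congr 1; ring
    rw [e1] at this
    rw [Real.norm_eq_abs]
    calc _ = 2 / c * (c / 2 * |σ x + u x - (σ φ + u φ)|) := by field_simp
      _ ≤ _ := by gcongr
  · intro φ
    obtain ⟨k, hk⟩ := hper φ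
    refine ⟨k, ?_⟩
    have hab : |σ (φ + 2 * π) + u (φ + 2 * π) - (σ φ + u φ + k * (2 * π))| ≤ 4 * δ := by
      rw [hk, abs_le]
      constructor <;> linarith [(hu (φ + 2 * π)).1, (hu (φ + 2 * π)).2, (hu φ).1, (hu φ).2]
    have := inj (σ φ + u φ + k * (2 * π)) (σ (φ + 2 * π) + u (φ + 2 * π)) (le_trans (by gcongr) A1)
    rw [huX, (F.per t2 ht2).int_mul k, huX, F.per t2 ht2, sub_self, norm_zero] at this
    have h0 : |σ (φ + 2 * π) + u (φ + 2 * π) - (σ φ + u φ + k * (2 * π))| ≤ 0 := by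
      by_contra hcon
      push Not at hcon
      have : 0 < c / 2 * |σ (φ + 2 * π) + u (φ + 2 * π) - (σ φ + u φ + k * (2 * π))| := by positivity
      linarith
    have := abs_nonpos_iff.1 h0
    simp only
    linarith
  · intro φ
    exact align F ht0 ht2 (hσ1' φ) A4 h02 h02' (by simpa using hu' φ)

theorem sym_all {X X1 X2 Xt : ℝ → ℝ → ℂ} {h : ℝ → ℝ} {τ c M : ℝ}
    (F : FD X X1 X2 Xt h τ c M) (h0 : CSym X X1 0) : ∀ t ∈ Icc 0 τ, CSym X X1 t := by
  obtain ⟨ε, hε, hstep⟩ := sym_step F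
  have key : ∀ n : ℕ, ∀ t ∈ Icc 0 τ, t ≤ n * ε → CSym X X1 t := by
    intro n
    induction n with
    | zero =>
      intro t ht hle
      have : t = 0 := le_antisymm (by simpa using hle) ht.1
      rw [this]; exact h0
    | succ n ih =>
      intro t ht hle
      push_cast at hle
      have hm : max 0 (t - ε) ∈ Icc 0 τ := ⟨le_max_left _ _, max_le (ht.1.trans ht.2) (by linarith [ht.2])⟩
      refine hstep (max 0 (t - ε)) hm t ht (max_le ht.1 (by linarith))
        (by linarith [le_max_right 0 (t - ε)]) (ih _ hm (max_le (by positivity) (by linarith)))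
  intro t ht
  obtain ⟨n, hn⟩ := exists_nat_ge (t / ε)
  exact key n t ht (by rwa [div_le_iff₀ hε] at hn)


theorem lift_sym {Y : ℝ → ℂ} (hY : Continuous Y) (hper : Function.Periodic Y (2 * π))
    (hinj : InjOn Y (Ico 0 (2 * π))) (hsym : ∀ φ, ∃ ψ, Y ψ = -Y φ) :
    ∃ σ : ℝ → ℝ, Continuous σ ∧ (∀ φ, ∃ k : ℤ, σ (φ + 2 * π) = σ φ + k * (2 * π)) ∧
      (∀ φ, Y (σ φ) = -Y φ) := by
  have : Fact (0 < 2 * π) := ⟨Real.two_pi_pos⟩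
  let L : AddCircle (2 * π) → ℂ := hper.lift
  have hLc : Continuous L := continuous_coinduced_dom.mpr hY
  have hLcoe : ∀ a : ℝ, L (a : AddCircle (2 * π)) = Y a := fun a => rfl
  have hLinj : Function.Injective L := by
    intro x y hxy
    obtain ⟨a, ha, rfl⟩ : ∃ a ∈ Ico 0 (0 + 2 * π), (a : AddCircle (2 * π)) = x := by
      have := AddCircle.coe_image_Ico_eq (2 * π) 0
      have h := this.ge (mem_univ x)
      exact h
    obtain ⟨b, hb, rfl⟩ : ∃ a ∈ Ico 0 (0 + 2 * π), (a : AddCircle (2 * π)) = y := by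
      have := AddCircle.coe_image_Ico_eq (2 * π) 0
      have h := this.ge (mem_univ y)
      exact h
    rw [zero_add] at ha hb
    rw [hLcoe, hLcoe] at hxy
    rw [hinj ha hb hxy]
  have hemb : Topology.IsClosedEmbedding L := hLc.isClosedEmbedding hLinj
  choose s hs using hsym
  let f : ℝ → AddCircle (2 * π) := fun φ => (s φ : AddCircle (2 * π))
  have hf : ∀ φ, L (f φ) = -Y φ := fun φ => hs φ
  have hfc : Continuous f := by
    rw [hemb.isEmbedding.continuous_iff]
    have : L ∘ f = fun φ => -Y φ := funext hf
    rw [this]; exact hY.neg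
  obtain ⟨F, ⟨-, hF⟩, -⟩ := (AddCircle.isCoveringMap_coe (2 * π)).existsUnique_continuousMap_lifts
    ⟨f, hfc⟩ (0:ℝ) (s 0) rfl
  have hF' : ∀ φ, ((F φ : ℝ) : AddCircle (2 * π)) = f φ := fun φ => congrFun hF φ
  refine ⟨F, F.continuous, fun φ => ?_, fun φ => ?_⟩
  · have h1 : ((F (φ + 2 * π) : ℝ) : AddCircle (2 * π)) = (F φ : ℝ) := by
      apply hLinj
      rw [hF', hF', hf, hf, hper]
    rw [← sub_eq_zero, ← AddCircle.coe_sub, AddCircle.coe_eq_zero_iff] at h1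
    obtain ⟨k, hk⟩ := h1
    refine ⟨k, ?_⟩
    rw [zsmul_eq_mul] at hk
    linarith
  · rw [← hLcoe, hF', hf]

theorem init_sym {X X1 : ℝ → ℝ → ℂ} {X2 Xt : ℝ → ℝ → ℂ} {h : ℝ → ℝ} {τ c M : ℝ} (hτ : 0 ≤ τ)
    (F : FD X X1 X2 Xt h τ c M) (hinj : InjOn (X 0) (Ico 0 (2 * π)))
    (hsym : ∀ φ, ∃ ψ, X 0 ψ = -X 0 φ) (hst : ∀ φ, 0 < cdet (X 0 φ) (X1 0 φ)) : CSym X X1 0 := by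
  have h0 : (0:ℝ) ∈ Icc 0 τ := ⟨le_rfl, hτ⟩
  have hc : Continuous (X 0) := continuous_iff_continuousAt.2 fun φ => (F.d1 0 h0 φ).continuousAt
  obtain ⟨σ, hσ, hk, hs⟩ := lift_sym hc (F.per 0 h0) hinj hsym
  refine ⟨σ, hσ, hk, hs, fun φ => ?_⟩
  have hp := par_lemma F.c0 (by linarith [F.M1]) (F.d1 0 h0) (F.d2 0 h0) (F.b1 0 h0) (F.b2 0 h0)
    (F.b0 0 h0) hσ hs φ
  have a1 := hst φ
  have a2 := hst (σ φ)
  rw [hs] at a2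
  rw [cinner]
  simp only [cdet, Complex.neg_re, Complex.neg_im] at *
  generalize (X 0 φ).re = x at *
  generalize (X 0 φ).im = y at *
  generalize (X1 0 φ).re = p at *
  generalize (X1 0 φ).im = q at *
  generalize (X1 0 (σ φ)).re = r at *
  generalize (X1 0 (σ φ)).im = s at *
  -- p s = q r
  have h1 : (x * q - y * p) * (-x * s - -y * r) * (p * r + q * s) =
    -((x * q - y * p) ^ 2 * (r ^ 2 + s ^ 2)) := by
    have hh : r * q = s * p := by linarith
    linear_combination (x^2*q*r - y^2*p*s + x*y*(q*s-p*r)) * hh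
  have h2 : 0 < r ^ 2 + s ^ 2 := by
    rcases eq_or_ne r 0 with rfl | hr
    · rcases eq_or_ne s 0 with rfl | hs
      · simp at a2
      · positivity
    · positivity
  by_contra hn
  push Not at hn
  nlinarith [mul_nonneg (mul_pos a1 a2).le hn, mul_pos (pow_pos a1 2) h2]


theorem part_exists {ω : ℝ} (hω : 0 < ω) {f : ℝ × ℝ → ℂ}
    (hf : ContDiffOn ℝ (⊤ : ℕ∞) f (Ico 0 ω ×ˢ univ))
    (hper : ∀ t ∈ Ico 0 ω, ∀ φ, f (t, φ + 2 * π) = f (t, φ)) :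
    ∃ g0 g1 : ℝ × ℝ → ℂ, ContDiffOn ℝ (⊤ : ℕ∞) g0 (Ico 0 ω ×ˢ univ) ∧
      ContDiffOn ℝ (⊤ : ℕ∞) g1 (Ico 0 ω ×ˢ univ) ∧
      (∀ t ∈ Ico 0 ω, ∀ φ, HasDerivWithinAt (fun s => f (s, φ)) (g0 (t, φ)) (Ico 0 ω) t) ∧
      (∀ t ∈ Ico 0 ω, ∀ φ, HasDerivAt (fun x => f (t, x)) (g1 (t, φ)) φ) ∧
      (∀ t ∈ Ico 0 ω, ∀ φ, g0 (t, φ + 2 * π) = g0 (t, φ)) ∧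
      (∀ t ∈ Ico 0 ω, ∀ φ, g1 (t, φ + 2 * π) = g1 (t, φ)) := by
  have hu : UniqueDiffOn ℝ (Ico (0:ℝ) ω) := uniqueDiffOn_Ico 0 ω
  have hU : UniqueDiffOn ℝ (Ico (0:ℝ) ω ×ˢ (univ : Set ℝ)) := hu.prod uniqueDiffOn_univ
  have hfd : ContDiffOn ℝ (⊤ : ℕ∞) (fderivWithin ℝ f (Ico 0 ω ×ˢ univ)) (Ico 0 ω ×ˢ univ) :=
    hf.fderivWithin hU (by simp)
  have hF : ∀ t ∈ Ico 0 ω, ∀ φ, HasFDerivWithinAt f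
      (fderivWithin ℝ f (Ico 0 ω ×ˢ univ) (t, φ)) (Ico 0 ω ×ˢ univ) (t, φ) := fun t ht φ =>
    (hf.differentiableOn (by simp) (t, φ) ⟨ht, mem_univ _⟩).hasFDerivWithinAt
  have d0 : ∀ t ∈ Ico 0 ω, ∀ φ, HasDerivWithinAt (fun s => f (s, φ))
      (fderivWithin ℝ f (Ico 0 ω ×ˢ univ) (t, φ) (1, 0)) (Ico 0 ω) t := by
    intro t ht φ
    have h1 : HasDerivWithinAt (fun s : ℝ => (s, φ)) ((1 : ℝ), (0 : ℝ)) (Ico 0 ω) t :=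
      (hasDerivWithinAt_id t _).prodMk (hasDerivWithinAt_const t _ φ)
    exact (hF t ht φ).comp_hasDerivWithinAt t h1 (fun s hs => mk_mem_prod hs (mem_univ _))
  have d1 : ∀ t ∈ Ico 0 ω, ∀ φ, HasDerivAt (fun x => f (t, x))
      (fderivWithin ℝ f (Ico 0 ω ×ˢ univ) (t, φ) (0, 1)) φ := by
    intro t ht φ
    have h1 : HasDerivWithinAt (fun s : ℝ => (t, s)) ((0 : ℝ), (1 : ℝ)) univ φ :=
      (hasDerivWithinAt_const φ _ t).prodMk (hasDerivWithinAt_id φ _)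
    have := (hF t ht φ).comp_hasDerivWithinAt φ h1 (fun s _ => mk_mem_prod ht (mem_univ _))
    exact hasDerivWithinAt_univ.1 this
  refine ⟨fun p => fderivWithin ℝ f (Ico 0 ω ×ˢ univ) p (1, 0),
    fun p => fderivWithin ℝ f (Ico 0 ω ×ˢ univ) p (0, 1), hfd.clm_apply contDiffOn_const,
    hfd.clm_apply contDiffOn_const, d0, d1, ?_, ?_⟩
  · intro t ht φ
    have a := d0 t ht (φ + 2 * π)
    have b := (d0 t ht φ).congr_of_mem (fun s hs => hper s hs φ) ht
    exact (hu t ht).eq_deriv _ a b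
  · intro t ht φ
    have a := (d1 t ht (φ + 2 * π)).comp_add_const φ (2 * π)
    have e : (fun x => f (t, x + 2 * π)) = fun x => f (t, x) := funext fun x => hper t ht x
    rw [e] at a
    exact a.unique (d1 t ht φ)

theorem per_mod {β : Type*} {g : ℝ → β} (hper : Function.Periodic g (2 * π)) (φ : ℝ) :
    ∃ ψ ∈ Icc 0 (2 * π), g φ = g ψ := by
  obtain ⟨ψ, h1, h2⟩ := hper.exists_mem_Ico₀ Real.two_pi_pos φ
  exact ⟨ψ, ⟨h1.1, h1.2.le⟩, h2⟩

theorem bd_exists {ω τ : ℝ} (hτ : τ < ω) {g : ℝ × ℝ → ℂ}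
    (hg : ContinuousOn g (Ico 0 ω ×ˢ univ))
    (hper : ∀ t ∈ Ico 0 ω, ∀ φ, g (t, φ + 2 * π) = g (t, φ)) :
    ∃ B, ∀ t ∈ Icc 0 τ, ∀ φ, ‖g (t, φ)‖ ≤ B := by
  have hK : IsCompact (Icc 0 τ ×ˢ Icc 0 (2 * π)) := isCompact_Icc.prod isCompact_Icc
  obtain ⟨B, hB⟩ := hK.exists_bound_of_continuousOn (f := g)
    (hg.mono (fun p hp => ⟨⟨hp.1.1, hp.1.2.trans_lt hτ⟩, mem_univ _⟩))
  refine ⟨B, fun t ht φ => ?_⟩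
  obtain ⟨ψ, h1, h2⟩ := per_mod (g := fun φ => g (t, φ)) (hper t ⟨ht.1, ht.2.trans_lt hτ⟩) φ
  rw [h2]
  exact hB (t, ψ) ⟨ht, h1⟩

theorem lb_exists {ω τ : ℝ} (hτ0 : 0 ≤ τ) (hτ : τ < ω) {g : ℝ × ℝ → ℂ}
    (hg : ContinuousOn g (Ico 0 ω ×ˢ univ)) (hne : ∀ t ∈ Ico 0 ω, ∀ φ, g (t, φ) ≠ 0)
    (hper : ∀ t ∈ Ico 0 ω, ∀ φ, g (t, φ + 2 * π) = g (t, φ)) :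
    ∃ c, 0 < c ∧ ∀ t ∈ Icc 0 τ, ∀ φ, c ≤ ‖g (t, φ)‖ := by
  have hK : IsCompact (Icc 0 τ ×ˢ Icc 0 (2 * π)) := isCompact_Icc.prod isCompact_Icc
  obtain ⟨p, hp, hmin⟩ := hK.exists_isMinOn ⟨((0:ℝ), (0:ℝ)), ⟨le_rfl, hτ0⟩, le_rfl, by positivity⟩
    (hg.mono (fun p hp => ⟨⟨hp.1.1, hp.1.2.trans_lt hτ⟩, mem_univ _⟩)).norm
  refine ⟨‖g p‖, norm_pos_iff.2 (hne p.1 ⟨hp.1.1, hp.1.2.trans_lt hτ⟩ p.2), fun t ht φ => ?_⟩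
  obtain ⟨ψ, h1, h2⟩ := per_mod (g := fun φ => g (t, φ)) (hper t ⟨ht.1, ht.2.trans_lt hτ⟩) φ
  rw [h2]
  exact hmin (show (t, ψ) ∈ _ from ⟨ht, h1⟩)

theorem mk_FD {X Xt : ℝ → ℝ → ℂ} {h : ℝ → ℝ} {ω τ : ℝ} (hτ0 : 0 ≤ τ) (hτ : τ < ω)
    (hs : ContDiffOn ℝ (⊤ : ℕ∞) (fun p : ℝ × ℝ => X p.1 p.2) (Ico 0 ω ×ˢ univ))
    (hper : ∀ t ∈ Ico 0 ω, Function.Periodic (X t) (2 * π))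
    (hreg : ∀ t ∈ Ico 0 ω, ∀ φ, deriv (X t) φ ≠ 0)
    (hXt : ∀ t ∈ Ico 0 ω, ∀ φ, HasDerivWithinAt (fun s => X s φ) (Xt t φ) (Ico 0 ω) t)
    (flow : ∀ t ∈ Ico 0 ω, ∀ φ, cdet (deriv (X t) φ) (Xt t φ) =
      cdet (deriv (X t) φ) (deriv (deriv (X t)) φ) / ‖deriv (X t) φ‖ ^ 2
        - h t * ‖deriv (X t) φ‖) :
    ∃ c M, FD X (fun t φ => deriv (X t) φ) (fun t φ => deriv (deriv (X t)) φ) Xt h τ c M := by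
  have hω : 0 < ω := hτ0.trans_lt hτ
  obtain ⟨g0, g1, sg0, sg1, dg0, dg1, pg0, pg1⟩ := part_exists hω hs hper
  obtain ⟨g10, g11, sg10, sg11, dg10, dg11, pg10, pg11⟩ := part_exists hω sg1 pg1
  have hin : ∀ t ∈ Icc 0 τ, t ∈ Ico 0 ω := fun t ht => ⟨ht.1, ht.2.trans_lt hτ⟩
  have hsub : Icc 0 τ ⊆ Ico 0 ω := hin
  have hsub2 : Icc 0 τ ×ˢ (univ : Set ℝ) ⊆ Ico 0 ω ×ˢ univ := prod_mono hsub subset_rfl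
  have e1 : ∀ t ∈ Ico 0 ω, ∀ φ, deriv (X t) φ = g1 (t, φ) := fun t ht φ => (dg1 t ht φ).deriv
  have e1' : ∀ t ∈ Ico 0 ω, deriv (X t) = fun φ => g1 (t, φ) := fun t ht => funext (e1 t ht)
  have e2 : ∀ t ∈ Ico 0 ω, ∀ φ, deriv (deriv (X t)) φ = g11 (t, φ) := fun t ht φ => by
    rw [e1' t ht]; exact (dg11 t ht φ).deriv
  have e0 : ∀ t ∈ Ico 0 ω, ∀ φ, Xt t φ = g0 (t, φ) := fun t ht φ =>
    (uniqueDiffOn_Ico 0 ω t ht).eq_deriv _ (hXt t ht φ) (dg0 t ht φ)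
  obtain ⟨B0, hB0⟩ := bd_exists hτ sg0.continuousOn pg0
  obtain ⟨B1, hB1⟩ := bd_exists hτ sg1.continuousOn pg1
  obtain ⟨B2, hB2⟩ := bd_exists hτ sg11.continuousOn pg11
  obtain ⟨B3, hB3⟩ := bd_exists hτ sg10.continuousOn pg10
  obtain ⟨c, hc, hcb⟩ := lb_exists hτ0 hτ sg1.continuousOn
    (fun t ht φ => by rw [← e1 t ht]; exact hreg t ht φ) pg1
  set M := max (max (max B0 B1) (max B2 B3)) 1 with hM
  have m0 : B0 ≤ M := (le_max_left _ _).trans ((le_max_left _ _).trans (le_max_left _ _))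
  have m1 : B1 ≤ M := (le_max_right _ _).trans ((le_max_left _ _).trans (le_max_left _ _))
  have m2 : B2 ≤ M := (le_max_left _ _).trans ((le_max_right _ _).trans (le_max_left _ _))
  have m3 : B3 ≤ M := (le_max_right _ _).trans ((le_max_right _ _).trans (le_max_left _ _))
  refine ⟨min c 1, M, ?_⟩
  constructor
  · positivity
  · exact min_le_right _ _
  · exact le_max_right _ _
  · intro t ht φ
    have := dg1 t (hin t ht) φ
    simp only [e1 t (hin t ht)]
    exact this
  · intro t ht φ
    have := dg11 t (hin t ht) φ
    simp only [e2 t (hin t ht)]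
    rw [← e1' t (hin t ht)] at this
    exact this
  · exact fun t ht φ => (hXt t (hin t ht) φ).mono hsub
  · intro t ht φ
    simp only [e1 t (hin t ht)]
    exact (min_le_left _ _).trans (hcb t ht φ)
  · intro t ht φ
    simp only [e1 t (hin t ht)]
    exact (hB1 t ht φ).trans m1
  · intro t ht φ
    simp only [e2 t (hin t ht)]
    exact (hB2 t ht φ).trans m2
  · intro t ht φ
    rw [e0 t (hin t ht)]
    exact (hB0 t ht φ).trans m0
  · intro t ht t' ht' φ
    have := (convex_Icc 0 τ).norm_image_sub_le_of_norm_hasDerivWithin_le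
      (fun s hs => (dg0 s (hin s hs) φ).mono hsub) (fun s hs => (hB0 s hs φ).trans m0) ht' ht
    exact this
  · intro t ht t' ht' φ
    have := (convex_Icc 0 τ).norm_image_sub_le_of_norm_hasDerivWithin_le
      (fun s hs => (dg10 s (hin s hs) φ).mono hsub) (fun s hs => (hB3 s hs φ).trans m3) ht' ht
    simp only [e1 t (hin t ht), e1 t' (hin t' ht')]
    exact this
  · exact fun t ht => hper t (hin t ht)
  · exact hs.continuousOn.mono hsub2
  · refine (sg0.continuousOn.mono hsub2).congr fun p hp => ?_
    exact e0 p.1 (hin _ hp.1) p.2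
  · exact fun t ht φ => flow t (hin t ht) φ


/-- identification of the plane with the complex numbers -/
def toC : (ℝ × ℝ) ≃L[ℝ] ℂ := Complex.equivRealProdCLM.symm

theorem toC_re (v : ℝ × ℝ) : (toC v).re = v.1 := by simp [toC]

theorem toC_im (v : ℝ × ℝ) : (toC v).im = v.2 := by simp [toC]

theorem toC_norm (v : ℝ × ℝ) : ‖toC v‖ = vnorm v := by
  rw [vnorm, ← toC_re, ← toC_im, ← cnormsq, Real.sqrt_sq (norm_nonneg _)]

theorem toC_det (v w : ℝ × ℝ) : cdet (toC v) (toC w) = vdet v w := by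
  simp only [cdet, vdet, toC_re, toC_im]

theorem toC_deriv {Z : ℝ → ℝ × ℝ} (hZ : Differentiable ℝ Z) :
    deriv (fun φ => toC (Z φ)) = fun φ => toC (deriv Z φ) := by
  ext1 φ
  exact (toC.toContinuousLinearMap.hasFDerivAt.comp_hasDerivAt φ (hZ φ).hasDerivAt).deriv

theorem vdet_unit (Z : ℝ → ℝ × ℝ) (φ : ℝ) (a : ℝ × ℝ) :
    vdet a (unitTangent Z φ) = (vnorm (deriv Z φ))⁻¹ * vdet a (deriv Z φ) := by
  simp [vdet, unitTangent]; ring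

theorem star_iff {Z : ℝ → ℝ × ℝ} (hZ : IsSmoothClosedCurve Z) (O : ℝ × ℝ) (φ : ℝ) :
    0 < vdet (Z φ - O) (unitTangent Z φ) ↔ 0 < vdet (Z φ - O) (deriv Z φ) := by
  have : 0 < vnorm (deriv Z φ) := by
    rw [← toC_norm]; exact norm_pos_iff.2 (by simpa using hZ.regular φ)
  rw [vdet_unit, mul_pos_iff_of_pos_left (inv_pos.2 this)]

theorem flow_det {Z : ℝ → ℝ × ℝ} (hZ : IsSmoothClosedCurve Z) (φ a h : ℝ) :
    vdet (deriv Z φ) (a • unitTangent Z φ + (curv Z φ - h) • innerNormal Z φ) =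
      vdet (deriv Z φ) (deriv (deriv Z) φ) / vnorm (deriv Z φ) ^ 2 - h * vnorm (deriv Z φ) := by
  have hp : 0 < vnorm (deriv Z φ) := by
    rw [← toC_norm]; exact norm_pos_iff.2 (by simpa using hZ.regular φ)
  have hsq : vnorm (deriv Z φ) ^ 2 = (deriv Z φ).1 ^ 2 + (deriv Z φ).2 ^ 2 :=
    Real.sq_sqrt (by positivity)
  have e : vdet (deriv Z φ) (a • unitTangent Z φ + (curv Z φ - h) • innerNormal Z φ) =
      (curv Z φ - h) * (vnorm (deriv Z φ))⁻¹ * ((deriv Z φ).1 ^ 2 + (deriv Z φ).2 ^ 2) := by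
    simp [vdet, unitTangent, innerNormal]; ring
  rw [e, ← hsq, curv]
  field_simp

theorem final_alg {P z v w : ℂ} (hp : cdet w v = 0) (hn : inner ℝ v w < 0)
    (h1 : 0 < cdet (z - P) v) (h2 : 0 < cdet (-z - P) w) : 0 < cdet z v := by
  rw [cinner] at hn
  simp only [cdet, Complex.neg_re, Complex.neg_im, Complex.sub_re, Complex.sub_im] at *
  generalize z.re = x at *
  generalize z.im = y at *
  generalize v.re = p at *
  generalize v.im = q at *
  generalize w.re = r at *
  generalize w.im = s at *
  generalize P.re = a at *
  generalize P.im = b at *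
  have hv : 0 < p ^ 2 + q ^ 2 := by
    rcases eq_or_ne p 0 with rfl | hp
    · rcases eq_or_ne q 0 with rfl | hq
      · simp at h1
      · positivity
    · positivity
  -- (p²+q²) w = (v·w) v
  have hr : (p ^ 2 + q ^ 2) * r = (p * r + q * s) * p := by linear_combination q * hp
  have hs : (p ^ 2 + q ^ 2) * s = (p * r + q * s) * q := by linear_combination -p * hp
  have h3 : 0 < (p ^ 2 + q ^ 2) * ((-x - a) * s - (-y - b) * r) := mul_pos hv h2
  have h4 : (p ^ 2 + q ^ 2) * ((-x - a) * s - (-y - b) * r) =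
      -(p * r + q * s) * ((x + a) * q - (y + b) * p) := by
    linear_combination (-x - a) * hs - (-y - b) * hr
  rw [h4] at h3
  have h5 := (mul_pos_iff_of_pos_left (show 0 < -(p * r + q * s) by linarith)).1 h3
  linarith


/-- If at some time the evolving curve of Gage's area-preserving flow (with star-shaped
centrosymmetric initial curve) is star-shaped with respect to some point, then the
origin `O` itself is one of its star centers. -/
theorem gapf_origin_is_star_center
    (X : ℝ → ℝ → ℝ × ℝ) (X₀ : ℝ → ℝ × ℝ) (ω : ℝ)
    (hX₀ : IsSmoothClosedCurve X₀) (hemb : IsEmbeddedCurve X₀)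
    (hstar₀ : StarShapedWrt X₀ 0) (hsym₀ : CentroSymmetricWrt X₀ 0)
    (hsol : IsGAPFSolutionOn X X₀ (Set.Ico 0 ω)) :
    ∀ t ∈ Set.Ico (0:ℝ) ω,
      (∃ P : ℝ × ℝ, StarShapedWrt (X t) P) → StarShapedWrt (X t) 0 := by
  rintro τ ⟨hτ0, hτ⟩ ⟨P, hP⟩
  obtain ⟨α, hflow⟩ := hsol.flow
  have hω : 0 < ω := hτ0.trans_lt hτ
  have hX0 : X 0 = X₀ := funext hsol.init
  have hdif : ∀ t ∈ Ico 0 ω, Differentiable ℝ (X t) := fun t ht =>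
    (hsol.curve t ht).smooth.differentiable (by simp)
  have hdif2 : ∀ t ∈ Ico 0 ω, Differentiable ℝ (deriv (X t)) := fun t ht =>
    ((contDiff_infty_iff_deriv.1 (hsol.curve t ht).smooth).2).differentiable (by simp)
  have E1 : ∀ t ∈ Ico 0 ω, deriv (fun φ => toC (X t φ)) = fun φ => toC (deriv (X t) φ) :=
    fun t ht => toC_deriv (hdif t ht)
  have E2 : ∀ t ∈ Ico 0 ω, deriv (deriv (fun φ => toC (X t φ))) =
      fun φ => toC (deriv (deriv (X t)) φ) := fun t ht => by
    rw [E1 t ht]; exact toC_deriv (hdif2 t ht)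
  obtain ⟨c, M, F⟩ := mk_FD (X := fun t φ => toC (X t φ))
    (Xt := fun t φ => toC (α t φ • unitTangent (X t) φ +
          (curv (X t) φ - 2 * π / clen (X t)) • innerNormal (X t) φ))
    (h := fun t => 2 * π / clen (X t)) hτ0 hτ
    (toC.contDiff.comp_contDiffOn hsol.smooth)
    (fun t ht φ => by simp only [(hsol.curve t ht).periodic φ])
    (fun t ht φ => by
      rw [E1 t ht]
      simpa using (hsol.curve t ht).regular φ)
    (fun t ht φ =>
      toC.toContinuousLinearMap.hasFDerivAt.comp_hasDerivWithinAt t (hflow t ht φ))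
    (fun t ht φ => by
      rw [E2 t ht, E1 t ht]
      simp only [toC_det, toC_norm]
      exact flow_det (hsol.curve t ht) φ _ _)
  have h0 : (0:ℝ) ∈ Ico 0 ω := ⟨le_rfl, hω⟩
  have hτm : τ ∈ Ico 0 ω := ⟨hτ0, hτ⟩
  have hinit := init_sym hτ0 F
    (by
      rw [hX0]
      intro a ha b hb hab
      exact hemb ha hb (toC.injective hab))
    (by
      intro φ
      have hm : (2:ℝ) • (0 : ℝ × ℝ) - X₀ φ ∈ Set.range X₀ := by
        rw [← hsym₀]
        exact ⟨X₀ φ, ⟨φ, rfl⟩, rfl⟩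
      obtain ⟨ψ, hψ⟩ := hm
      refine ⟨ψ, ?_⟩
      simp only [hX0, hψ]
      simp)
    (by
      intro φ
      simp only [E1 0 h0]
      rw [toC_det, hX0]
      have := (star_iff hX₀ 0 φ).1 (hstar₀ φ)
      simpa using this)
  have hτI : τ ∈ Icc 0 τ := ⟨hτ0, le_rfl⟩
  obtain ⟨σ, hσ, -, hs, hn⟩ := sym_all F hinit τ hτI
  intro φ
  rw [star_iff (hsol.curve τ hτm), sub_zero, ← toC_det]
  have hp := par_lemma F.c0 (by linarith [F.M1]) (F.d1 τ hτI) (F.d2 τ hτI) (F.b1 τ hτI)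
    (F.b2 τ hτI) (F.b0 τ hτI) hσ hs φ
  have hn := hn φ
  have hs := hs φ
  simp only [E1 τ hτm] at hp hn
  refine final_alg (P := toC P) hp hn ?_ ?_
  · rw [← map_sub, toC_det]
    exact (star_iff (hsol.curve τ hτm) P φ).1 (hP φ)
  · simp only at hs
    rw [← hs, ← map_sub, toC_det]
    exact (star_iff (hsol.curve τ hτm) P (σ φ)).1 (hP (σ φ))
end
end

section
/- Let X₀ be a smooth, embedded, closed plane curve, star-shaped and centrosymmetric with respect to the origin O, and suppose Gage's area-preserving flow with initial curve X₀ has a smooth solution X(·,t) on a time interval [0,ω). Then the evolving curve X(·,t) is star-shaped with respect to O for every t ∈ [0,ω). -/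
open Real Set MeasureTheory Filter

noncomputable section

/-- A twice differentiable closed plane curve, star-shaped with respect to the origin, given
by its coordinates and their derivatives. -/
structure Crv (x y x1 y1 x2 y2 : ℝ → ℝ) : Prop where
  hx : ∀ s, HasDerivAt x (x1 s) s
  hy : ∀ s, HasDerivAt y (y1 s) s
  hx1 : ∀ s, HasDerivAt x1 (x2 s) s
  hy1 : ∀ s, HasDerivAt y1 (y2 s) s
  px : ∀ s, x (s + 2 * π) = x s
  py : ∀ s, y (s + 2 * π) = y s
  D : ∀ s, 0 < x s * y1 s - y s * x1 s

namespace Crv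
variable {x y x1 y1 x2 y2 : ℝ → ℝ}

lemma q_pos (h : Crv x y x1 y1 x2 y2) (s : ℝ) : 0 < x s ^ 2 + y s ^ 2 := by
  have := h.D s
  by_contra hc
  have hx : x s = 0 := by nlinarith [sq_nonneg (x s), sq_nonneg (y s)]
  have hy : y s = 0 := by nlinarith [sq_nonneg (x s), sq_nonneg (y s)]
  rw [hx, hy] at this; simp at this

lemma cx (h : Crv x y x1 y1 x2 y2) : Continuous x :=
  continuous_iff_continuousAt.2 fun s => (h.hx s).continuousAt
lemma cy (h : Crv x y x1 y1 x2 y2) : Continuous y :=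
  continuous_iff_continuousAt.2 fun s => (h.hy s).continuousAt
lemma cx1 (h : Crv x y x1 y1 x2 y2) : Continuous x1 :=
  continuous_iff_continuousAt.2 fun s => (h.hx1 s).continuousAt
lemma cy1 (h : Crv x y x1 y1 x2 y2) : Continuous y1 :=
  continuous_iff_continuousAt.2 fun s => (h.hy1 s).continuousAt

lemma px1 (h : Crv x y x1 y1 x2 y2) (s : ℝ) : x1 (s + 2 * π) = x1 s := by
  have h1 := (h.hx (s + 2 * π)).comp_add_const s (2 * π)
  have : (fun s => x (s + 2 * π)) = x := funext h.px
  rw [this] at h1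
  exact h1.unique (h.hx s)
lemma py1 (h : Crv x y x1 y1 x2 y2) (s : ℝ) : y1 (s + 2 * π) = y1 s := by
  have h1 := (h.hy (s + 2 * π)).comp_add_const s (2 * π)
  have : (fun s => y (s + 2 * π)) = y := funext h.py
  rw [this] at h1
  exact h1.unique (h.hy s)

lemma hq (h : Crv x y x1 y1 x2 y2) (s : ℝ) :
    HasDerivAt (fun s => x s ^ 2 + y s ^ 2) (2 * (x s * x1 s + y s * y1 s)) s := by
  have := ((h.hx s).pow 2).add ((h.hy s).pow 2)
  refine this.congr_deriv ?_
  simp; ring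

lemma lift (h : Crv x y x1 y1 x2 y2) : ∃ Θ : ℝ → ℝ,
    (∀ s, HasDerivAt Θ ((x s * y1 s - y s * x1 s) / (x s ^ 2 + y s ^ 2)) s) ∧
    (∀ s, x s = √(x s ^ 2 + y s ^ 2) * cos (Θ s)) ∧
    (∀ s, y s = √(x s ^ 2 + y s ^ 2) * sin (Θ s)) := by
  have hc : Continuous (fun s => (x s * y1 s - y s * x1 s) / (x s ^ 2 + y s ^ 2)) := by
    have := h.cx; have := h.cy; have := h.cx1; have := h.cy1
    refine Continuous.div (by fun_prop) (by fun_prop) (fun s => (h.q_pos s).ne')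
  set z : ℂ := ⟨x 0, y 0⟩ with hz
  have hz0 : z ≠ 0 := by
    intro h0
    have h1 := congrArg Complex.re h0
    have h2 := congrArg Complex.im h0
    simp [hz] at h1 h2
    have := h.q_pos 0
    rw [h1, h2] at this; simp at this
  have hnz : ‖z‖ = √(x 0 ^ 2 + y 0 ^ 2) := by
    rw [Complex.norm_eq_sqrt_sq_add_sq]
  set Θ : ℝ → ℝ := fun s =>
    (∫ u in (0:ℝ)..s, (x u * y1 u - y u * x1 u) / (x u ^ 2 + y u ^ 2)) + z.arg with hΘ
  have hd : ∀ s, HasDerivAt Θ ((x s * y1 s - y s * x1 s) / (x s ^ 2 + y s ^ 2)) s := by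
    intro s
    exact (intervalIntegral.integral_hasDerivAt_right (hc.intervalIntegrable _ _)
      hc.aestronglyMeasurable.stronglyMeasurableAtFilter hc.continuousAt).add_const _
  have h0 : Θ 0 = z.arg := by simp [hΘ]
  have hr : ∀ s, 0 < √(x s ^ 2 + y s ^ 2) := fun s => Real.sqrt_pos.2 (h.q_pos s)
  have hsq : ∀ s, √(x s ^ 2 + y s ^ 2) ^ 2 = x s ^ 2 + y s ^ 2 :=
    fun s => Real.sq_sqrt (h.q_pos s).le
  have hrd : ∀ s, HasDerivAt (fun s => √(x s ^ 2 + y s ^ 2))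
      ((2 * (x s * x1 s + y s * y1 s)) / (2 * √(x s ^ 2 + y s ^ 2))) s :=
    fun s => (h.hq s).sqrt (h.q_pos s).ne'
  have ha : ∀ s, HasDerivAt (fun s => (x s * cos (Θ s) + y s * sin (Θ s)) /
      √(x s ^ 2 + y s ^ 2)) 0 s := by
    intro s
    have := (((h.hx s).mul (hd s).cos).add ((h.hy s).mul (hd s).sin)).div (hrd s) (hr s).ne'
    refine this.congr_deriv ?_
    rw [div_eq_zero_iff]; left
    simp only [Pi.add_apply, Pi.mul_apply]
    have h1 := hr s
    have h2 := hsq s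
    have h3 := h.q_pos s
    set r := √(x s ^ 2 + y s ^ 2)
    rw [← h2]
    field_simp
    rw [h2]
    ring
  have hb : ∀ s, HasDerivAt (fun s => (y s * cos (Θ s) - x s * sin (Θ s)) /
      √(x s ^ 2 + y s ^ 2)) 0 s := by
    intro s
    have := (((h.hy s).mul (hd s).cos).sub ((h.hx s).mul (hd s).sin)).div (hrd s) (hr s).ne'
    refine this.congr_deriv ?_
    rw [div_eq_zero_iff]; left
    simp only [Pi.sub_apply, Pi.mul_apply]
    have h1 := hr s
    have h2 := hsq s
    have h3 := h.q_pos s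
    set r := √(x s ^ 2 + y s ^ 2)
    rw [← h2]
    field_simp
    rw [h2]
    ring
  have hA : ∀ s, (x s * cos (Θ s) + y s * sin (Θ s)) / √(x s ^ 2 + y s ^ 2) = 1 := by
    intro s
    have := is_const_of_deriv_eq_zero (fun s => (ha s).differentiableAt)
      (fun s => (ha s).deriv) s 0
    rw [this, h0, Complex.cos_arg hz0, Complex.sin_arg, hnz]
    have h1 := hr 0
    have h2 := hsq 0
    set r := √(x 0 ^ 2 + y 0 ^ 2)
    simp only [hz]
    field_simp
    linarith
  have hB : ∀ s, (y s * cos (Θ s) - x s * sin (Θ s)) / √(x s ^ 2 + y s ^ 2) = 0 := by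
    intro s
    have := is_const_of_deriv_eq_zero (fun s => (hb s).differentiableAt)
      (fun s => (hb s).deriv) s 0
    rw [this, h0, Complex.cos_arg hz0, Complex.sin_arg, hnz]
    have h1 := hr 0
    simp only [hz]
    field_simp
    ring
  refine ⟨Θ, hd, fun s => ?_, fun s => ?_⟩
  · have h1 := hA s
    have h2 := hB s
    have h3 := hr s
    set r := √(x s ^ 2 + y s ^ 2)
    rw [div_eq_iff h3.ne'] at h1 h2
    linear_combination (cos (Θ s)) * h1 - (sin (Θ s)) * h2 + (-x s) * (sin_sq_add_cos_sq (Θ s))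
  · have h1 := hA s
    have h2 := hB s
    have h3 := hr s
    set r := √(x s ^ 2 + y s ^ 2)
    rw [div_eq_iff h3.ne'] at h1 h2
    linear_combination (sin (Θ s)) * h1 + (cos (Θ s)) * h2 + (-y s) * (sin_sq_add_cos_sq (Θ s))

/-- The polar angle of a star-shaped closed curve. -/
lemma lift' (h : Crv x y x1 y1 x2 y2) : ∃ (Θ : ℝ → ℝ) (n : ℕ),
    (∀ s, HasDerivAt Θ ((x s * y1 s - y s * x1 s) / (x s ^ 2 + y s ^ 2)) s) ∧
    (∀ s, x s = √(x s ^ 2 + y s ^ 2) * cos (Θ s)) ∧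
    (∀ s, y s = √(x s ^ 2 + y s ^ 2) * sin (Θ s)) ∧
    StrictMono Θ ∧ 1 ≤ n ∧ (∀ s, Θ (s + 2 * π) = Θ s + n * (2 * π)) ∧ Function.Surjective Θ := by
  obtain ⟨Θ, hd, hX, hY⟩ := h.lift
  have hmono : StrictMono Θ := by
    refine strictMono_of_deriv_pos fun s => ?_
    rw [(hd s).deriv]
    exact div_pos (h.D s) (h.q_pos s)
  have hper : ∀ s, Θ (s + 2 * π) - Θ s = Θ (0 + 2 * π) - Θ 0 := by
    intro s
    have hh : ∀ s, HasDerivAt (fun s => Θ (s + 2 * π) - Θ s) 0 s := by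
      intro s
      refine (((hd (s + 2 * π)).comp_add_const s (2 * π)).sub (hd s)).congr_deriv ?_
      rw [h.px, h.py, h.px1, h.py1, sub_self]
    exact is_const_of_deriv_eq_zero (fun s => (hh s).differentiableAt)
      (fun s => (hh s).deriv) s 0
  have hWpos : 0 < Θ (0 + 2 * π) - Θ 0 := by
    have : Θ 0 < Θ (0 + 2 * π) := hmono (by positivity)
    linarith
  have hcos : cos (Θ (0 + 2 * π) - Θ 0) = 1 := by
    have h1 := hX (0 + 2 * π)
    have h2 := hY (0 + 2 * π)
    rw [h.px, h.py] at h1 h2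
    have h3 := hX 0
    have h4 := hY 0
    have h5 : 0 < √(x 0 ^ 2 + y 0 ^ 2) := Real.sqrt_pos.2 (h.q_pos 0)
    set r := √(x 0 ^ 2 + y 0 ^ 2)
    have e1 : cos (Θ (0 + 2 * π)) = cos (Θ 0) := by
      have := h1.symm.trans h3
      exact mul_left_cancel₀ h5.ne' this
    have e2 : sin (Θ (0 + 2 * π)) = sin (Θ 0) := by
      have := h2.symm.trans h4
      exact mul_left_cancel₀ h5.ne' this
    rw [cos_sub, e1, e2]
    nlinarith [sin_sq_add_cos_sq (Θ 0)]
  obtain ⟨k, hk⟩ := (cos_eq_one_iff _).1 hcos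
  have hk0 : 0 < k := by
    rw [← hk] at hWpos
    have : (0:ℝ) < k := by
      by_contra hc
      push Not at hc
      nlinarith [pi_pos]
    exact_mod_cast this
  obtain ⟨n, rfl⟩ := Int.eq_ofNat_of_zero_le hk0.le
  have hperiod : ∀ s, Θ (s + 2 * π) = Θ s + n * (2 * π) := by
    intro s
    have := hper s
    rw [← hk] at this
    push_cast at this
    linarith
  have hn : 1 ≤ n := by omega
  have hn' : (1:ℝ) ≤ n := by exact_mod_cast hn
  refine ⟨Θ, n, hd, hX, hY, hmono, hn, hperiod, ?_⟩
  have hcont : Continuous Θ := continuous_iff_continuousAt.2 fun s => (hd s).continuousAt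
  have hup : ∀ m : ℕ, Θ (0 + m * (2 * π)) = Θ 0 + m * (n * (2 * π)) := by
    intro m
    induction m with
    | zero => simp
    | succ m ih =>
      push_cast
      rw [show 0 + ((m:ℝ) + 1) * (2 * π) = (0 + m * (2 * π)) + 2 * π by ring, hperiod, ih]
      ring
  have hdn : ∀ m : ℕ, Θ (0 - m * (2 * π)) = Θ 0 - m * (n * (2 * π)) := by
    intro m
    induction m with
    | zero => simp
    | succ m ih =>
      have := hperiod (0 - ((m:ℝ) + 1) * (2 * π))
      push_cast
      rw [show 0 - ((m:ℝ) + 1) * (2 * π) + 2 * π = (0 - m * (2 * π)) by ring, ih] at this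
      linarith
  intro a
  obtain ⟨m, hm⟩ := exists_nat_ge (|a - Θ 0| )
  have hmm : |a - Θ 0| ≤ m * (n * (2 * π)) := by
    have : (1:ℝ) ≤ n * (2 * π) := by nlinarith [pi_gt_three]
    nlinarith [abs_nonneg (a - Θ 0)]
  have := abs_le.1 hmm
  have hm0 : (0:ℝ) ≤ m := Nat.cast_nonneg m
  have hle : 0 - (m:ℝ) * (2 * π) ≤ 0 + m * (2 * π) := by nlinarith [pi_pos]
  obtain ⟨s, -, hs⟩ := intermediate_value_Icc hle hcont.continuousOn
    (show a ∈ Icc _ _ by rw [hup, hdn]; constructor <;> linarith)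
  exact ⟨s, hs⟩

lemma det_eq {Θ : ℝ → ℝ} (hX : ∀ s, x s = √(x s ^ 2 + y s ^ 2) * cos (Θ s))
    (hY : ∀ s, y s = √(x s ^ 2 + y s ^ 2) * sin (Θ s)) (s u : ℝ) :
    x s * y u - y s * x u =
      √(x s ^ 2 + y s ^ 2) * √(x u ^ 2 + y u ^ 2) * sin (Θ u - Θ s) := by
  have h1 := hX s; have h2 := hY s; have h3 := hX u; have h4 := hY u
  set r := √(x s ^ 2 + y s ^ 2)
  set r' := √(x u ^ 2 + y u ^ 2)
  rw [h1, h2, h3, h4, sin_sub]; ring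

lemma dot_eq {Θ : ℝ → ℝ} (hX : ∀ s, x s = √(x s ^ 2 + y s ^ 2) * cos (Θ s))
    (hY : ∀ s, y s = √(x s ^ 2 + y s ^ 2) * sin (Θ s)) (s u : ℝ) :
    x s * x u + y s * y u =
      √(x s ^ 2 + y s ^ 2) * √(x u ^ 2 + y u ^ 2) * cos (Θ u - Θ s) := by
  have h1 := hX s; have h2 := hY s; have h3 := hX u; have h4 := hY u
  set r := √(x s ^ 2 + y s ^ 2)
  set r' := √(x u ^ 2 + y u ^ 2)
  rw [h1, h2, h3, h4, cos_sub]; ring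

lemma partner (h : Crv x y x1 y1 x2 y2) (s : ℝ) : ∃ s' ∈ Icc s (s + 2 * π),
    x s * y s' - y s * x s' = 0 ∧ x s * x s' + y s * y s' < 0 ∧
    ∀ u u', s ≤ u → u ≤ u' → u' ≤ s' → 0 ≤ x u * y u' - y u * x u' := by
  obtain ⟨Θ, n, hd, hX, hY, hmono, hn, hper, -⟩ := h.lift'
  have hcont : Continuous Θ := continuous_iff_continuousAt.2 fun s => (hd s).continuousAt
  have hn' : (1:ℝ) ≤ n := by exact_mod_cast hn
  have hr : ∀ s, 0 < √(x s ^ 2 + y s ^ 2) := fun s => Real.sqrt_pos.2 (h.q_pos s)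
  obtain ⟨s', hs', he⟩ := intermediate_value_Icc (show s ≤ s + 2 * π by linarith [pi_pos])
    hcont.continuousOn (show Θ s + π ∈ Icc _ _ by
      rw [hper]; constructor <;> nlinarith [pi_pos])
  refine ⟨s', hs', ?_, ?_, ?_⟩
  · rw [det_eq hX hY, he]; simp
  · rw [dot_eq hX hY, he]; simp
    exact mul_pos (hr _) (hr _)
  · intro u u' h1 h2 h3
    rw [det_eq hX hY]
    refine mul_nonneg (mul_pos (hr _) (hr _)).le (sin_nonneg_of_nonneg_of_le_pi ?_ ?_)
    · have := hmono.monotone h2; linarith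
    · have := hmono.monotone h1; have := hmono.monotone h3; linarith

lemma unique (h : Crv x y x1 y1 x2 y2)
    (hinj : ∀ s ∈ Ico 0 (2 * π), ∀ u ∈ Ico 0 (2 * π), x s = x u → y s = y u → s = u)
    (s u : ℝ) (h1 : x s * y u - y s * x u = 0) (h2 : 0 < x s * x u + y s * y u) :
    x s ^ 2 + y s ^ 2 = x u ^ 2 + y u ^ 2 := by
  obtain ⟨Θ, n, hd, hX, hY, hmono, hn, hper, hsurj⟩ := h.lift'
  have hcont : Continuous Θ := continuous_iff_continuousAt.2 fun s => (hd s).continuousAt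
  have hr : ∀ s, 0 < √(x s ^ 2 + y s ^ 2) := fun s => Real.sqrt_pos.2 (h.q_pos s)
  have hpx : Function.Periodic x (2 * π) := h.px
  have hpy : Function.Periodic y (2 * π) := h.py
  set e := hmono.orderIsoOfSurjective Θ hsurj with he
  have hee : ∀ a, Θ (e.symm a) = a := fun a => e.apply_symm_apply a
  have hec : Continuous e.symm := e.symm.continuous
  -- winding number one
  have hinj' : ∀ s u, x s = x u → y s = y u → s < u → u < s + 2 * π → False := by
    intro s u hx hy hsu hus
    have hp : (0:ℝ) < 2 * π := by positivity
    obtain ⟨k, hk, hk'⟩ := existsUnique_sub_zsmul_mem_Ico hp s 0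
    obtain ⟨l, hl, hl'⟩ := existsUnique_sub_zsmul_mem_Ico hp u 0
    simp only [zsmul_eq_mul, zero_add] at hk hl
    have := hinj _ hk _ hl (by rw [hpx.sub_int_mul_eq, hpx.sub_int_mul_eq, hx])
      (by rw [hpy.sub_int_mul_eq, hpy.sub_int_mul_eq, hy])
    have h3 : u - s = ((l - k : ℤ) : ℝ) * (2 * π) := by push_cast; linarith
    have h4 : (0:ℝ) < ((l - k : ℤ) : ℝ) := by
      by_contra hc; push Not at hc; nlinarith
    have h5 : ((l - k : ℤ) : ℝ) < 1 := by
      by_contra hc; push Not at hc; nlinarith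
    have h4' : 0 < l - k := by exact_mod_cast h4
    have h5' : l - k < 1 := by exact_mod_cast h5
    omega
  have hn1 : n = 1 := by
    by_contra hne
    have hn2 : (2:ℝ) ≤ n := by exact_mod_cast (by omega : 2 ≤ n)
    have hcx := h.cx
    have hcy := h.cy
    have hq : Continuous (fun s => x s ^ 2 + y s ^ 2) := by fun_prop
    obtain ⟨m, -, hm⟩ := (isCompact_Icc (a := (0:ℝ)) (b := 2 * π)).exists_isMaxOn
      (nonempty_Icc.2 (by positivity)) hq.continuousOn
    have hm' : ∀ s, x s ^ 2 + y s ^ 2 ≤ x m ^ 2 + y m ^ 2 := by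
      intro s
      have hp : (0:ℝ) < 2 * π := by positivity
      obtain ⟨k, hk, hk'⟩ := existsUnique_sub_zsmul_mem_Ico hp s 0
      simp only [zsmul_eq_mul, zero_add] at hk
      have := hm (Ico_subset_Icc_self hk)
      simp only [mem_ofPred_eq] at this
      rwa [hpx.sub_int_mul_eq, hpy.sub_int_mul_eq] at this
    set g : ℝ → ℝ := fun a => (x (e.symm a) ^ 2 + y (e.symm a) ^ 2) -
      (x (e.symm (a + 2 * π)) ^ 2 + y (e.symm (a + 2 * π)) ^ 2) with hg
    have hgc : Continuous g := by
      have h3 := hq.comp hec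
      have h4 := h3.comp (continuous_id.add (continuous_const (y := 2 * π)))
      exact h3.sub h4
    have hem : e.symm (Θ m) = m := e.symm_apply_apply m
    have hg1 : g (Θ m - 2 * π) ≤ 0 := by
      simp only [hg, sub_add_cancel, hem]; linarith [hm' (e.symm (Θ m - 2 * π))]
    have hg2 : 0 ≤ g (Θ m) := by
      simp only [hg, hem]; linarith [hm' (e.symm (Θ m + 2 * π))]
    obtain ⟨a, -, ha⟩ := intermediate_value_Icc (show Θ m - 2 * π ≤ Θ m by linarith [pi_pos])
      hgc.continuousOn (show (0:ℝ) ∈ Icc _ _ from ⟨hg1, hg2⟩)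
    have hqq : x (e.symm a) ^ 2 + y (e.symm a) ^ 2 =
      (x (e.symm (a + 2 * π)) ^ 2 + y (e.symm (a + 2 * π)) ^ 2) := by
      simp only [hg] at ha; linarith
    refine hinj' (e.symm a) (e.symm (a + 2 * π)) ?_ ?_ ?_ ?_
    · rw [hX (e.symm a), hX (e.symm (a + 2 * π)), hqq, hee, hee, cos_add_two_pi]
    · rw [hY (e.symm a), hY (e.symm (a + 2 * π)), hqq, hee, hee, sin_add_two_pi]
    · exact e.symm.strictMono (by linarith [pi_pos])
    · rw [← hmono.lt_iff_lt, hper, hee, hee]; nlinarith [pi_pos]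
  subst hn1
  have hrr := mul_pos (hr s) (hr u)
  rw [det_eq hX hY] at h1
  rw [dot_eq hX hY] at h2
  have h3 : sin (Θ u - Θ s) = 0 := by
    rcases mul_eq_zero.1 h1 with h | h
    · exact absurd h hrr.ne'
    · exact h
  have h4 : 0 < cos (Θ u - Θ s) := by
    by_contra hc; push Not at hc; nlinarith
  have h5 : cos (Θ u - Θ s) = 1 := by
    nlinarith [sin_sq_add_cos_sq (Θ u - Θ s)]
  obtain ⟨k, hk⟩ := (cos_eq_one_iff _).1 h5
  have hfp : ∀ k : ℤ, Θ (s + k * (2 * π)) = Θ s + k * (2 * π) := by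
    intro k
    have : Function.Periodic (fun s => Θ s - s) (2 * π) := by
      intro s; simp only; rw [hper]; push_cast; ring
    have := this.int_mul k s
    linarith
  have h6 : u = s + k * (2 * π) := by
    apply hmono.injective
    rw [hfp, hk]; ring
  have e1 : x u = x s := by rw [h6]; exact hpx.int_mul k s
  have e2 : y u = y s := by rw [h6]; exact hpy.int_mul k s
  rw [e1, e2]

/-- First and second order conditions at a maximizing pair of opposite points. -/
lemma spatial (h : Crv x y x1 y1 x2 y2) (s1 s2 : ℝ)
    (h1 : x s1 * y s2 - y s1 * x s2 = 0) (h2 : x s1 * x s2 + y s1 * y s2 < 0)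
    (hmax : ∀ u v, x u * y v - y u * x v = 0 → x u * x v + y u * y v < 0 →
      log (x v ^ 2 + y v ^ 2) - log (x u ^ 2 + y u ^ 2) ≤
        log (x s2 ^ 2 + y s2 ^ 2) - log (x s1 ^ 2 + y s1 ^ 2)) :
    (x s1 * x1 s1 + y s1 * y1 s1) / (x s1 * y1 s1 - y s1 * x1 s1) =
      (x s2 * x1 s2 + y s2 * y1 s2) / (x s2 * y1 s2 - y s2 * x1 s2) ∧
    ((x1 s2 ^ 2 + y1 s2 ^ 2 + x s2 * x2 s2 + y s2 * y2 s2) * (x s2 * y1 s2 - y s2 * x1 s2) -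
      (x s2 * x1 s2 + y s2 * y1 s2) * (x s2 * y2 s2 - y s2 * x2 s2)) /
        (x s2 * y1 s2 - y s2 * x1 s2) ^ 2 *
        ((x s2 ^ 2 + y s2 ^ 2) / (x s2 * y1 s2 - y s2 * x1 s2)) ≤
    ((x1 s1 ^ 2 + y1 s1 ^ 2 + x s1 * x2 s1 + y s1 * y2 s1) * (x s1 * y1 s1 - y s1 * x1 s1) -
      (x s1 * x1 s1 + y s1 * y1 s1) * (x s1 * y2 s1 - y s1 * x2 s1)) /
        (x s1 * y1 s1 - y s1 * x1 s1) ^ 2 *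
        ((x s1 ^ 2 + y s1 ^ 2) / (x s1 * y1 s1 - y s1 * x1 s1)) := by
  obtain ⟨Θ, n, hd, hX, hY, hmono, hn, hper, hsurj⟩ := h.lift'
  have hr : ∀ s, 0 < √(x s ^ 2 + y s ^ 2) := fun s => Real.sqrt_pos.2 (h.q_pos s)
  set e := hmono.orderIsoOfSurjective Θ hsurj with he
  have hee : ∀ a, Θ (e.symm a) = a := fun a => e.apply_symm_apply a
  have hse : ∀ a, e.symm (Θ a) = a := fun a => e.symm_apply_apply a
  have hec : Continuous e.symm := e.symm.continuous
  have hed : ∀ a, HasDerivAt e.symm ((x (e.symm a) ^ 2 + y (e.symm a) ^ 2) /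
      (x (e.symm a) * y1 (e.symm a) - y (e.symm a) * x1 (e.symm a))) a := by
    intro a
    have := HasDerivAt.of_local_left_inverse (f := Θ) (g := e.symm) hec.continuousAt
      (hd (e.symm a)) (div_pos (h.D _) (h.q_pos _)).ne' (Eventually.of_forall hee)
    rwa [inv_div] at this
  set V : ℝ → ℝ := fun s => ((x1 s ^ 2 + y1 s ^ 2 + x s * x2 s + y s * y2 s) *
    (x s * y1 s - y s * x1 s) -
      (x s * x1 s + y s * y1 s) * (x s * y2 s - y s * x2 s)) /
        (x s * y1 s - y s * x1 s) ^ 2 *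
        ((x s ^ 2 + y s ^ 2) / (x s * y1 s - y s * x1 s)) with hV
  set P : ℝ → ℝ := fun s => (x s * x1 s + y s * y1 s) / (x s * y1 s - y s * x1 s) with hP
  have hL : ∀ a, HasDerivAt (fun a => log (x (e.symm a) ^ 2 + y (e.symm a) ^ 2))
      (2 * P (e.symm a)) a := by
    intro a
    have := ((h.hq (e.symm a)).log (h.q_pos _).ne').comp a (hed a)
    refine this.congr_deriv ?_
    have h3 := (h.q_pos (e.symm a)).ne'
    have h4 := (h.D (e.symm a)).ne'
    simp only [hP]
    field_simp
  have hPd : ∀ a, HasDerivAt (fun a => P (e.symm a)) (V (e.symm a)) a := by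
    intro a
    set s := e.symm a
    have h4 := (h.D s).ne'
    have h5 := (((h.hx s).mul (h.hx1 s)).add ((h.hy s).mul (h.hy1 s))).div
      (((h.hx s).mul (h.hy1 s)).sub ((h.hy s).mul (h.hx1 s))) h4
    have h6 := h5.comp a (hed a)
    refine h6.congr_deriv ?_
    simp only [hV, Pi.add_apply, Pi.mul_apply, Pi.sub_apply]
    congr 2
    ring
  obtain ⟨d, hd0⟩ : ∃ d, d = Θ s2 - Θ s1 := ⟨_, rfl⟩
  have hrr := mul_pos (hr s1) (hr s2)
  rw [det_eq hX hY, ← hd0] at h1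
  rw [dot_eq hX hY, ← hd0] at h2
  have h3 : sin d = 0 := by
    rcases mul_eq_zero.1 h1 with h | h
    · exact absurd h hrr.ne'
    · exact h
  have h4 : cos d < 0 := by
    by_contra hc; push Not at hc; nlinarith
  set g : ℝ → ℝ := fun a => log (x (e.symm (a + d)) ^ 2 + y (e.symm (a + d)) ^ 2) -
    log (x (e.symm a) ^ 2 + y (e.symm a) ^ 2) with hg
  have hgd : ∀ a, HasDerivAt g (2 * P (e.symm (a + d)) - 2 * P (e.symm a)) a := fun a =>
    ((hL (a + d)).comp_add_const a d).sub (hL a)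
  have hgd' : deriv g = fun a => 2 * P (e.symm (a + d)) - 2 * P (e.symm a) :=
    funext fun a => (hgd a).deriv
  have hgdd : ∀ a, HasDerivAt (deriv g) (2 * V (e.symm (a + d)) - 2 * V (e.symm a)) a := by
    intro a
    rw [hgd']
    exact (((hPd (a + d)).comp_add_const a d).const_mul 2).sub ((hPd a).const_mul 2)
  have hadd : Θ s1 + d = Θ s2 := by rw [hd0]; ring
  have hgm : ∀ a, g a ≤ g (Θ s1) := by
    intro a
    have h5 : g (Θ s1) = log (x s2 ^ 2 + y s2 ^ 2) - log (x s1 ^ 2 + y s1 ^ 2) := by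
      simp only [hg, hadd, hse]
    rw [h5]
    apply hmax
    · rw [det_eq hX hY, hee, hee]; simp [h3]
    · rw [dot_eq hX hY, hee, hee]; simp
      exact mul_neg_of_pos_of_neg (mul_pos (hr _) (hr _)) h4
  have hlm : IsLocalMax g (Θ s1) := Eventually.of_forall hgm
  have hd1 : deriv g (Θ s1) = 0 := hlm.deriv_eq_zero
  have hd2 : ¬ 0 < deriv (deriv g) (Θ s1) := by
    intro hpos
    have hmin := isLocalMin_of_deriv_deriv_pos hpos hd1 (hgd _).continuousAt
    have hconst : g =ᶠ[nhds (Θ s1)] fun _ => g (Θ s1) := by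
      filter_upwards [hmin] with a ha
      exact le_antisymm (hgm a) ha
    have := hconst.deriv.deriv_eq
    simp at this
    linarith
  rw [(hgdd _).deriv, hadd, hse, hse] at hd2
  rw [hgd'] at hd1
  simp only [hadd, hse] at hd1
  constructor
  · change P s1 = P s2; linarith
  · change V s2 ≤ V s1; linarith

end Crv

/-- Partial derivative in the space variable. -/
def pd (f : ℝ × ℝ → ℝ) : ℝ × ℝ → ℝ := fun p => deriv (fun s => f (p.1, s)) p.2
/-- Partial derivative in the time variable. -/
def pt (f : ℝ × ℝ → ℝ) : ℝ × ℝ → ℝ := fun p => deriv (fun t => f (t, p.2)) p.1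

/-- Smooth functions on the space-time domain. -/
def Sm (ω : ℝ) (f : ℝ × ℝ → ℝ) : Prop := ContDiffOn ℝ (⊤ : ℕ∞) f (Ico 0 ω ×ˢ univ)

lemma uniqueDiffOn_dom (ω : ℝ) : UniqueDiffOn ℝ (Ico (0:ℝ) ω ×ˢ (univ : Set ℝ)) :=
  (uniqueDiffOn_Ico 0 ω).prod uniqueDiffOn_univ

lemma Sm.pd_eq {ω : ℝ} {f : ℝ × ℝ → ℝ} (hf : Sm ω f) {t : ℝ} (ht : t ∈ Ico 0 ω) (s : ℝ) :
    HasDerivAt (fun s => f (t, s)) (fderivWithin ℝ f (Ico 0 ω ×ˢ univ) (t, s) (0, 1)) s := by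
  have h1 : HasFDerivWithinAt f (fderivWithin ℝ f (Ico 0 ω ×ˢ univ) (t, s)) (Ico 0 ω ×ˢ univ)
      (t, s) :=
    ((hf.differentiableOn (by simp)) (t, s) ⟨ht, mem_univ _⟩).hasFDerivWithinAt
  have h2 : HasDerivWithinAt (fun s : ℝ => ((t, s) : ℝ × ℝ)) (0, 1) univ s :=
    ((hasDerivAt_const s t).prodMk (hasDerivAt_id s)).hasDerivWithinAt
  have := h1.comp_hasDerivWithinAt s h2 (fun u _ => ⟨ht, mem_univ _⟩)
  exact hasDerivWithinAt_univ.1 this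

lemma Sm.hpd {ω : ℝ} {f : ℝ × ℝ → ℝ} (hf : Sm ω f) {t : ℝ} (ht : t ∈ Ico 0 ω) (s : ℝ) :
    HasDerivAt (fun s => f (t, s)) (pd f (t, s)) s := by
  have := hf.pd_eq ht s
  exact this.differentiableAt.hasDerivAt

lemma Sm.pd {ω : ℝ} {f : ℝ × ℝ → ℝ} (hf : Sm ω f) : Sm ω (pd f) := by
  have h1 : ContDiffOn ℝ (⊤ : ℕ∞) (fderivWithin ℝ f (Ico 0 ω ×ˢ univ)) (Ico 0 ω ×ˢ univ) :=
    ContDiffOn.fderivWithin hf (uniqueDiffOn_dom ω) (by simp)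
  have h2 : ContDiffOn ℝ (⊤ : ℕ∞)
      (fun p => fderivWithin ℝ f (Ico 0 ω ×ˢ univ) p (0, 1)) (Ico 0 ω ×ˢ univ) :=
    h1.clm_apply contDiffOn_const
  refine h2.congr ?_
  rintro ⟨t, s⟩ ⟨ht, -⟩
  exact (hf.pd_eq ht s).deriv

lemma dom_mem {ω t : ℝ} (ht : t ∈ Ioo 0 ω) (s : ℝ) :
    (Ico (0:ℝ) ω ×ˢ (univ : Set ℝ)) ∈ nhds (t, s) :=
  prod_mem_nhds (Ico_mem_nhds ht.1 ht.2) univ_mem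

lemma Sm.cda {ω : ℝ} {f : ℝ × ℝ → ℝ} (hf : Sm ω f) {t : ℝ} (ht : t ∈ Ioo 0 ω) (s : ℝ) :
    ContDiffAt ℝ (⊤ : ℕ∞) f (t, s) :=
  ContDiffOn.contDiffAt hf (dom_mem ht s)

lemma Sm.fderiv_one {ω : ℝ} {f : ℝ × ℝ → ℝ} (hf : Sm ω f) {t : ℝ} (ht : t ∈ Ioo 0 ω) (s : ℝ) :
    fderiv ℝ f (t, s) (0, 1) = _root_.pd f (t, s) := by
  have h1 := ((hf.cda ht s).differentiableAt (by simp)).hasFDerivAt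
  have h2 : HasDerivAt (fun s : ℝ => ((t, s) : ℝ × ℝ)) (0, 1) s :=
    (hasDerivAt_const s t).prodMk (hasDerivAt_id s)
  exact (h1.comp_hasDerivAt s h2).deriv.symm

lemma Sm.hpt' {ω : ℝ} {f : ℝ × ℝ → ℝ} (hf : Sm ω f) {t : ℝ} (ht : t ∈ Ioo 0 ω) (s : ℝ) :
    HasDerivAt (fun t => f (t, s)) (fderiv ℝ f (t, s) (1, 0)) t := by
  have h1 := ((hf.cda ht s).differentiableAt (by simp)).hasFDerivAt
  have h2 : HasDerivAt (fun t : ℝ => ((t, s) : ℝ × ℝ)) (1, 0) t :=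
    (hasDerivAt_id t).prodMk (hasDerivAt_const t s)
  exact h1.comp_hasDerivAt t h2

lemma Sm.fderiv_zero {ω : ℝ} {f : ℝ × ℝ → ℝ} (hf : Sm ω f) {t : ℝ} (ht : t ∈ Ioo 0 ω) (s : ℝ) :
    fderiv ℝ f (t, s) (1, 0) = pt f (t, s) :=
  (hf.hpt' ht s).deriv.symm

lemma Sm.hpt {ω : ℝ} {f : ℝ × ℝ → ℝ} (hf : Sm ω f) {t : ℝ} (ht : t ∈ Ioo 0 ω) (s : ℝ) :
    HasDerivAt (fun t => f (t, s)) (pt f (t, s)) t := by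
  rw [← hf.fderiv_zero ht s]; exact hf.hpt' ht s

lemma Sm.chain {ω : ℝ} {f : ℝ × ℝ → ℝ} (hf : Sm ω f) {t : ℝ} (ht : t ∈ Ioo 0 ω) {g : ℝ → ℝ}
    {g' : ℝ} (hg : HasDerivAt g g' t) :
    HasDerivAt (fun t => f (t, g t)) (pt f (t, g t) + _root_.pd f (t, g t) * g') t := by
  have h1 := ((hf.cda ht (g t)).differentiableAt (by simp)).hasFDerivAt
  have h2 : HasDerivAt (fun t : ℝ => ((t, g t) : ℝ × ℝ)) (1, g') t :=
    (hasDerivAt_id t).prodMk hg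
  have h3 := h1.comp_hasDerivAt t h2
  refine h3.congr_deriv ?_
  have : ((1, g') : ℝ × ℝ) = (1, 0) + g' • (0, 1) := by simp
  rw [this, map_add, map_smul, hf.fderiv_zero ht, hf.fderiv_one ht, smul_eq_mul]
  ring

/-- Mixed partial derivatives agree. -/
lemma Sm.swap {ω : ℝ} {f : ℝ × ℝ → ℝ} (hf : Sm ω f) {t : ℝ} (ht : t ∈ Ioo 0 ω) (s : ℝ) :
    HasDerivAt (fun s => pt f (t, s)) (pt (_root_.pd f) (t, s)) s := by
  have hsym : IsSymmSndFDerivAt ℝ f (t, s) :=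
    (hf.cda ht s).isSymmSndFDerivAt (by simp; exact WithTop.coe_le_coe.2 (le_top : (2 : ℕ∞) ≤ ⊤))
  have hd : HasFDerivAt (fderiv ℝ f) (fderiv ℝ (fderiv ℝ f) (t, s)) (t, s) := by
    have : ContDiffAt ℝ 1 (fderiv ℝ f) (t, s) :=
      (hf.cda ht s).fderiv_right (m := 1) (by norm_num; exact WithTop.coe_le_coe.2 (le_top : (2 : ℕ∞) ≤ ⊤))
    exact (this.differentiableAt (by simp)).hasFDerivAt
  have h2 : HasDerivAt (fun s : ℝ => ((t, s) : ℝ × ℝ)) (0, 1) s :=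
    (hasDerivAt_const s t).prodMk (hasDerivAt_id s)
  have h2' : HasDerivAt (fun t : ℝ => ((t, s) : ℝ × ℝ)) (1, 0) t :=
    (hasDerivAt_id t).prodMk (hasDerivAt_const t s)
  have h3 : HasDerivAt (fun s => fderiv ℝ f (t, s) (1, 0))
      (fderiv ℝ (fderiv ℝ f) (t, s) (0, 1) (1, 0)) s :=
    (ContinuousLinearMap.apply ℝ ℝ ((1, 0) : ℝ × ℝ)).hasFDerivAt.comp_hasDerivAt s
      (hd.comp_hasDerivAt s h2)
  have h4 : HasDerivAt (fun t => fderiv ℝ f (t, s) (0, 1))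
      (fderiv ℝ (fderiv ℝ f) (t, s) (1, 0) (0, 1)) t :=
    (ContinuousLinearMap.apply ℝ ℝ ((0, 1) : ℝ × ℝ)).hasFDerivAt.comp_hasDerivAt t
      (hd.comp_hasDerivAt t h2')
  have h5 : HasDerivAt (fun t => _root_.pd f (t, s))
      (fderiv ℝ (fderiv ℝ f) (t, s) (1, 0) (0, 1)) t := by
    have h6 : (fun t => _root_.pd f (t, s)) =ᶠ[nhds t]
        fun t => fderiv ℝ f (t, s) (0, 1) := by
      filter_upwards [Ioo_mem_nhds ht.1 ht.2] with τ hτ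
      exact (hf.fderiv_one hτ s).symm
    exact HasDerivAt.congr_of_eventuallyEq h4 h6
  have h7 : pt (_root_.pd f) (t, s) = fderiv ℝ (fderiv ℝ f) (t, s) (1, 0) (0, 1) := h5.deriv
  rw [h7, hsym.eq]
  have h8 : (fun s => pt f (t, s)) = fun s => fderiv ℝ f (t, s) (1, 0) :=
    funext fun u => (hf.fderiv_zero ht u).symm
  rw [h8]
  exact h3

lemma Sm.cont {ω : ℝ} {f : ℝ × ℝ → ℝ} (hf : Sm ω f) : ContinuousOn f (Ico 0 ω ×ˢ univ) :=
  ContDiffOn.continuousOn hf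

lemma Sm.implicit {ω : ℝ} {f : ℝ × ℝ → ℝ} (hf : Sm ω f) {t : ℝ} (ht : t ∈ Ioo 0 ω) (s : ℝ)
    (h0 : f (t, s) = 0) (hne : _root_.pd f (t, s) ≠ 0) :
    ∃ (g : ℝ → ℝ) (g' : ℝ), g t = s ∧ HasDerivAt g g' t ∧ ∀ᶠ τ in nhds t, f (τ, g τ) = 0 := by
  have h1 : HasStrictFDerivAt f (fderiv ℝ f (t, s)) (t, s) :=
    (hf.cda ht s).hasStrictFDerivAt (by simp)
  have h2 : (fderiv ℝ f (t, s) ∘L .inr ℝ ℝ ℝ).IsInvertible := by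
    refine ⟨ContinuousLinearEquiv.unitsEquivAut ℝ (Units.mk0 _ hne), ?_⟩
    ext
    simp [hf.fderiv_one ht s]
  refine ⟨h1.implicitFunctionOfProdDomain h2, _, ?_,
    (h1.hasStrictFDerivAt_implicitFunctionOfProdDomain h2).hasFDerivAt.hasDerivAt, ?_⟩
  · exact (h1.eventually_apply_eq_iff_implicitFunctionOfProdDomain h2).self_of_nhds.mp rfl
  · have := h1.eventually_apply_implicitFunctionOfProdDomain h2
    rwa [h0] at this

/-- One-sided derivative test. -/
lemma deriv_nonpos_left {f : ℝ → ℝ} {f' a : ℝ} (h : HasDerivAt f f' a)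
    (hle : ∀ᶠ t in nhdsWithin a (Iio a), f a ≤ f t) : f' ≤ 0 := by
  have h1 := (hasDerivWithinAt_iff_tendsto_slope' (s := Iio a) (by simp)).1 h.hasDerivWithinAt
  refine le_of_tendsto h1 ?_
  filter_upwards [hle, self_mem_nhdsWithin] with t ht hta
  rw [slope_def_field]
  exact div_nonpos_of_nonneg_of_nonpos (by linarith) (by simp at hta; linarith)

lemma deriv_nonneg_right {f : ℝ → ℝ} {f' a : ℝ} (h : HasDerivAt f f' a)
    (hle : ∀ᶠ t in nhdsWithin a (Ioi a), f a ≤ f t) : 0 ≤ f' := by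
  have h1 := (hasDerivWithinAt_iff_tendsto_slope' (s := Ioi a) (by simp)).1 h.hasDerivWithinAt
  refine ge_of_tendsto h1 ?_
  filter_upwards [hle, self_mem_nhdsWithin] with t ht hta
  rw [slope_def_field]
  exact div_nonneg (by linarith) (by simp at hta; linarith)

lemma second_deriv_nonneg {f f1 : ℝ → ℝ} {f2 a : ℝ} (h : ∀ s, HasDerivAt f (f1 s) s)
    (h1 : HasDerivAt f1 f2 a) (hmin : ∀ s, f a ≤ f s) : f1 a = 0 ∧ 0 ≤ f2 := by
  have hd : deriv f = f1 := funext fun s => (h s).deriv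
  have hlm : IsLocalMin f a := Eventually.of_forall hmin
  have h0 : deriv f a = 0 := hlm.deriv_eq_zero
  refine ⟨by rw [← hd]; exact h0, ?_⟩
  by_contra hc
  push Not at hc
  have hneg : deriv (deriv f) a < 0 := by rw [hd, h1.deriv]; exact hc
  have hmax := isLocalMax_of_deriv_deriv_neg hneg h0 (h a).continuousAt
  have hconst : f =ᶠ[nhds a] fun _ => f a := by
    filter_upwards [hmax] with u hu
    exact le_antisymm hu (hmin u)
  have := hconst.deriv.deriv_eq
  simp at this
  linarith

/-- Gage's flow in coordinates, with the tangential component eliminated. -/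
structure Flw (ω : ℝ) (x y : ℝ × ℝ → ℝ) (lam : ℝ → ℝ) : Prop where
  hx : Sm ω x
  hy : Sm ω y
  px : ∀ t ∈ Ico 0 ω, ∀ s, x (t, s + 2 * π) = x (t, s)
  py : ∀ t ∈ Ico 0 ω, ∀ s, y (t, s + 2 * π) = y (t, s)
  reg : ∀ t ∈ Ico 0 ω, ∀ s, 0 < pd x (t, s) ^ 2 + pd y (t, s) ^ 2
  lam_pos : ∀ t ∈ Ico 0 ω, 0 < lam t
  flow : ∀ t ∈ Ioo 0 ω, ∀ s, pt x (t, s) * pd y (t, s) - pt y (t, s) * pd x (t, s) =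
    lam t * √(pd x (t, s) ^ 2 + pd y (t, s) ^ 2) -
      (pd x (t, s) * pd (pd y) (t, s) - pd y (t, s) * pd (pd x) (t, s)) /
        (pd x (t, s) ^ 2 + pd y (t, s) ^ 2)

/-- The star-shapedness determinant. -/
def Dt (x y : ℝ × ℝ → ℝ) (p : ℝ × ℝ) : ℝ := x p * pd y p - y p * pd x p

lemma Flw.cD {ω : ℝ} {x y : ℝ × ℝ → ℝ} {lam : ℝ → ℝ} (F : Flw ω x y lam) :
    ContinuousOn (Dt x y) (Ico 0 ω ×ˢ univ) :=
  (F.hx.cont.mul F.hy.pd.cont).sub (F.hy.cont.mul F.hx.pd.cont)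

lemma Flw.noncross {ω : ℝ} {x y : ℝ × ℝ → ℝ} {lam : ℝ → ℝ} (F : Flw ω x y lam) {t1 : ℝ}
    (ht1 : t1 ∈ Ioo 0 ω) (hD : ∀ t ∈ Ico 0 t1, ∀ s, 0 < Dt x y (t, s)) (s0 : ℝ)
    (h0 : Dt x y (t1, s0) = 0) : x (t1, s0) = 0 ∧ y (t1, s0) = 0 := by
  by_contra hne
  have ht1' : t1 ∈ Ico 0 ω := ⟨ht1.1.le, ht1.2⟩
  have hDt : ∀ s, HasDerivAt (fun t => Dt x y (t, s)) (pt x (t1, s) * pd y (t1, s) +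
      x (t1, s) * pt (pd y) (t1, s) - (pt y (t1, s) * pd x (t1, s) +
      y (t1, s) * pt (pd x) (t1, s))) t1 := fun s =>
    ((F.hx.hpt ht1 s).mul (F.hy.pd.hpt ht1 s)).sub ((F.hy.hpt ht1 s).mul (F.hx.pd.hpt ht1 s))
  have hev : ∀ s, ∀ᶠ t in nhdsWithin t1 (Iio t1), 0 < Dt x y (t, s) := by
    intro s
    filter_upwards [Ioo_mem_nhdsLT ht1.1] with t ht
    exact hD t ⟨ht.1.le, ht.2⟩ s
  have hge : ∀ s, 0 ≤ Dt x y (t1, s) := by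
    intro s
    have h1 : Tendsto (fun t => Dt x y (t, s)) (nhdsWithin t1 (Iio t1)) (nhds (Dt x y (t1, s))) :=
      (hDt s).continuousAt.tendsto.mono_left nhdsWithin_le_nhds
    exact ge_of_tendsto h1 ((hev s).mono fun t ht => ht.le)
  have hDtle := deriv_nonpos_left (hDt s0) ((hev s0).mono fun t ht => by rw [h0]; exact ht.le)
  have hDs : ∀ s, HasDerivAt (fun s => Dt x y (t1, s))
      (x (t1, s) * pd (pd y) (t1, s) - y (t1, s) * pd (pd x) (t1, s)) s := by
    intro s
    refine (((F.hx.hpd ht1' s).mul (F.hy.pd.hpd ht1' s)).sub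
      ((F.hy.hpd ht1' s).mul (F.hx.pd.hpd ht1' s))).congr_deriv ?_
    ring
  have hDss := ((F.hx.hpd ht1' s0).mul (F.hy.pd.pd.hpd ht1' s0)).sub
      ((F.hy.hpd ht1' s0).mul (F.hx.pd.pd.hpd ht1' s0))
  obtain ⟨e1, e2⟩ := second_deriv_nonneg hDs hDss (fun s => by rw [h0]; exact hge s)
  have hQ := F.reg t1 ht1' s0
  have hlam := F.lam_pos t1 ht1'
  -- differentiate the flow equation
  have hL := ((F.hx.swap ht1 s0).mul (F.hy.pd.hpd ht1' s0)).sub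
    ((F.hy.swap ht1 s0).mul (F.hx.pd.hpd ht1' s0))
  have hQd : HasDerivAt (fun s => pd x (t1, s) ^ 2 + pd y (t1, s) ^ 2)
      (2 * (pd x (t1, s0) * pd (pd x) (t1, s0) + pd y (t1, s0) * pd (pd y) (t1, s0))) s0 := by
    refine (((F.hx.pd.hpd ht1' s0).pow 2).add ((F.hy.pd.hpd ht1' s0).pow 2)).congr_deriv ?_
    simp; ring
  have hR := ((hQd.sqrt hQ.ne').const_mul (lam t1)).sub
    ((((F.hx.pd.hpd ht1' s0).mul (F.hy.pd.pd.hpd ht1' s0)).sub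
    ((F.hy.pd.hpd ht1' s0).mul (F.hx.pd.pd.hpd ht1' s0))).div hQd hQ.ne')
  have hfun : (fun s => pt x (t1, s) * pd y (t1, s) - pt y (t1, s) * pd x (t1, s)) =
    fun s => lam t1 * √(pd x (t1, s) ^ 2 + pd y (t1, s) ^ 2) -
      (pd x (t1, s) * pd (pd y) (t1, s) - pd y (t1, s) * pd (pd x) (t1, s)) /
        (pd x (t1, s) ^ 2 + pd y (t1, s) ^ 2) := funext fun s => F.flow t1 ht1 s
  have hL' : HasDerivAt (fun s => pt x (t1, s) * pd y (t1, s) - pt y (t1, s) * pd x (t1, s))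
    _ s0 := hL
  rw [hfun] at hL'
  have key := hL'.unique hR
  have hflow := F.flow t1 ht1 s0
  simp only [Pi.sub_apply, Pi.mul_apply] at key
  simp only [Dt] at h0
  generalize x (t1, s0) = a at *
  generalize y (t1, s0) = b at *
  generalize pd x (t1, s0) = a1 at *
  generalize pd y (t1, s0) = b1 at *
  generalize pd (pd x) (t1, s0) = a2 at *
  generalize pd (pd y) (t1, s0) = b2 at *
  generalize pd (pd (pd x)) (t1, s0) = a3 at *
  generalize pd (pd (pd y)) (t1, s0) = b3 at *
  generalize pt x (t1, s0) = at0 at *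
  generalize pt y (t1, s0) = bt0 at *
  generalize pt (pd x) (t1, s0) = at1 at *
  generalize pt (pd y) (t1, s0) = bt1 at *
  generalize lam t1 = l at *
  obtain ⟨c, hca, hcb⟩ : ∃ c, a = c * a1 ∧ b = c * b1 := by
    refine ⟨(a * a1 + b * b1) / (a1 ^ 2 + b1 ^ 2), ?_, ?_⟩
    · field_simp; linear_combination b1 * h0
    · field_simp; linear_combination (-a1) * h0
  have hc0 : c ≠ 0 := by rintro rfl; exact hne ⟨by simp [hca], by simp [hcb]⟩
  have hK : a1 * b2 - b1 * a2 = 0 := by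
    have : c * (a1 * b2 - b1 * a2) = 0 := by rw [hca, hcb] at e1; linear_combination e1
    exact (mul_eq_zero.1 this).resolve_left hc0
  obtain ⟨d, hda, hdb⟩ : ∃ d, a2 = d * a1 ∧ b2 = d * b1 := by
    refine ⟨(a2 * a1 + b2 * b1) / (a1 ^ 2 + b1 ^ 2), ?_, ?_⟩
    · field_simp; linear_combination (-b1) * hK
    · field_simp; linear_combination (a1) * hK
  have hr : 0 < √(a1 ^ 2 + b1 ^ 2) := Real.sqrt_pos.2 hQ
  have hr2 : √(a1 ^ 2 + b1 ^ 2) ^ 2 = a1 ^ 2 + b1 ^ 2 := Real.sq_sqrt hQ.le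
  generalize √(a1 ^ 2 + b1 ^ 2) = r at *
  rw [hK] at hflow key
  rw [← hr2] at hflow key hQ
  subst hda hdb hca hcb
  have h3 : l * (2 * (a1 * (d * a1) + b1 * (d * b1)) / (2 * r)) = l * d * r := by
    field_simp; rw [hr2]
  rw [h3] at key
  have key2 : at1 * b1 - bt1 * a1 = - (a1 * b3 - b1 * a3) / r ^ 2 := by
    have h4 : (at0 * b1 - bt0 * a1) = l * r := by rw [hflow]; simp
    have h5 : ((d * a1 * (d * b1) + a1 * b3 - (d * b1 * (d * a1) + b1 * a3)) * r ^ 2 -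
      0 * (2 * (a1 * (d * a1) + b1 * (d * b1)))) / (r ^ 2) ^ 2 =
      (a1 * b3 - b1 * a3) / r ^ 2 := by
      field_simp
      ring
    rw [h5] at key
    rw [neg_div]
    linear_combination key - d * h4
  have h6 : 0 ≤ c * (a1 * b3 - b1 * a3) := by nlinarith
  have h7 : at0 * b1 - bt0 * a1 = l * r := by rw [hflow]; simp
  have h8 : c * (at1 * b1 - bt1 * a1) ≤ 0 := by
    rw [key2, neg_div, mul_neg, ← mul_div_assoc]
    have := div_nonneg h6 (sq_nonneg r)
    linarith
  have h9 : 0 < l * r := mul_pos hlam hr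
  nlinarith

lemma Flw.crv {ω : ℝ} {x y : ℝ × ℝ → ℝ} {lam : ℝ → ℝ} (F : Flw ω x y lam) {t : ℝ}
    (ht : t ∈ Ico 0 ω) (hD : ∀ s, 0 < Dt x y (t, s)) :
    Crv (fun s => x (t, s)) (fun s => y (t, s)) (fun s => pd x (t, s)) (fun s => pd y (t, s))
      (fun s => pd (pd x) (t, s)) (fun s => pd (pd y) (t, s)) where
  hx := F.hx.hpd ht
  hy := F.hy.hpd ht
  hx1 := F.hx.pd.hpd ht
  hy1 := F.hy.pd.hpd ht
  px := F.px t ht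
  py := F.py t ht
  D := hD

lemma exists_shift (u : ℝ) : ∃ k : ℤ, u - k * (2 * π) ∈ Icc 0 (2 * π) := by
  have hp : (0:ℝ) < 2 * π := by positivity
  obtain ⟨k, hk, -⟩ := existsUnique_sub_zsmul_mem_Ico hp u 0
  simp only [zsmul_eq_mul, zero_add] at hk
  exact ⟨k, Ico_subset_Icc_self hk⟩

lemma Flw.temporal {ω : ℝ} {x y : ℝ × ℝ → ℝ} {lam : ℝ → ℝ} (F : Flw ω x y lam) {t : ℝ}
    (ht : t ∈ Ioo 0 ω) (s : ℝ) (hD : 0 < Dt x y (t, s)) :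
    ∃ g : ℝ → ℝ, g t = s ∧ ContinuousAt g t ∧
      (∀ᶠ τ in nhds t, x (t, s) * y (τ, g τ) - y (t, s) * x (τ, g τ) = 0) ∧
      HasDerivAt (fun τ => log (x (τ, g τ) ^ 2 + y (τ, g τ) ^ 2))
        (2 * ((pt x (t, s) * pd y (t, s) - pt y (t, s) * pd x (t, s)) / Dt x y (t, s))) t := by
  have ht' : t ∈ Ico 0 ω := ⟨ht.1.le, ht.2⟩
  set f : ℝ × ℝ → ℝ := fun p => x (t, s) * y p - y (t, s) * x p with hf
  have hfs : Sm ω f := by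
    have h1 : ContDiffOn ℝ (⊤ : ℕ∞) (fun p => x (t, s) * y p) (Ico 0 ω ×ˢ univ) :=
      contDiffOn_const.mul F.hy
    have h2 : ContDiffOn ℝ (⊤ : ℕ∞) (fun p => y (t, s) * x p) (Ico 0 ω ×ˢ univ) :=
      contDiffOn_const.mul F.hx
    exact h1.sub h2
  have hpf : pd f (t, s) = Dt x y (t, s) := by
    have := ((F.hy.hpd ht' s).const_mul (x (t, s))).sub ((F.hx.hpd ht' s).const_mul (y (t, s)))
    exact this.deriv
  obtain ⟨g, g', hg, hgd, hev⟩ := hfs.implicit ht s (by simp only [hf]; ring)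
    (by rw [hpf]; exact hD.ne')
  refine ⟨g, hg, hgd.continuousAt, hev, ?_⟩
  have hxc := F.hx.chain ht hgd
  have hyc := F.hy.chain ht hgd
  have hfc := (hyc.const_mul (x (t, s))).sub (hxc.const_mul (y (t, s)))
  have hfc0 : HasDerivAt (fun τ => x (t, s) * y (τ, g τ) - y (t, s) * x (τ, g τ)) 0 t :=
    (hasDerivAt_const t (0:ℝ)).congr_of_eventuallyEq hev
  have e1 := hfc.unique hfc0
  have hq : 0 < x (t, s) ^ 2 + y (t, s) ^ 2 := by
    by_contra hc
    have hx : x (t, s) = 0 := by nlinarith [sq_nonneg (x (t, s)), sq_nonneg (y (t, s))]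
    have hy : y (t, s) = 0 := by nlinarith [sq_nonneg (x (t, s)), sq_nonneg (y (t, s))]
    simp [Dt, hx, hy] at hD
  have hlog := ((hxc.pow 2).add (hyc.pow 2)).log (by
    simp only [Pi.add_apply, Pi.pow_apply, hg]; exact hq.ne')
  refine hlog.congr_deriv ?_
  simp only [Pi.add_apply, Pi.pow_apply, hg] at e1 ⊢
  simp only [Dt] at hD ⊢
  generalize x (t, s) = a at *
  generalize y (t, s) = b at *
  generalize pd x (t, s) = a1 at *
  generalize pd y (t, s) = b1 at *
  generalize pt x (t, s) = at0 at *
  generalize pt y (t, s) = bt0 at *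
  have hD' := hD.ne'
  rw [← mul_div_assoc, div_eq_div_iff hq.ne' hD']
  norm_num
  linear_combination 2 * (a * a1 + b * b1) * e1

/-- A vector parallel to a nonzero vector is a multiple of it. -/
lemma par {a b c d : ℝ} (h : 0 < a ^ 2 + b ^ 2) (h0 : a * d - b * c = 0) :
    ∃ k, c = k * a ∧ d = k * b := by
  refine ⟨(a * c + b * d) / (a ^ 2 + b ^ 2), ?_, ?_⟩
  · field_simp; linear_combination (-b) * h0
  · field_simp; linear_combination a * h0

/-- The pointwise inequality at a maximizing pair. -/
lemma alg_ineq {S1 S2 D1 D2 Q1 Q2 q1 q2 K1 K2 l V1 V2 : ℝ} (hD1 : 0 < D1) (hD2 : 0 < D2)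
    (hQ1 : 0 < Q1) (hQ2 : 0 < Q2) (hq1 : 0 < q1) (hq : q1 < q2) (hl : 0 < l)
    (i1 : S1 ^ 2 + D1 ^ 2 = q1 * Q1) (i2 : S2 ^ 2 + D2 ^ 2 = q2 * Q2)
    (hP : S1 / D1 = S2 / D2) (hV : V2 ≤ V1)
    (hV1 : V1 = (Q1 * D1 - q1 * K1) / D1 ^ 2 * (q1 / D1))
    (hV2 : V2 = (Q2 * D2 - q2 * K2) / D2 ^ 2 * (q2 / D2)) :
    (l * √Q2 - K2 / Q2) / D2 - (l * √Q1 - K1 / Q1) / D1 ≤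
      |K1 / Q1 / D1| * (log q2 - log q1) := by
  have hq2 : 0 < q2 := hq1.trans hq
  obtain ⟨m, hm⟩ : ∃ m, m = q1 * Q1 / D1 ^ 2 := ⟨_, rfl⟩
  have hm1 : m = 1 + (S1 / D1) ^ 2 := by
    rw [hm, ← i1]; field_simp; ring
  have hm2 : m = q2 * Q2 / D2 ^ 2 := by
    rw [hm1, hP, ← i2]; field_simp; ring
  have hmpos : 0 < m := by rw [hm]; positivity
  obtain ⟨B1, hB1⟩ : ∃ B, B = K1 / Q1 / D1 := ⟨_, rfl⟩
  obtain ⟨B2, hB2⟩ : ∃ B, B = K2 / Q2 / D2 := ⟨_, rfl⟩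
  have e1 : V1 = m - q1 * m * B1 := by
    rw [hV1, hB1, hm]; field_simp
  have e2 : V2 = m - q2 * m * B2 := by
    rw [hV2, hB2, hm2]; field_simp
  have h1 : q1 * B1 ≤ q2 * B2 := by
    have : m * (q1 * B1) ≤ m * (q2 * B2) := by rw [e1, e2] at hV; nlinarith
    exact le_of_mul_le_mul_left this hmpos
  have h2 : √Q2 / D2 ≤ √Q1 / D1 := by
    refine (sq_le_sq₀ (by positivity) (by positivity)).1 ?_
    rw [div_pow, div_pow, Real.sq_sqrt hQ2.le, Real.sq_sqrt hQ1.le]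
    have a1 : Q1 / D1 ^ 2 = m / q1 := by rw [hm]; field_simp
    have a2 : Q2 / D2 ^ 2 = m / q2 := by rw [hm2]; field_simp
    rw [a1, a2]
    gcongr
  have h3 : (l * √Q2 - K2 / Q2) / D2 - (l * √Q1 - K1 / Q1) / D1 =
      l * (√Q2 / D2 - √Q1 / D1) + (B1 - B2) := by
    rw [hB1, hB2]; ring
  have h4 : B1 - B2 ≤ B1 * (1 - q1 / q2) := by
    have : B1 * (q1 / q2) ≤ B2 := by
      rw [← mul_div_assoc, div_le_iff₀ hq2]; linarith
    linarith
  have h5 : 0 ≤ 1 - q1 / q2 := by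
    rw [sub_nonneg, div_le_one hq2]; exact hq.le
  have h6 : 1 - q1 / q2 ≤ log q2 - log q1 := by
    have := Real.one_sub_inv_le_log_of_pos (div_pos hq2 hq1)
    rw [inv_div, Real.log_div hq2.ne' hq1.ne'] at this
    exact this
  have h7 : B1 * (1 - q1 / q2) ≤ |B1| * (log q2 - log q1) :=
    (mul_le_mul_of_nonneg_right (le_abs_self B1) h5).trans
      (mul_le_mul_of_nonneg_left h6 (abs_nonneg _))
  rw [h3, ← hB1]
  have h8 : l * (√Q2 / D2 - √Q1 / D1) ≤ 0 :=
    mul_nonpos_of_nonneg_of_nonpos hl.le (by linarith)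
  linarith

/-- Opposite points of the curve at time `t`. -/
def Opp (x y : ℝ × ℝ → ℝ) (t u v : ℝ) : Prop :=
  x (t, u) * y (t, v) - y (t, u) * x (t, v) = 0 ∧ x (t, u) * x (t, v) + y (t, u) * y (t, v) < 0

/-- The squared distance to the origin. -/
def qf (x y : ℝ × ℝ → ℝ) (p : ℝ × ℝ) : ℝ := x p ^ 2 + y p ^ 2

/-- Comparison principle: central symmetry is preserved while the curve is star-shaped. -/
lemma Flw.comparison {ω : ℝ} {x y : ℝ × ℝ → ℝ} {lam : ℝ → ℝ} (F : Flw ω x y lam) {t2 : ℝ}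
    (ht2 : t2 ∈ Ico 0 ω) (hD : ∀ t ∈ Icc 0 t2, ∀ s, 0 < Dt x y (t, s))
    (hinit : ∀ u v, Opp x y 0 u v → qf x y (0, u) = qf x y (0, v)) :
    ∀ t ∈ Icc 0 t2, ∀ u v, Opp x y t u v → log (qf x y (t, v)) - log (qf x y (t, u)) ≤ 0 := by
  have hIcc : ∀ t ∈ Icc 0 t2, t ∈ Ico 0 ω := fun t ht => ⟨ht.1, ht.2.trans_lt ht2.2⟩
  have hqpos : ∀ t ∈ Icc 0 t2, ∀ s, 0 < qf x y (t, s) := fun t ht s =>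
    (F.crv (hIcc t ht) (hD t ht)).q_pos s
  have hperx : ∀ t ∈ Icc 0 t2, ∀ s (k : ℤ), x (t, s - k * (2 * π)) = x (t, s) := by
    intro t ht s k
    have : Function.Periodic (fun s => x (t, s)) (2 * π) := F.px t (hIcc t ht)
    exact this.sub_int_mul_eq k
  have hpery : ∀ t ∈ Icc 0 t2, ∀ s (k : ℤ), y (t, s - k * (2 * π)) = y (t, s) := by
    intro t ht s k
    have : Function.Periodic (fun s => y (t, s)) (2 * π) := F.py t (hIcc t ht)
    exact this.sub_int_mul_eq k
  -- curvature bound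
  have hsub : Icc 0 t2 ×ˢ Icc 0 (2 * π) ⊆ Ico 0 ω ×ˢ (univ : Set ℝ) :=
    fun p hp => ⟨hIcc _ hp.1, mem_univ _⟩
  have hBc : ContinuousOn (fun p => (pd x p * pd (pd y) p - pd y p * pd (pd x) p) /
      (pd x p ^ 2 + pd y p ^ 2) / Dt x y p) (Icc 0 t2 ×ˢ Icc 0 (2 * π)) := by
    have c1 := F.hx.pd.cont.mono hsub
    have c2 := F.hy.pd.cont.mono hsub
    have c3 := F.hx.pd.pd.cont.mono hsub
    have c4 := F.hy.pd.pd.cont.mono hsub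
    have c5 := F.cD.mono hsub
    refine (ContinuousOn.div (by fun_prop) (by fun_prop) ?_).div c5 ?_
    · exact fun p hp => (F.reg p.1 (hIcc _ hp.1) p.2).ne'
    · exact fun p hp => (hD p.1 hp.1 p.2).ne'
  obtain ⟨C, hC⟩ := (isCompact_Icc.prod isCompact_Icc).exists_bound_of_continuousOn hBc
  simp only [Real.norm_eq_abs] at hC
  -- the compact set of opposite pairs
  set Z : Set (ℝ × ℝ × ℝ) := Icc 0 t2 ×ˢ Icc 0 (2 * π) ×ˢ Icc 0 (2 * π) with hZ
  have hZc : IsCompact Z := isCompact_Icc.prod (isCompact_Icc.prod isCompact_Icc)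
  have m1 : MapsTo (fun p : ℝ × ℝ × ℝ => (p.1, p.2.1)) Z (Ico 0 ω ×ˢ univ) :=
    fun p hp => ⟨hIcc _ hp.1, mem_univ _⟩
  have m2 : MapsTo (fun p : ℝ × ℝ × ℝ => (p.1, p.2.2)) Z (Ico 0 ω ×ˢ univ) :=
    fun p hp => ⟨hIcc _ hp.1, mem_univ _⟩
  have n1 : ContinuousOn (fun p : ℝ × ℝ × ℝ => (p.1, p.2.1)) Z := by fun_prop
  have n2 : ContinuousOn (fun p : ℝ × ℝ × ℝ => (p.1, p.2.2)) Z := by fun_prop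
  have cx1 : ContinuousOn (fun p : ℝ × ℝ × ℝ => x (p.1, p.2.1)) Z := F.hx.cont.comp n1 m1
  have cx2 : ContinuousOn (fun p : ℝ × ℝ × ℝ => x (p.1, p.2.2)) Z := F.hx.cont.comp n2 m2
  have cy1 : ContinuousOn (fun p : ℝ × ℝ × ℝ => y (p.1, p.2.1)) Z := F.hy.cont.comp n1 m1
  have cy2 : ContinuousOn (fun p : ℝ × ℝ × ℝ => y (p.1, p.2.2)) Z := F.hy.cont.comp n2 m2
  have cdet : ContinuousOn (fun p : ℝ × ℝ × ℝ =>
      x (p.1, p.2.1) * y (p.1, p.2.2) - y (p.1, p.2.1) * x (p.1, p.2.2)) Z :=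
    (cx1.mul cy2).sub (cy1.mul cx2)
  have cdot : ContinuousOn (fun p : ℝ × ℝ × ℝ =>
      x (p.1, p.2.1) * x (p.1, p.2.2) + y (p.1, p.2.1) * y (p.1, p.2.2)) Z :=
    (cx1.mul cx2).add (cy1.mul cy2)
  set Kp : Set (ℝ × ℝ × ℝ) := (Z ∩ (fun p : ℝ × ℝ × ℝ =>
      x (p.1, p.2.1) * y (p.1, p.2.2) - y (p.1, p.2.1) * x (p.1, p.2.2)) ⁻¹' {0}) ∩
      (Z ∩ (fun p : ℝ × ℝ × ℝ =>
      x (p.1, p.2.1) * x (p.1, p.2.2) + y (p.1, p.2.1) * y (p.1, p.2.2)) ⁻¹' (Iic 0)) with hKp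
  have hKc : IsCompact Kp := by
    refine hZc.of_isClosed_subset ?_ (fun p hp => hp.1.1)
    exact (cdet.preimage_isClosed_of_isClosed hZc.isClosed isClosed_singleton).inter
      (cdot.preimage_isClosed_of_isClosed hZc.isClosed isClosed_Iic)
  set M : ℝ := 2 * C + 1 with hM
  set G : ℝ → ℝ → ℝ → ℝ := fun t u v =>
    exp (-M * t) * (log (qf x y (t, v)) - log (qf x y (t, u))) with hG
  have hGc : ContinuousOn (fun p : ℝ × ℝ × ℝ => G p.1 p.2.1 p.2.2) Kp := by
    have hKZ : Kp ⊆ Z := fun p hp => hp.1.1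
    have q1 : ContinuousOn (fun p : ℝ × ℝ × ℝ => log (qf x y (p.1, p.2.1))) Z := by
      refine ContinuousOn.log ?_ (fun p hp => (hqpos _ hp.1 _).ne')
      exact (cx1.pow 2).add (cy1.pow 2)
    have q2 : ContinuousOn (fun p : ℝ × ℝ × ℝ => log (qf x y (p.1, p.2.2))) Z := by
      refine ContinuousOn.log ?_ (fun p hp => (hqpos _ hp.1 _).ne')
      exact (cx2.pow 2).add (cy2.pow 2)
    have q3 : ContinuousOn (fun p : ℝ × ℝ × ℝ => exp (-M * p.1)) Z := by fun_prop
    exact (q3.mul (q2.sub q1)).mono hKZ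
  intro T hT U V hUV
  by_contra hcon
  push Not at hcon
  -- reduction of arbitrary parameters to the fundamental period
  have hred : ∀ t ∈ Icc 0 t2, ∀ u v, Opp x y t u v →
      ∃ u' v', (t, u', v') ∈ Kp ∧ G t u' v' = G t u v := by
    intro t ht u v huv
    obtain ⟨k, hk⟩ := exists_shift u
    obtain ⟨l, hl⟩ := exists_shift v
    refine ⟨_, _, ⟨⟨⟨ht, hk, hl⟩, ?_⟩, ⟨⟨ht, hk, hl⟩, ?_⟩⟩, ?_⟩
    · simp only [mem_preimage, hperx t ht, hpery t ht, mem_singleton_iff]; exact huv.1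
    · simp only [mem_preimage, hperx t ht, hpery t ht, mem_Iic]; exact huv.2.le
    · simp only [hG, qf, hperx t ht, hpery t ht]
  obtain ⟨U', V', hUV', hGU⟩ := hred T hT U V hUV
  obtain ⟨⟨t0, s1, s2⟩, hp0, hmax⟩ := hKc.exists_isMaxOn ⟨_, hUV'⟩ hGc
  have hmax' : ∀ t ∈ Icc 0 t2, ∀ u v, Opp x y t u v → G t u v ≤ G t0 s1 s2 := by
    intro t ht u v huv
    obtain ⟨u', v', h1, h2⟩ := hred t ht u v huv
    rw [← h2]; exact hmax h1
  have ht0 : t0 ∈ Icc 0 t2 := hp0.1.1.1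
  have hs1 : s1 ∈ Icc 0 (2 * π) := hp0.1.1.2.1
  have hGpos : 0 < G t0 s1 s2 := lt_of_lt_of_le
    (show 0 < G T U V from mul_pos (exp_pos _) hcon) (hmax' T hT U V hUV)
  have hell : 0 < log (qf x y (t0, s2)) - log (qf x y (t0, s1)) := by
    by_contra hc
    push Not at hc
    have := mul_nonpos_of_nonneg_of_nonpos (exp_pos (-M * t0)).le hc
    simp only [hG] at hGpos
    linarith
  have hq1 := hqpos t0 ht0 s1
  have hq2 := hqpos t0 ht0 s2
  have hopp : Opp x y t0 s1 s2 := by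
    have h1 : x (t0, s1) * y (t0, s2) - y (t0, s1) * x (t0, s2) = 0 := hp0.1.2
    have h2 : x (t0, s1) * x (t0, s2) + y (t0, s1) * y (t0, s2) ≤ 0 := hp0.2.2
    refine ⟨h1, lt_of_le_of_ne h2 fun h3 => ?_⟩
    have : qf x y (t0, s1) * qf x y (t0, s2) = 0 := by
      simp only [qf]
      linear_combination (x (t0, s1) * y (t0, s2) - y (t0, s1) * x (t0, s2)) * h1 +
        (x (t0, s1) * x (t0, s2) + y (t0, s1) * y (t0, s2)) * h3
    exact (mul_pos hq1 hq2).ne' this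
  have ht0pos : 0 < t0 := by
    rcases ht0.1.eq_or_lt with h | h
    · subst h
      rw [hinit s1 s2 hopp] at hell; simp at hell
    · exact h
  have ht0I : t0 ∈ Ioo 0 ω := ⟨ht0pos, (hIcc t0 ht0).2⟩
  -- spatial conditions
  have hcrv := F.crv (hIcc t0 ht0) (hD t0 ht0)
  have hspat := hcrv.spatial s1 s2 hopp.1 hopp.2 (by
    intro u v h1 h2
    have := hmax' t0 ht0 u v ⟨h1, h2⟩
    exact le_of_mul_le_mul_left this (exp_pos _))
  -- temporal conditions
  obtain ⟨g1, hg1, hg1c, hg1e, hg1d⟩ := F.temporal ht0I s1 (hD t0 ht0 s1)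
  obtain ⟨g2, hg2, hg2c, hg2e, hg2d⟩ := F.temporal ht0I s2 (hD t0 ht0 s2)
  have hcont : ∀ (f : ℝ × ℝ → ℝ), Sm ω f → ∀ g : ℝ → ℝ, ContinuousAt g t0 →
      ContinuousAt (fun t => f (t, g t)) t0 := by
    intro f hf g hg
    have h1 : ContinuousAt f (t0, g t0) := (hf.cda ht0I (g t0)).continuousAt
    exact ContinuousAt.comp (g := f) (f := fun t => (t, g t)) h1 (continuousAt_id.prodMk hg)
  have hdotev : ∀ᶠ t in nhds t0,
      x (t, g1 t) * x (t, g2 t) + y (t, g1 t) * y (t, g2 t) < 0 := by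
    have h1 : ContinuousAt (fun t => x (t, g1 t) * x (t, g2 t) + y (t, g1 t) * y (t, g2 t)) t0 :=
      ((hcont x F.hx g1 hg1c).mul (hcont x F.hx g2 hg2c)).add
        ((hcont y F.hy g1 hg1c).mul (hcont y F.hy g2 hg2c))
    refine h1.eventually_lt continuousAt_const ?_
    rw [hg1, hg2]; exact hopp.2
  have hoppev : ∀ᶠ t in nhds t0, Opp x y t (g1 t) (g2 t) := by
    filter_upwards [hg1e, hg2e, hdotev] with t h1 h2 h3
    refine ⟨?_, h3⟩
    obtain ⟨k1, e1, e2⟩ := par hq1 h1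
    obtain ⟨k2, e3, e4⟩ := par hq2 h2
    rw [e1, e2, e3, e4]
    linear_combination k1 * k2 * hopp.1
  have hGd := ((((hasDerivAt_id t0).const_mul (-M)).exp).mul (hg2d.sub hg1d)).neg
  have htemp := deriv_nonpos_left hGd (by
    filter_upwards [nhdsWithin_le_nhds hoppev, Ioo_mem_nhdsLT ht0pos] with t h1 h2
    have := hmax' t ⟨h2.1.le, h2.2.le.trans ht0.2⟩ _ _ h1
    simp only [hG, qf] at this
    simpa [hg1, hg2] using this)
  have hflow1 := F.flow t0 ht0I s1
  have hflow2 := F.flow t0 ht0I s2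
  rw [hflow1, hflow2] at htemp
  have hqlt : qf x y (t0, s1) < qf x y (t0, s2) := by
    rw [← Real.log_lt_log_iff hq1 hq2]; linarith
  have hfin := alg_ineq (hD t0 ht0 s1) (hD t0 ht0 s2) (F.reg t0 (hIcc t0 ht0) s1)
    (F.reg t0 (hIcc t0 ht0) s2) hq1 hqlt (F.lam_pos t0 (hIcc t0 ht0))
    (S1 := x (t0, s1) * pd x (t0, s1) + y (t0, s1) * pd y (t0, s1))
    (S2 := x (t0, s2) * pd x (t0, s2) + y (t0, s2) * pd y (t0, s2))
    (K1 := pd x (t0, s1) * pd (pd y) (t0, s1) - pd y (t0, s1) * pd (pd x) (t0, s1))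
    (K2 := pd x (t0, s2) * pd (pd y) (t0, s2) - pd y (t0, s2) * pd (pd x) (t0, s2))
    (by simp only [Dt, qf]; ring) (by simp only [Dt, qf]; ring) hspat.1 hspat.2
    (by simp only [Dt, qf]; congr 2; ring) (by simp only [Dt, qf]; congr 2; ring)
  have hCb := hC (t0, s1) ⟨ht0, hs1⟩
  have hexp := exp_pos (-M * t0)
  simp only [id, Pi.sub_apply, hg1, hg2, mul_one] at htemp
  have hell' : 0 < log (x (t0, s2) ^ 2 + y (t0, s2) ^ 2) - log (x (t0, s1) ^ 2 + y (t0, s1) ^ 2) :=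
    hell
  simp only [qf] at hfin
  set ell := log (x (t0, s2) ^ 2 + y (t0, s2) ^ 2) - log (x (t0, s1) ^ 2 + y (t0, s1) ^ 2)
  have hfin2 := hfin.trans (mul_le_mul_of_nonneg_right hCb hell'.le)
  generalize ((lam t0 * √(pd x (t0, s2) ^ 2 + pd y (t0, s2) ^ 2) -
    (pd x (t0, s2) * pd (pd y) (t0, s2) - pd y (t0, s2) * pd (pd x) (t0, s2)) /
      (pd x (t0, s2) ^ 2 + pd y (t0, s2) ^ 2)) / Dt x y (t0, s2)) = R2 at *
  generalize ((lam t0 * √(pd x (t0, s1) ^ 2 + pd y (t0, s1) ^ 2) -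
    (pd x (t0, s1) * pd (pd y) (t0, s1) - pd y (t0, s1) * pd (pd x) (t0, s1)) /
      (pd x (t0, s1) ^ 2 + pd y (t0, s1) ^ 2)) / Dt x y (t0, s1)) = R1 at *
  have h9 : 0 ≤ exp (-M * t0) * (2 * R2 - 2 * R1 - M * ell) := by linarith
  have h10 : 0 ≤ 2 * R2 - 2 * R1 - M * ell := nonneg_of_mul_nonneg_right h9 hexp
  rw [hM] at h10
  nlinarith

/-- The curve cannot reach the origin. -/
lemma Flw.nozero {ω : ℝ} {x y : ℝ × ℝ → ℝ} {lam : ℝ → ℝ} (F : Flw ω x y lam) {t1 : ℝ}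
    (ht1 : t1 ∈ Ioo 0 ω) (hD : ∀ t ∈ Ico 0 t1, ∀ s, 0 < Dt x y (t, s))
    (hsym : ∀ t ∈ Ico 0 t1, ∀ u v, Opp x y t u v →
      log (qf x y (t, v)) - log (qf x y (t, u)) ≤ 0) (s0 : ℝ)
    (hx0 : x (t1, s0) = 0) (hy0 : y (t1, s0) = 0) : False := by
  have ht1' : t1 ∈ Ico 0 ω := ⟨ht1.1.le, ht1.2⟩
  have hIco : ∀ t ∈ Ico 0 t1, t ∈ Ico 0 ω := fun t ht => ⟨ht.1, ht.2.trans ht1.2⟩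
  have hpart : ∀ t ∈ Ico 0 t1, ∃ s' ∈ Icc s0 (s0 + 2 * π),
      x (t, s') = - x (t, s0) ∧ y (t, s') = - y (t, s0) ∧
      pd x (t, s0) * pd y (t, s') - pd y (t, s0) * pd x (t, s') = 0 ∧
      pd x (t, s0) * pd x (t, s') + pd y (t, s0) * pd y (t, s') ≤ 0 ∧
      ∀ u u', s0 ≤ u → u ≤ u' → u' ≤ s' → 0 ≤ x (t, u) * y (t, u') - y (t, u) * x (t, u') := by
    intro t ht
    have hcrv := F.crv (hIco t ht) (hD t ht)
    obtain ⟨s', hs', h1, h2, h3⟩ := hcrv.partner s0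
    have hswap : ∀ u v, Opp x y t u v → Opp x y t v u := fun u v h =>
      ⟨by linear_combination -h.1, by have := h.2; nlinarith⟩
    have heq : ∀ u v, Opp x y t u v → log (qf x y (t, v)) - log (qf x y (t, u)) = 0 := by
      intro u v h
      have := hsym t ht u v h
      have := hsym t ht v u (hswap u v h)
      linarith
    have hsp := (hcrv.spatial s0 s' h1 h2 (fun u v a b => by
      have e1 := heq u v ⟨a, b⟩
      have e2 := heq s0 s' ⟨h1, h2⟩
      simp only [qf] at e1 e2
      linarith)).1
    have hq1 := hcrv.q_pos s0
    have hq2 := hcrv.q_pos s'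
    have hqe : x (t, s') ^ 2 + y (t, s') ^ 2 = x (t, s0) ^ 2 + y (t, s0) ^ 2 := by
      have e2 := heq s0 s' ⟨h1, h2⟩
      simp only [qf] at e2
      exact Real.log_injOn_pos hq2 hq1 (by linarith)
    have hD1 := hcrv.D s0
    have hD2 := hcrv.D s'
    refine ⟨s', hs', ?_⟩
    suffices h : x (t, s') = - x (t, s0) ∧ y (t, s') = - y (t, s0) ∧
      pd x (t, s0) * pd y (t, s') - pd y (t, s0) * pd x (t, s') = 0 ∧
      pd x (t, s0) * pd x (t, s') + pd y (t, s0) * pd y (t, s') ≤ 0 from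
      ⟨h.1, h.2.1, h.2.2.1, h.2.2.2, h3⟩
    clear h3 hcrv heq
    generalize x (t, s0) = a at *
    generalize y (t, s0) = b at *
    generalize x (t, s') = c at *
    generalize y (t, s') = d at *
    generalize pd x (t, s0) = a1 at *
    generalize pd y (t, s0) = b1 at *
    generalize pd x (t, s') = c1 at *
    generalize pd y (t, s') = d1 at *
    obtain ⟨k, rfl, rfl⟩ := par hq1 h1
    have hk2 : k ^ 2 = 1 := by
      have : (k ^ 2 - 1) * (a ^ 2 + b ^ 2) = 0 := by linear_combination hqe
      rcases mul_eq_zero.1 this with h | h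
      · linarith
      · exact absurd h hq1.ne'
    have hk : k = -1 := by
      have hkn : k < 0 := by
        by_contra hc; push Not at hc; nlinarith [mul_nonneg hc hq1.le]
      nlinarith
    subst hk
    rw [div_eq_div_iff hD1.ne' hD2.ne'] at hsp
    -- the tangents are antiparallel
    have e1 : (a * b1 - b * a1) * c1 = -(-1 * a * d1 - -1 * b * c1) * a1 := by
      have : (a ^ 2 + b ^ 2) * ((a * b1 - b * a1) * c1 +
        (-1 * a * d1 - -1 * b * c1) * a1) = 0 := by linear_combination a * hsp
      have := (mul_eq_zero.1 this).resolve_left hq1.ne'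
      linarith
    have e2 : (a * b1 - b * a1) * d1 = -(-1 * a * d1 - -1 * b * c1) * b1 := by
      have : (a ^ 2 + b ^ 2) * ((a * b1 - b * a1) * d1 +
        (-1 * a * d1 - -1 * b * c1) * b1) = 0 := by linear_combination b * hsp
      have := (mul_eq_zero.1 this).resolve_left hq1.ne'
      linarith
    refine ⟨by ring, by ring, ?_, ?_⟩
    · have : (a * b1 - b * a1) * (a1 * d1 - b1 * c1) = 0 := by
        linear_combination a1 * e2 - b1 * e1
      exact (mul_eq_zero.1 this).resolve_left hD1.ne'
    · have : (a * b1 - b * a1) * (a1 * c1 + b1 * d1) =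
          -((-1 * a * d1 - -1 * b * c1) * (a1 ^ 2 + b1 ^ 2)) := by
        linear_combination a1 * e1 + b1 * e2
      by_contra hc
      push Not at hc
      have h5 := mul_pos hD1 hc
      have h6 : 0 ≤ (-1 * a * d1 - -1 * b * c1) * (a1 ^ 2 + b1 ^ 2) := by positivity
      linarith
  -- pass to the limit
  choose! σ hσ using hpart
  obtain ⟨w, -, hwlt, hwlim⟩ := exists_seq_strictMono_tendsto' (x := t1) (y := (0:ℝ)) ht1.1
  have hw : ∀ n, w n ∈ Ico 0 t1 := fun n => ⟨(hwlt n).1.le, (hwlt n).2⟩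
  obtain ⟨p, hp, ρ, hρ, hlim⟩ := isCompact_Icc.tendsto_subseq
    (fun n => (hσ (w n) (hw n)).1)
  set τ : ℕ → ℝ := w ∘ ρ with hτ
  have hτlim : Tendsto τ atTop (nhds t1) := hwlim.comp hρ.tendsto_atTop
  have hτm : ∀ n, τ n ∈ Ico 0 t1 := fun n => hw _
  have hslim : Tendsto (fun n => σ (τ n)) atTop (nhds p) := hlim
  have lim0 : ∀ f : ℝ × ℝ → ℝ, Sm ω f → ∀ s,
      Tendsto (fun n => f (τ n, s)) atTop (nhds (f (t1, s))) := fun f hf s =>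
    ((hf.cda ht1 s).continuousAt.tendsto).comp (hτlim.prodMk_nhds tendsto_const_nhds)
  have lim1 : ∀ f : ℝ × ℝ → ℝ, Sm ω f →
      Tendsto (fun n => f (τ n, σ (τ n))) atTop (nhds (f (t1, p))) := fun f hf =>
    ((hf.cda ht1 p).continuousAt.tendsto).comp (hτlim.prodMk_nhds hslim)
  have hxp : x (t1, p) = 0 := by
    have h1 := lim1 x F.hx
    have h2 := (lim0 x F.hx s0).neg
    rw [hx0, neg_zero] at h2
    refine tendsto_nhds_unique h1 (h2.congr fun n => ?_)
    exact (hσ (τ n) (hτm n)).2.1.symm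
  have hyp : y (t1, p) = 0 := by
    have h1 := lim1 y F.hy
    have h2 := (lim0 y F.hy s0).neg
    rw [hy0, neg_zero] at h2
    refine tendsto_nhds_unique h1 (h2.congr fun n => ?_)
    exact (hσ (τ n) (hτm n)).2.2.1.symm
  have hdet : pd x (t1, s0) * pd y (t1, p) - pd y (t1, s0) * pd x (t1, p) = 0 := by
    have h1 := ((lim0 _ F.hx.pd s0).mul (lim1 _ F.hy.pd)).sub
      ((lim0 _ F.hy.pd s0).mul (lim1 _ F.hx.pd))
    refine tendsto_nhds_unique h1 (tendsto_const_nhds.congr fun n => ?_)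
    exact (hσ (τ n) (hτm n)).2.2.2.1.symm
  have hdot : pd x (t1, s0) * pd x (t1, p) + pd y (t1, s0) * pd y (t1, p) ≤ 0 := by
    have h1 := ((lim0 _ F.hx.pd s0).mul (lim1 _ F.hx.pd)).add
      ((lim0 _ F.hy.pd s0).mul (lim1 _ F.hy.pd))
    exact le_of_tendsto h1 (Eventually.of_forall fun n => (hσ (τ n) (hτm n)).2.2.2.2.1)
  have hQ0 := F.reg t1 ht1' s0
  have hQp := F.reg t1 ht1' p
  obtain ⟨k, hk1, hk2⟩ := par hQ0 hdet
  have hk : k < 0 := by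
    rw [hk1, hk2] at hdot hQp
    have h1 : k ≤ 0 := by
      by_contra hc; push Not at hc
      nlinarith [mul_pos hc hQ0]
    refine lt_of_le_of_ne h1 fun h2 => ?_
    rw [h2] at hQp; simp at hQp
  have hps0 : s0 < p := by
    refine lt_of_le_of_ne hp.1 fun h => ?_
    rw [← h] at hk1 hk2
    have h1 : (1 - k) * (pd x (t1, s0) ^ 2 + pd y (t1, s0) ^ 2) = 0 := by
      linear_combination pd x (t1, s0) * hk1 + pd y (t1, s0) * hk2
    rcases mul_eq_zero.1 h1 with h2 | h2
    · linarith
    · exact hQ0.ne' h2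
  have hlimdet : ∀ u u', s0 ≤ u → u ≤ u' → u' < p →
      0 ≤ x (t1, u) * y (t1, u') - y (t1, u) * x (t1, u') := by
    intro u u' h1 h2 h3
    have h4 := ((lim0 _ F.hx u).mul (lim0 _ F.hy u')).sub ((lim0 _ F.hy u).mul (lim0 _ F.hx u'))
    refine ge_of_tendsto h4 ?_
    filter_upwards [hslim.eventually (lt_mem_nhds h3)] with n hn
    exact (hσ (τ n) (hτm n)).2.2.2.2.2 u u' h1 h2 hn.le
  -- the arc lies on a line through the origin
  have hline : ∀ u ∈ Ioo s0 p,
      pd x (t1, s0) * y (t1, u) - pd y (t1, s0) * x (t1, u) = 0 := by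
    intro u hu
    apply le_antisymm
    · have h1 := ((F.hy.hpd ht1' p).const_mul (x (t1, u))).sub
        ((F.hx.hpd ht1' p).const_mul (y (t1, u)))
      have h2 := deriv_nonpos_left h1 (by
        filter_upwards [Ioo_mem_nhdsLT hu.2] with v hv
        simpa [hxp, hyp] using hlimdet u v hu.1.le hv.1.le hv.2)
      rw [hk1, hk2] at h2
      by_contra hc
      push Not at hc
      nlinarith [mul_pos_of_neg_of_neg hk (neg_neg_of_pos hc)]
    · have h1 := ((F.hx.hpd ht1' s0).mul_const (y (t1, u))).sub
        ((F.hy.hpd ht1' s0).mul_const (x (t1, u)))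
      refine deriv_nonneg_right h1 ?_
      filter_upwards [Ioo_mem_nhdsGT hu.1] with v hv
      simpa [hx0, hy0] using hlimdet v u hv.1.le hv.2.le hu.2
  have hg : ∀ s, HasDerivAt (fun s => pd x (t1, s0) * x (t1, s) + pd y (t1, s0) * y (t1, s))
      (pd x (t1, s0) * pd x (t1, s) + pd y (t1, s0) * pd y (t1, s)) s := fun s =>
    ((F.hx.hpd ht1' s).const_mul _).add ((F.hy.hpd ht1' s).const_mul _)
  obtain ⟨ξ, hξ, hξ0⟩ := exists_hasDerivAt_eq_zero hps0
    (fun s _ => (hg s).continuousAt.continuousWithinAt) (by simp [hx0, hy0, hxp, hyp])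
    (fun s _ => hg s)
  have hl : HasDerivAt (fun s => pd x (t1, s0) * y (t1, s) - pd y (t1, s0) * x (t1, s))
      (pd x (t1, s0) * pd y (t1, ξ) - pd y (t1, s0) * pd x (t1, ξ)) ξ :=
    ((F.hy.hpd ht1' ξ).const_mul _).sub ((F.hx.hpd ht1' ξ).const_mul _)
  have hl0 : HasDerivAt (fun s => pd x (t1, s0) * y (t1, s) - pd y (t1, s0) * x (t1, s)) 0 ξ := by
    refine (hasDerivAt_const ξ (0:ℝ)).congr_of_eventuallyEq ?_
    filter_upwards [Ioo_mem_nhds hξ.1 hξ.2] with u hu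
    exact hline u hu
  have e1 := hl.unique hl0
  have hQξ := F.reg t1 ht1' ξ
  have : (pd x (t1, s0) ^ 2 + pd y (t1, s0) ^ 2) * (pd x (t1, ξ) ^ 2 + pd y (t1, ξ) ^ 2) = 0 := by
    linear_combination (pd x (t1, s0) * pd y (t1, ξ) - pd y (t1, s0) * pd x (t1, ξ)) * e1 +
      (pd x (t1, s0) * pd x (t1, ξ) + pd y (t1, s0) * pd y (t1, ξ)) * hξ0
  exact (mul_pos hQ0 hQξ).ne' this

/-- Star-shapedness is preserved. -/
lemma Flw.main {ω : ℝ} {x y : ℝ × ℝ → ℝ} {lam : ℝ → ℝ} (F : Flw ω x y lam)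
    (hD0 : ∀ s, 0 < Dt x y (0, s))
    (hinit : ∀ u v, Opp x y 0 u v → qf x y (0, u) = qf x y (0, v)) :
    ∀ t ∈ Ico 0 ω, ∀ s, 0 < Dt x y (t, s) := by
  intro T hT s
  by_contra hcon
  push Not at hcon
  have hsub : Icc 0 T ×ˢ Icc 0 (2 * π) ⊆ Ico 0 ω ×ˢ (univ : Set ℝ) :=
    fun p hp => ⟨⟨hp.1.1, hp.1.2.trans_lt hT.2⟩, mem_univ _⟩
  set A : Set (ℝ × ℝ) := (Icc 0 T ×ˢ Icc 0 (2 * π)) ∩ Dt x y ⁻¹' (Iic 0) with hA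
  have hper : ∀ t ∈ Icc 0 T, ∀ s (k : ℤ), Dt x y (t, s - k * (2 * π)) = Dt x y (t, s) := by
    intro t ht s k
    have ht' : t ∈ Ico 0 ω := ⟨ht.1, ht.2.trans_lt hT.2⟩
    have hx : Function.Periodic (fun s => x (t, s)) (2 * π) := F.px t ht'
    have hy : Function.Periodic (fun s => y (t, s)) (2 * π) := F.py t ht'
    have hx1 : ∀ s, pd x (t, s + 2 * π) = pd x (t, s) := by
      intro s
      have h1 := (F.hx.hpd ht' (s + 2 * π)).comp_add_const s (2 * π)
      rw [show (fun s => x (t, s + 2 * π)) = fun s => x (t, s) from funext hx] at h1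
      exact h1.unique (F.hx.hpd ht' s)
    have hy1 : ∀ s, pd y (t, s + 2 * π) = pd y (t, s) := by
      intro s
      have h1 := (F.hy.hpd ht' (s + 2 * π)).comp_add_const s (2 * π)
      rw [show (fun s => y (t, s + 2 * π)) = fun s => y (t, s) from funext hy] at h1
      exact h1.unique (F.hy.hpd ht' s)
    have : Function.Periodic (fun s => Dt x y (t, s)) (2 * π) := by
      intro s
      simp only [Dt, hx1, hy1, F.px t ht', F.py t ht']
    exact this.sub_int_mul_eq k
  have hAc : IsCompact A := by
    refine (isCompact_Icc.prod isCompact_Icc).of_isClosed_subset ?_ inter_subset_left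
    exact (F.cD.mono hsub).preimage_isClosed_of_isClosed
      (isCompact_Icc.prod isCompact_Icc).isClosed isClosed_Iic
  have hAin : ∀ t ∈ Icc 0 T, ∀ s, Dt x y (t, s) ≤ 0 → ∃ s', (t, s') ∈ A := by
    intro t ht s hs
    obtain ⟨k, hk⟩ := exists_shift s
    exact ⟨_, ⟨ht, hk⟩, by simp only [mem_preimage, hper t ht, mem_Iic]; exact hs⟩
  obtain ⟨s', hs'⟩ := hAin T ⟨hT.1, le_rfl⟩ s hcon
  obtain ⟨⟨t1, s0⟩, hp, hmin⟩ := hAc.exists_isMinOn ⟨_, hs'⟩ continuous_fst.continuousOn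
  have ht1 : t1 ∈ Icc 0 T := hp.1.1
  have hle : Dt x y (t1, s0) ≤ 0 := hp.2
  have hpos : 0 < t1 := by
    rcases ht1.1.eq_or_lt with h | h
    · rw [← h] at hle; exact absurd (hD0 s0) (not_lt.2 hle)
    · exact h
  have ht1I : t1 ∈ Ioo 0 ω := ⟨hpos, ht1.2.trans_lt hT.2⟩
  have hDlt : ∀ t ∈ Ico 0 t1, ∀ s, 0 < Dt x y (t, s) := by
    intro t ht s
    by_contra hc
    push Not at hc
    obtain ⟨u, hu⟩ := hAin t ⟨ht.1, ht.2.le.trans ht1.2⟩ s hc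
    have : t1 ≤ t := hmin hu
    exact absurd ht.2 (not_lt.2 this)
  have hge : 0 ≤ Dt x y (t1, s0) := by
    have h1 : ContinuousAt (fun t => Dt x y (t, s0)) t1 :=
      ((F.hx.hpt ht1I s0).continuousAt.mul (F.hy.pd.hpt ht1I s0).continuousAt).sub
        ((F.hy.hpt ht1I s0).continuousAt.mul (F.hx.pd.hpt ht1I s0).continuousAt)
    refine ge_of_tendsto (h1.tendsto.mono_left (nhdsWithin_le_nhds (s := Iio t1))) ?_
    filter_upwards [Ioo_mem_nhdsLT hpos] with t ht
    exact (hDlt t ⟨ht.1.le, ht.2⟩ s0).le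
  obtain ⟨hx0, hy0⟩ := F.noncross ht1I hDlt s0 (le_antisymm hle hge)
  refine F.nozero ht1I hDlt ?_ s0 hx0 hy0
  intro t ht
  exact F.comparison ⟨ht.1, ht.2.trans ht1I.2⟩
    (fun τ hτ => hDlt τ ⟨hτ.1, hτ.2.trans_lt ht.2⟩) hinit t ⟨ht.1, le_rfl⟩

/-- The derivative of a curve in coordinates. -/
lemma deriv_coord {X : ℝ → ℝ → ℝ × ℝ} {ω : ℝ}
    (hx : Sm ω (fun p => (X p.1 p.2).1)) (hy : Sm ω (fun p => (X p.1 p.2).2)) {t : ℝ}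
    (ht : t ∈ Ico 0 ω) :
    deriv (X t) = fun s => (pd (fun p => (X p.1 p.2).1) (t, s),
      pd (fun p => (X p.1 p.2).2) (t, s)) :=
  funext fun s => ((hx.hpd ht s).prodMk (hy.hpd ht s)).deriv

lemma deriv2_coord {X : ℝ → ℝ → ℝ × ℝ} {ω : ℝ}
    (hx : Sm ω (fun p => (X p.1 p.2).1)) (hy : Sm ω (fun p => (X p.1 p.2).2)) {t : ℝ}
    (ht : t ∈ Ico 0 ω) :
    deriv (deriv (X t)) = fun s => (pd (pd (fun p => (X p.1 p.2).1)) (t, s),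
      pd (pd (fun p => (X p.1 p.2).2)) (t, s)) := by
  rw [deriv_coord hx hy ht]
  exact funext fun s => ((hx.pd.hpd ht s).prodMk (hy.pd.hpd ht s)).deriv

lemma flow_alg {a1 b1 a2 b2 al l r u v : ℝ} (hQ : 0 < a1 ^ 2 + b1 ^ 2)
    (hr : r = √(a1 ^ 2 + b1 ^ 2))
    (hu : u = al * (r⁻¹ * a1) + ((a1 * b2 - b1 * a2) / r ^ 3 - l) * (-(r⁻¹ * b1)))
    (hv : v = al * (r⁻¹ * b1) + ((a1 * b2 - b1 * a2) / r ^ 3 - l) * (r⁻¹ * a1)) :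
    u * b1 - v * a1 = l * √(a1 ^ 2 + b1 ^ 2) - (a1 * b2 - b1 * a2) / (a1 ^ 2 + b1 ^ 2) := by
  have hrp : 0 < r := by rw [hr]; exact Real.sqrt_pos.2 hQ
  have hr2 : a1 ^ 2 + b1 ^ 2 = r ^ 2 := by rw [hr, Real.sq_sqrt hQ.le]
  rw [← hr, hr2]
  have h1 : u * b1 - v * a1 =
      -(((a1 * b2 - b1 * a2) / r ^ 3 - l) * r⁻¹ * (a1 ^ 2 + b1 ^ 2)) := by
    rw [hu, hv]; ring
  rw [h1, hr2]
  generalize a1 * b2 - b1 * a2 = K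
  field_simp
  ring

lemma star_iff_s10 {X : ℝ → ℝ → ℝ × ℝ} {ω : ℝ}
    (hx : Sm ω (fun p => (X p.1 p.2).1)) (hy : Sm ω (fun p => (X p.1 p.2).2)) {t : ℝ}
    (ht : t ∈ Ico 0 ω)
    (hreg : ∀ s, 0 < pd (fun p => (X p.1 p.2).1) (t, s) ^ 2 +
      pd (fun p => (X p.1 p.2).2) (t, s) ^ 2) (s : ℝ) :
    0 < vdet (X t s - 0) (unitTangent (X t) s) ↔
      0 < Dt (fun p => (X p.1 p.2).1) (fun p => (X p.1 p.2).2) (t, s) := by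
  have hr : 0 < vnorm (deriv (X t) s) := by
    rw [deriv_coord hx hy ht]; exact Real.sqrt_pos.2 (hreg s)
  have : vdet (X t s - 0) (unitTangent (X t) s) = (vnorm (deriv (X t) s))⁻¹ *
      Dt (fun p => (X p.1 p.2).1) (fun p => (X p.1 p.2).2) (t, s) := by
    generalize hc : vnorm (deriv (X t) s) = c
    simp only [vdet, unitTangent, hc, Dt, sub_zero, Prod.smul_fst, Prod.smul_snd, smul_eq_mul]
    rw [deriv_coord hx hy ht]
    ring
  rw [this]
  exact mul_pos_iff_of_pos_left (inv_pos.2 hr)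

lemma flw_of_sol {X : ℝ → ℝ → ℝ × ℝ} {X₀ : ℝ → ℝ × ℝ} {ω : ℝ}
    (hsol : IsGAPFSolutionOn X X₀ (Set.Ico 0 ω)) :
    Flw ω (fun p => (X p.1 p.2).1) (fun p => (X p.1 p.2).2) (fun t => 2 * π / clen (X t)) := by
  have hx : Sm ω (fun p => (X p.1 p.2).1) := hsol.smooth.fst
  have hy : Sm ω (fun p => (X p.1 p.2).2) := hsol.smooth.snd
  have hreg : ∀ t ∈ Ico 0 ω, ∀ s, 0 < pd (fun p => (X p.1 p.2).1) (t, s) ^ 2 +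
      pd (fun p => (X p.1 p.2).2) (t, s) ^ 2 := by
    intro t ht s
    have h1 := (hsol.curve t ht).regular s
    rw [deriv_coord hx hy ht] at h1
    by_contra hc
    apply h1
    have e1 : pd (fun p => (X p.1 p.2).1) (t, s) = 0 := by
      nlinarith [sq_nonneg (pd (fun p => (X p.1 p.2).1) (t, s)),
        sq_nonneg (pd (fun p => (X p.1 p.2).2) (t, s))]
    have e2 : pd (fun p => (X p.1 p.2).2) (t, s) = 0 := by
      nlinarith [sq_nonneg (pd (fun p => (X p.1 p.2).1) (t, s)),
        sq_nonneg (pd (fun p => (X p.1 p.2).2) (t, s))]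
    simp only [e1, e2]; rfl
  refine ⟨hx, hy, ?_, ?_, hreg, ?_, ?_⟩
  · intro t ht s
    exact congrArg Prod.fst ((hsol.curve t ht).periodic s)
  · intro t ht s
    exact congrArg Prod.snd ((hsol.curve t ht).periodic s)
  · intro t ht
    refine div_pos (by positivity) ?_
    have hc : Continuous fun s => vnorm (deriv (X t) s) := by
      rw [deriv_coord hx hy ht]
      have c1 : Continuous fun s => pd (fun p => (X p.1 p.2).1) (t, s) :=
        continuous_iff_continuousAt.2 fun s => (hx.pd.hpd ht s).continuousAt
      have c2 : Continuous fun s => pd (fun p => (X p.1 p.2).2) (t, s) :=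
        continuous_iff_continuousAt.2 fun s => (hy.pd.hpd ht s).continuousAt
      exact ((c1.pow 2).add (c2.pow 2)).sqrt
    refine intervalIntegral.intervalIntegral_pos_of_pos (hc.intervalIntegrable _ _) ?_
      (by positivity)
    intro s
    rw [deriv_coord hx hy ht]; exact Real.sqrt_pos.2 (hreg t ht s)
  · intro t ht s
    have ht' : t ∈ Ico 0 ω := ⟨ht.1.le, ht.2⟩
    obtain ⟨α, hα⟩ := hsol.flow
    have h1 := (hα t ht' s).hasDerivAt (Ico_mem_nhds ht.1 ht.2)
    have hu := (hasFDerivAt_fst.comp_hasDerivAt t h1).deriv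
    have hv := (hasFDerivAt_snd.comp_hasDerivAt t h1).deriv
    refine flow_alg (al := α t s) (hreg t ht' s) rfl ?_ ?_
    · refine Eq.trans hu ?_
      simp only [unitTangent, innerNormal, curv, vdet, vnorm]
      rw [deriv2_coord hx hy ht', deriv_coord hx hy ht']
      rfl
    · refine Eq.trans hv ?_
      simp only [unitTangent, innerNormal, curv, vdet, vnorm]
      rw [deriv2_coord hx hy ht', deriv_coord hx hy ht']
      rfl

/-- Gage's area-preserving flow preserves star-shapedness with respect to `O` for a
star-shaped centrosymmetric initial curve. -/
theorem gapf_preserves_starshapedness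
    (X : ℝ → ℝ → ℝ × ℝ) (X₀ : ℝ → ℝ × ℝ) (ω : ℝ)
    (hX₀ : IsSmoothClosedCurve X₀) (hemb : IsEmbeddedCurve X₀)
    (hstar₀ : StarShapedWrt X₀ 0) (hsym₀ : CentroSymmetricWrt X₀ 0)
    (hsol : IsGAPFSolutionOn X X₀ (Set.Ico 0 ω)) :
    ∀ t ∈ Set.Ico (0:ℝ) ω, StarShapedWrt (X t) 0 := by
  intro T hT
  have h0 : (0:ℝ) ∈ Ico 0 ω := ⟨le_rfl, hT.1.trans_lt hT.2⟩
  have hX0 : X 0 = X₀ := funext hsol.init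
  subst hX0
  have F := flw_of_sol hsol
  have hD0 : ∀ s, 0 < Dt (fun p => (X p.1 p.2).1) (fun p => (X p.1 p.2).2) (0, s) := fun s =>
    (star_iff_s10 F.hx F.hy h0 (F.reg 0 h0) s).1 (hstar₀ s)
  have hmain := F.main hD0 ?_
  · intro s
    exact (star_iff_s10 F.hx F.hy hT (F.reg T hT) s).2 (hmain T hT s)
  intro u v huv
  have hmem : -(X 0 u) ∈ Set.range (X 0) := by
    have h1 : (fun Z => (2 : ℝ) • (0 : ℝ × ℝ) - Z) (X 0 u) ∈
        (fun Z => (2 : ℝ) • (0 : ℝ × ℝ) - Z) '' Set.range (X 0) :=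
      ⟨X 0 u, ⟨u, rfl⟩, rfl⟩
    rw [hsym₀] at h1
    simpa using h1
  obtain ⟨w, hw⟩ := hmem
  have hw1 : (X 0 w).1 = -(X 0 u).1 := congrArg Prod.fst hw
  have hw2 : (X 0 w).2 = -(X 0 u).2 := congrArg Prod.snd hw
  have huv1 := huv.1
  have huv2 := huv.2
  simp only at huv1 huv2
  have huniq := (F.crv h0 hD0).unique
    (fun s hs u hu h1 h2 => hemb hs hu (Prod.ext h1 h2)) w v
    (by simp only [hw1, hw2]; linear_combination -huv1)
    (by simp only [hw1, hw2]; linarith)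
  simp only [hw1, hw2] at huniq
  simp only [qf]
  linear_combination huniq
end
end
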